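/- arXiv:1105.3411 — 3 statements merged into one kernel-verified Lean document; each statement's English description precedes it below -/
import Mathlib

section
/- For every γ > 0 there exists an integer n₀ such that for every n ≥ n₀ divisible by 4, every 3-graph H on n vertices with minimum codegree δ₂(H) ≥ (3/4 + γ)·n contains a K₄³-factor. -/
open Finset

/-- `A` is the vertex set of a copy of the hypergraph with vertex type `V` and edge set `EF`
inside the hypergraph on `Fin n` with edge set `E`. -/
def IsCopy {n : ℕ} {V : Type} [Fintype V] [DecidableEq V] (E : Finset (Finset (Fin n)))
    (EF : Finset (Finset V)) (A : Finset (Fin n)) : Prop :=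
  ∃ f : V ↪ Fin n, Finset.map f Finset.univ = A ∧ ∀ e ∈ EF, e.map f ∈ E

/-- The induced subhypergraph of `E` on `S` has an `F`-factor, where `F` has vertex type `V`
and edge set `EF`: there are pairwise vertex-disjoint copies of `F` covering exactly `S`. -/
def HasFactorOn {n : ℕ} {V : Type} [Fintype V] [DecidableEq V] (E : Finset (Finset (Fin n)))
    (EF : Finset (Finset V)) (S : Finset (Fin n)) : Prop :=
  ∃ P : Finset (Finset (Fin n)), (∀ A ∈ P, IsCopy E EF A) ∧
    (P : Set (Finset (Fin n))).PairwiseDisjoint id ∧ P.biUnion id = S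

/-- `x` is `(F, i, η)`-close to `y`. -/
def CloseTo {n : ℕ} {V : Type} [Fintype V] [DecidableEq V] (E : Finset (Finset (Fin n)))
    (EF : Finset (Finset V)) (i : ℕ) (η : ℝ) (x y : Fin n) : Prop :=
  η * (n : ℝ) ^ (i * Fintype.card V - 1) ≤
    (({S : Finset (Fin n) | S.card = i * Fintype.card V - 1 ∧ x ∉ S ∧ y ∉ S ∧
      HasFactorOn E EF (insert x S) ∧ HasFactorOn E EF (insert y S)}).ncard : ℝ)

/-- `H` is `(F, i, η)`-closed. -/
def IsClosedGraph {n : ℕ} {V : Type} [Fintype V] [DecidableEq V] (E : Finset (Finset (Fin n)))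
    (EF : Finset (Finset V)) (i : ℕ) (η : ℝ) : Prop :=
  ∀ x y : Fin n, x ≠ y → CloseTo E EF i η x y

/-- `Ñ_{F,i,η}(x)`: the set of vertices `(F, i, η)`-close to `x`. -/
def Ntilde {n : ℕ} {V : Type} [Fintype V] [DecidableEq V] (E : Finset (Finset (Fin n)))
    (EF : Finset (Finset V)) (i : ℕ) (η : ℝ) (x : Fin n) : Set (Fin n) :=
  {y | CloseTo E EF i η x y}

/-- Degree of the set `T` in the `k`-graph with edge set `E`. -/
noncomputable def degOn {n : ℕ} (E : Finset (Finset (Fin n))) (k : ℕ) (T : Finset (Fin n)) : ℕ :=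
  ({S : Finset (Fin n) | S.card = k - T.card ∧ Disjoint S T ∧ S ∪ T ∈ E}).ncard

/-- Edge set of the complete `k`-graph `K_t^k` on `Fin t`. -/
def cliqueEdges (t k : ℕ) : Finset (Finset (Fin t)) :=
  Finset.powersetCard k (Finset.univ : Finset (Fin t))

/-- Edge set of the complete `k`-partite `k`-graph `K_k^k(m)` with parts of size `m`. -/
def multipartiteEdges (k m : ℕ) : Finset (Finset (Fin k × Fin m)) :=
  Finset.univ.filter (fun e : Finset (Fin k × Fin m) =>
    ∀ i : Fin k, (e.filter (fun v => v.1 = i)).card = 1)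

namespace K43

variable {α : Type*} [DecidableEq α]

/-- `A` spans a complete 3-graph on four vertices. -/
def Tile (E : Finset (Finset α)) (A : Finset α) : Prop :=
  A.card = 4 ∧ ∀ e ⊆ A, e.card = 3 → e ∈ E

/-- `S` can be partitioned into tiles. -/
inductive Tiled (E : Finset (Finset α)) : Finset α → Prop
  | empty : Tiled E ∅
  | union {A S : Finset α} : Tile E A → Tiled E S → Disjoint A S → Tiled E (A ∪ S)

/-- The four vertices `a, b, c, d` span a complete 3-graph. -/
def K4 (E : Finset (Finset α)) (a b c d : α) : Prop :=
  {a, b, c} ∈ E ∧ {a, b, d} ∈ E ∧ {a, c, d} ∈ E ∧ {b, c, d} ∈ E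

/-- The vertices of `V` that do not form an edge with `a` and `b`. -/
def miss (E : Finset (Finset α)) (V : Finset α) (a b : α) : Finset α :=
  V.filter fun v => ({a, b, v} : Finset α) ∉ E

/-- Every pair of vertices of `V` forms an edge with all but at most `D` vertices of `V`. -/
def MissLE (E : Finset (Finset α)) (V : Finset α) (D : ℕ) : Prop :=
  ∀ a ∈ V, ∀ b ∈ V, a ≠ b → (miss E V a b).card ≤ D

theorem Tiled.disjUnion {E : Finset (Finset α)} {S T : Finset α} (hS : Tiled E S)
    (hT : Tiled E T) (h : Disjoint S T) : Tiled E (S ∪ T) := by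
  induction hS with
  | empty => simpa using hT
  | @union A S hA _ hAS ih =>
    rw [disjoint_union_left] at h
    rw [union_assoc]
    exact .union hA (ih h.2) (disjoint_union_right.2 ⟨hAS, h.1⟩)

theorem Tile.tiled {E : Finset (Finset α)} {A : Finset α} (h : Tile E A) : Tiled E A := by
  simpa using Tiled.union h .empty (disjoint_empty_right A)

theorem Tiled.four_dvd {E : Finset (Finset α)} {S : Finset α} (hS : Tiled E S) :
    4 ∣ S.card := by
  induction hS with
  | empty => simp
  | union hA _ h ih =>
    rw [card_union_of_disjoint h, hA.1]
    exact dvd_add dvd_rfl ih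

theorem Tiled.biUnion {ι : Type*} [DecidableEq ι] {E : Finset (Finset α)} (I : Finset ι)
    (S : ι → Finset α) (hS : ∀ i ∈ I, Tiled E (S i))
    (hd : ∀ i ∈ I, ∀ j ∈ I, i ≠ j → Disjoint (S i) (S j)) : Tiled E (I.biUnion S) := by
  induction I using Finset.induction_on with
  | empty => simpa using Tiled.empty
  | insert i I hi ih =>
    rw [biUnion_insert]
    refine (hS i (mem_insert_self i I)).disjUnion
      (ih (fun j hj => hS j (mem_insert_of_mem hj)) fun j hj k hk =>
        hd j (mem_insert_of_mem hj) k (mem_insert_of_mem hk)) ?_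
    rw [disjoint_biUnion_right]
    exact fun j hj => hd i (mem_insert_self i I) j (mem_insert_of_mem hj)
      fun h => hi (h ▸ hj)

theorem ne_of_card_triple {a b c : α} (h : ({a, b, c} : Finset α).card = 3) :
    a ≠ b ∧ a ≠ c ∧ b ≠ c := by
  refine ⟨?_, ?_, ?_⟩ <;> rintro rfl
  · have := card_le_two (a := a) (b := c); simp at h; omega
  · have := card_le_two (a := b) (b := a)
    rw [show ({a, b, a} : Finset α) = {b, a} by ext; simp] at h; omega
  · have := card_le_two (a := a) (b := b); simp at h; omega

theorem MissLE.mono {E : Finset (Finset α)} {V V' : Finset α} {D : ℕ} (h : MissLE E V D)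
    (hV : V' ⊆ V) : MissLE E V' D := fun a ha b hb hab =>
  (card_le_card (filter_subset_filter _ hV)).trans (h a (hV ha) b (hV hb) hab)

theorem triple_rotate (a b c : α) : ({a, b, c} : Finset α) = {b, c, a} := by
  ext; simp; tauto

theorem triple_swap (a b c : α) : ({a, b, c} : Finset α) = {b, a, c} := by
  ext; simp; tauto

theorem card_le_nbr {V : Finset α} {D : ℕ} (hV : MissLE E V D) {a b : α} (ha : a ∈ V)
    (hb : b ∈ V) (hab : a ≠ b) :
    V.card ≤ D + (V.filter fun v => ({a, b, v} : Finset α) ∈ E).card := by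
  have h := hV a ha b hb hab
  have := card_filter_add_card_filter_not (s := V) (fun v => ({a, b, v} : Finset α) ∈ E)
  unfold miss at h
  omega

section Uniform

variable {E : Finset (Finset α)} (hE : ∀ e ∈ E, e.card = 3)
include hE

theorem edge_ne {a b c : α} (h : {a, b, c} ∈ E) : a ≠ b ∧ a ≠ c ∧ b ≠ c :=
  ne_of_card_triple (hE _ h)

theorem K4.tile {a b c d : α} (h : K4 E a b c d) : Tile E {a, b, c, d} := by
  obtain ⟨h1, h2, h3, h4⟩ := h
  obtain ⟨hab, hac, hbc⟩ := edge_ne hE h1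
  obtain ⟨-, had, hbd⟩ := edge_ne hE h2
  obtain ⟨-, -, hcd⟩ := edge_ne hE h3
  have hc : ({a, b, c, d} : Finset α).card = 4 := by
    rw [card_insert_of_notMem (by simp [hab, hac, had]),
      card_insert_of_notMem (by simp [hbc, hbd]), card_pair hcd]
  refine ⟨hc, fun e he hec => ?_⟩
  have h1' : (({a, b, c, d} : Finset α) \ e).card = 1 := by
    rw [card_sdiff_of_subset he]; omega
  obtain ⟨x, hx⟩ := card_eq_one.1 h1'
  have hxm : x ∈ ({a, b, c, d} : Finset α) \ e := by rw [hx]; simp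
  have hee : e = ({a, b, c, d} : Finset α).erase x := by
    rw [← sdiff_singleton_eq_erase, ← hx, Finset.sdiff_sdiff_eq_self he]
  have hx' := (mem_sdiff.1 hxm).1
  simp only [mem_insert, mem_singleton] at hx'
  rcases hx' with rfl | rfl | rfl | rfl
  · rw [hee]; convert h4 using 1; ext; simp; grind
  · rw [hee]; convert h3 using 1; ext; simp; grind
  · rw [hee]; convert h2 using 1; ext; simp; grind
  · rw [hee]; convert h1 using 1; ext; simp; grind

theorem card_le_K4 {V : Finset α} {D : ℕ} (hV : MissLE E V D) {a b c : α} (ha : a ∈ V)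
    (hb : b ∈ V) (hc : c ∈ V) (h : {a, b, c} ∈ E) [DecidablePred (K4 E a b c)] :
    V.card ≤ 3 * D + (V.filter (K4 E a b c)).card := by
  obtain ⟨hab, hac, hbc⟩ := edge_ne hE h
  have hsub : V ⊆ (miss E V a b ∪ miss E V a c ∪ miss E V b c) ∪ V.filter (K4 E a b c) := by
    intro v hv
    simp only [mem_union, miss, mem_filter, K4]
    tauto
  have h1 := card_le_card hsub
  have h2 := card_union_le (miss E V a b ∪ miss E V a c ∪ miss E V b c) (V.filter (K4 E a b c))
  have h3 := card_union_le (miss E V a b ∪ miss E V a c) (miss E V b c)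
  have h4 := card_union_le (miss E V a b) (miss E V a c)
  have := hV a ha b hb hab
  have := hV a ha c hc hac
  have := hV b hb c hc hbc
  omega

open Classical in
theorem card_le_good {V : Finset α} {D : ℕ} (hV : MissLE E V D) {T : Finset α} (hT : T ∈ E)
    (hTV : T ⊆ V) :
    V.card ≤ 3 * D + (V.filter fun z => z ∉ T ∧ Tile E (insert z T)).card := by
  obtain ⟨a, b, c, -, -, -, rfl⟩ := card_eq_three.1 (hE T hT)
  have := card_le_K4 hE hV (hTV (by simp)) (hTV (by simp)) (hTV (by simp)) hT
  refine this.trans (Nat.add_le_add_left (card_le_card fun z hz => ?_) _)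
  rw [mem_filter] at hz ⊢
  have hn1 := edge_ne hE hz.2.2.1
  have hn2 := edge_ne hE hz.2.2.2.1
  refine ⟨hz.1, by simp; grind, ?_⟩
  convert hz.2.tile hE using 1
  ext; simp; tauto

end Uniform
end K43

namespace K43

variable {α : Type*} [DecidableEq α] {E : Finset (Finset α)} {V : Finset α}

/-- However one forbids `u` vertices, some set `S` of at most `s` other vertices can be tiled
together with `x` and can be tiled together with `y`. -/
def Reach (E : Finset (Finset α)) (V : Finset α) (s u : ℕ) (x y : α) : Prop :=
  ∀ U : Finset α, U.card ≤ u → x ∉ U → y ∉ U →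
    ∃ S ⊆ V, Disjoint S U ∧ x ∉ S ∧ y ∉ S ∧ S.card ≤ s ∧
      Tiled E (insert x S) ∧ Tiled E (insert y S)

theorem Reach.symm {s u : ℕ} {x y : α} (h : Reach E V s u x y) : Reach E V s u y x := by
  intro U hU hy hx
  obtain ⟨S, h1, h2, h3, h4, h5, h6, h7⟩ := h U hU hx hy
  exact ⟨S, h1, h2, h4, h3, h5, h7, h6⟩

theorem Reach.mono {s u s' u' : ℕ} {x y : α} (h : Reach E V s u x y) (hs : s ≤ s')
    (hu : u' ≤ u) : Reach E V s' u' x y := by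
  intro U hU hx hy
  obtain ⟨S, h1, h2, h3, h4, h5, h6⟩ := h U (hU.trans hu) hx hy
  exact ⟨S, h1, h2, h3, h4, h5.trans hs, h6⟩

theorem exists_connector {s u k : ℕ} (x y : Fin k → α)
    (hR : ∀ i, Reach E V s u (x i) (y i)) (Z : Finset α) (hx : ∀ i, x i ∈ Z)
    (hy : ∀ i, y i ∈ Z) (hc : Z.card + k * s ≤ u) :
    ∃ B ⊆ V, Disjoint B Z ∧ B.card ≤ k * s ∧ ∀ z : Fin k → α,
      (∀ i, z i = x i ∨ z i = y i) → Function.Injective z →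
        Tiled E (univ.image z ∪ B) := by
  induction k with
  | zero => exact ⟨∅, by simp, by simp, by simp, fun z _ _ => by simpa using Tiled.empty⟩
  | succ k ih =>
    rw [Nat.succ_mul] at hc
    obtain ⟨B, hBV, hBZ, hBc, hB⟩ := ih (Fin.tail x) (Fin.tail y) (fun i => hR i.succ)
      (fun i => hx i.succ) (fun i => hy i.succ) (by omega)
    have hUc : ((Z ∪ B) \ {x 0, y 0}).card ≤ u :=
      (card_le_card sdiff_subset).trans ((card_union_le _ _).trans (by omega))
    obtain ⟨S, hSV, hSU, hxS, hyS, hSc, hTx, hTy⟩ := hR 0 _ hUc (by simp) (by simp)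
    have hS : Disjoint S (Z ∪ B) := by
      rw [disjoint_left] at hSU ⊢
      intro v hv hv'
      refine hSU hv (mem_sdiff.2 ⟨hv', ?_⟩)
      simp only [mem_insert, mem_singleton, not_or]
      exact ⟨fun h => hxS (h ▸ hv), fun h => hyS (h ▸ hv)⟩
    rw [disjoint_union_right] at hS
    refine ⟨S ∪ B, union_subset hSV hBV, disjoint_union_left.2 ⟨hS.1, hBZ⟩,
      (card_union_le _ _).trans (by rw [Nat.succ_mul]; omega), fun z hz hzi => ?_⟩
    have h0 : Tiled E (insert (z 0) S) := by
      rcases hz 0 with h | h <;> rw [h] <;> assumption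
    have h1 := hB (Fin.tail z) (fun i => hz i.succ) fun i j h =>
      Fin.succ_injective _ (hzi h)
    have hzZ : ∀ i, z i ∈ Z := fun i => by
      rcases hz i with h | h <;> rw [h] <;> simp [hx, hy]
    have key := h0.disjUnion h1 (by
      rw [disjoint_insert_left, disjoint_union_right]
      refine ⟨?_, ?_, hS.2⟩
      · simp only [mem_union, mem_image, mem_univ, true_and, not_or, not_exists]
        refine ⟨fun i hi => ?_, fun h => disjoint_left.1 hBZ h (hzZ 0)⟩
        exact Fin.succ_ne_zero i (hzi hi)
      · rw [disjoint_right]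
        intro v hv hvS
        obtain ⟨i, -, rfl⟩ := mem_image.1 hv
        exact disjoint_left.1 hS.1 hvS (hzZ _))
    convert key using 1
    ext v
    simp only [mem_union, mem_image, mem_univ, true_and, mem_insert, Fin.exists_fin_succ,
      Fin.tail]
    grind

theorem Reach.trans_of_card {s u u' : ℕ} {x y : α} (hu : u' + 3 + 2 * s ≤ u)
    {Z : Finset α} (hZV : Z ⊆ V) (hZ : u' + 2 < Z.card)
    (h : ∀ z ∈ Z, Reach E V s u x z ∧ Reach E V s u z y) :
    Reach E V (2 * s + 1) u' x y := by
  intro U hU hxU hyU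
  have hlt : (insert x (insert y U)).card < Z.card :=
    lt_of_le_of_lt ((card_insert_le _ _).trans (Nat.succ_le_succ (card_insert_le _ _))) (by omega)
  obtain ⟨z, hz, hz'⟩ := exists_mem_notMem_of_card_lt_card hlt
  simp only [mem_insert, not_or] at hz'
  obtain ⟨hzx, hzy, hzU⟩ := hz'
  obtain ⟨B, hBV, hBZ, hBc, hB⟩ := exists_connector (k := 2) ![x, z] ![z, y]
    (by simpa [Fin.forall_fin_two] using h z hz) (insert z (insert x (insert y U)))
    (by simp [Fin.forall_fin_two]) (by simp [Fin.forall_fin_two]) (by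
      have h1 := card_insert_le z (insert x (insert y U))
      have h2 := card_insert_le x (insert y U)
      have h3 := card_insert_le y U
      omega)
  simp only [disjoint_insert_right] at hBZ
  obtain ⟨hzB, hxB, hyB, hBU⟩ := hBZ
  refine ⟨insert z B, insert_subset (hZV hz) hBV, disjoint_insert_left.2 ⟨hzU, hBU⟩,
    by simp [hxB, Ne.symm hzx], by simp [hyB, Ne.symm hzy],
    (card_insert_le _ _).trans (by omega), ?_, ?_⟩
  · convert hB ![x, z] (by simp) (by
      intro i j; fin_cases i <;> fin_cases j <;> simp [hzx, Ne.symm hzx]) using 1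
    ext v; simp [Fin.exists_fin_two]; grind
  · convert hB ![z, y] (by simp) (by
      intro i j; fin_cases i <;> fin_cases j <;> simp [hzy, Ne.symm hzy]) using 1
    ext v; simp [Fin.exists_fin_two]; grind

end K43

namespace K43

variable {α : Type*} [DecidableEq α] {E : Finset (Finset α)} {V : Finset α} {D : ℕ}

theorem exists_triple (hE : ∀ e ∈ E, e.card = 3) (hV : MissLE E V D) {x : α} (hx : x ∈ V)
    (hN : 3 * D + 2 ≤ V.card) : ∃ T ∈ E, T ⊆ V ∧ x ∉ T ∧ Tile E (insert x T) := by
  classical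
  obtain ⟨a, ha, hax⟩ := exists_mem_ne (show 1 < V.card by omega) x
  have h1 := card_le_nbr hV hx ha (Ne.symm hax)
  obtain ⟨b, hb⟩ := card_pos.1 (show 0 < (V.filter fun v => ({x, a, v} : Finset α) ∈ E).card by
    omega)
  rw [mem_filter] at hb
  have h2 := card_le_K4 hE hV hx ha hb.1 hb.2
  obtain ⟨c, hc⟩ := card_pos.1 (show 0 < (V.filter (K4 E x a b)).card by omega)
  rw [mem_filter] at hc
  have hn := edge_ne hE hc.2.1
  have hn' := edge_ne hE hc.2.2.1
  refine ⟨{a, b, c}, hc.2.2.2.2, ?_, ?_, hc.2.tile hE⟩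
  · simp [insert_subset_iff, ha, hb.1, hc.1]
  · simp; grind

theorem exists_disjoint_triples (hE : ∀ e ∈ E, e.card = 3) (hV : MissLE E V D) {x : α}
    (hx : x ∈ V) (M : ℕ) (hN : 3 * D + 3 * M + 2 ≤ V.card) :
    ∃ 𝒯 : Finset (Finset α), 𝒯.card = M ∧ (𝒯 : Set (Finset α)).PairwiseDisjoint id ∧
      ∀ T ∈ 𝒯, T ∈ E ∧ T ⊆ V ∧ x ∉ T ∧ Tile E (insert x T) := by
  induction M with
  | zero => exact ⟨∅, by simp, by simp, by simp⟩
  | succ M ih =>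
    obtain ⟨𝒯, hc, hd, h𝒯⟩ := ih (by omega)
    have hU : (𝒯.biUnion id).card ≤ M * 3 := hc ▸
      card_biUnion_le_card_mul _ _ _ fun T hT => (hE T (h𝒯 T hT).1).le
    have hxU : x ∉ 𝒯.biUnion id := by
      simp only [mem_biUnion, id, not_exists, not_and]
      exact fun T hT => (h𝒯 T hT).2.2.1
    have hcard := le_card_sdiff (𝒯.biUnion id) V
    obtain ⟨T, hTE, hTV, hxT, hT⟩ := exists_triple hE (hV.mono (sdiff_subset (t := 𝒯.biUnion id)))
      (mem_sdiff.2 ⟨hx, hxU⟩) (by omega)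
    have hdT : ∀ T' ∈ 𝒯, Disjoint T T' := fun T' hT' =>
      disjoint_of_subset_right (subset_biUnion_of_mem id hT')
        (disjoint_of_subset_left hTV sdiff_disjoint)
    have hT𝒯 : T ∉ 𝒯 := fun h => by
      have h1 := hE T hTE
      rw [disjoint_self.1 (hdT T h)] at h1
      simp at h1
    refine ⟨insert T 𝒯, by rw [card_insert_of_notMem hT𝒯, hc], ?_, ?_⟩
    · rw [coe_insert, Set.pairwiseDisjoint_insert]
      exact ⟨hd, fun T' hT' _ => hdT T' hT'⟩
    · intro T' hT'
      rcases mem_insert.1 hT' with rfl | h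
      · exact ⟨hTE, hTV.trans sdiff_subset, hxT, hT⟩
      · exact h𝒯 T' h

open Classical in
theorem card_reach (hE : ∀ e ∈ E, e.card = 3) (hV : MissLE E V D) {x : α}
    (hx : x ∈ V) (u M : ℕ) (hN : 3 * D + 3 * M + 2 ≤ V.card) :
    M * V.card ≤ M * (3 * D + (V.filter (Reach E V 3 u x)).card) + u * V.card := by
  obtain ⟨𝒯, hc, hd, h𝒯⟩ := exists_disjoint_triples hE hV hx M hN
  let r : Finset α → α → Prop := fun T z => z ∉ T ∧ Tile E (insert z T)
  have hdc := sum_card_bipartiteAbove_eq_sum_card_bipartiteBelow (s := 𝒯) (t := V) r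
  have h1 : M * V.card ≤ M * (3 * D) + ∑ T ∈ 𝒯, (V.bipartiteAbove r T).card := by
    rw [← hc, ← smul_eq_mul, ← smul_eq_mul, ← sum_const, ← sum_const, ← sum_add_distrib]
    exact sum_le_sum fun T hT => card_le_good hE hV (h𝒯 T hT).1 (h𝒯 T hT).2.1
  have h2 : ∀ z, u < (𝒯.bipartiteBelow r z).card → Reach E V 3 u x z := by
    intro z hz U hU hxU hzU
    by_contra! hcon
    have : (𝒯.bipartiteBelow r z).card ≤ ((𝒯.bipartiteBelow r z).biUnion (· ∩ U)).card := by
      refine card_le_card_biUnion (fun T hT T' hT' hTT' => ?_) fun T hT => ?_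
      · exact disjoint_of_subset_left inter_subset_left (disjoint_of_subset_right inter_subset_left
          (hd (mem_filter.1 hT).1 (mem_filter.1 hT').1 hTT'))
      · obtain ⟨hT, hzT, hTz⟩ := mem_filter.1 hT
        rw [← not_disjoint_iff_nonempty_inter]
        intro hTU
        obtain ⟨h3, h4, h5, h6⟩ := h𝒯 T hT
        exact hcon T h4 hTU h5 hzT (hE T h3).le h6.tiled hTz.tiled
    have h3 : (𝒯.bipartiteBelow r z).biUnion (· ∩ U) ⊆ U :=
      biUnion_subset.2 fun T _ => inter_subset_right
    have := card_le_card h3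
    omega
  have h3 : ∑ z ∈ V, (𝒯.bipartiteBelow r z).card
      ≤ (V.filter (Reach E V 3 u x)).card * M + V.card * u := by
    rw [← sum_filter_add_sum_filter_not V (Reach E V 3 u x)]
    refine Nat.add_le_add (sum_le_card_nsmul _ _ _ fun z _ => ?_) ?_
    · exact (card_le_card (filter_subset _ _)).trans hc.le
    · refine (sum_le_card_nsmul _ _ u fun z hz => ?_).trans
        (Nat.mul_le_mul_right _ (card_le_card (filter_subset _ _)))
      by_contra! h
      exact (mem_filter.1 hz).2 (h2 z h)
  nlinarith

end K43

namespace K43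

variable {α : Type*} [DecidableEq α] {E : Finset (Finset α)} {V : Finset α} {D : ℕ}

theorem K4.swap {a b c d : α} (h : K4 E a b c d) : K4 E a b d c := by
  unfold K4 at *
  rw [triple_rotate a d c, triple_swap d c a, triple_rotate b d c, triple_swap d c b,
    ← triple_rotate a c d, ← triple_rotate b c d]
  tauto

theorem K4.rotate {a b c d : α} (h : K4 E a b c d) : K4 E b c d a := by
  unfold K4 at *
  rw [← triple_rotate a b c, ← triple_rotate a b d, ← triple_rotate a c d]
  tauto

section Count

/-- The number of triples in `P × Q × R` that do not form an edge. -/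
def nonEdges (E : Finset (Finset α)) (P Q R : Finset α) : ℕ :=
  ∑ x ∈ P, ∑ y ∈ Q, ∑ z ∈ R, if ({x, y, z} : Finset α) ∈ E then 0 else 1

theorem nonEdges_swap (P Q R : Finset α) : nonEdges E P Q R = nonEdges E Q P R := by
  unfold nonEdges
  rw [sum_comm]
  simp_rw [triple_swap]

theorem nonEdges_rotate (P Q R : Finset α) : nonEdges E P Q R = nonEdges E Q R P := by
  unfold nonEdges
  rw [sum_comm]
  refine sum_congr rfl fun y _ => ?_
  rw [sum_comm]
  simp_rw [triple_rotate _ y]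

theorem nonEdges_add_le (hV : MissLE E V D) {A B P Q : Finset α} (hAB : Disjoint A B)
    (hU : A ∪ B = V) (hP : P ⊆ V) (hQ : Q ⊆ V) :
    nonEdges E P Q A + nonEdges E P Q B
      ≤ D * (P.card * Q.card) + (P ∩ Q).card * V.card := by
  unfold nonEdges
  have h1 : ∀ x y : α, (∑ z ∈ A, if ({x, y, z} : Finset α) ∈ E then 0 else 1)
      + (∑ z ∈ B, if ({x, y, z} : Finset α) ∈ E then 0 else 1) = (miss E V x y).card := by
    intro x y
    rw [← sum_union hAB, hU, miss, card_filter]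
    exact sum_congr rfl fun z _ => by split_ifs <;> simp_all
  simp_rw [← sum_add_distrib, h1]
  calc ∑ x ∈ P, ∑ y ∈ Q, (miss E V x y).card
      ≤ ∑ x ∈ P, ∑ y ∈ Q, (D + if x = y then V.card else 0) := by
        refine sum_le_sum fun x hx => sum_le_sum fun y hy => ?_
        split_ifs with h
        · exact (card_le_card (filter_subset _ _)).trans (Nat.le_add_left _ _)
        · exact hV x (hP hx) y (hQ hy) h
    _ = _ := by
        simp only [sum_add_distrib, sum_const, smul_eq_mul, sum_ite_eq, ← sum_filter,
          filter_mem_eq_inter]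
        ring

theorem card_mul_le_nonEdges {P Q R S : Finset α}
    (h : ∀ w ∈ P, ∀ x ∈ Q, ∀ y ∈ R, ∀ z ∈ S, ¬ K4 E w x y z) :
    P.card * Q.card * R.card * S.card ≤ nonEdges E P Q R * S.card + nonEdges E P Q S * R.card
      + nonEdges E P R S * Q.card + nonEdges E Q R S * P.card := by
  let f : α → α → α → ℕ := fun x y z => if ({x, y, z} : Finset α) ∈ E then 0 else 1
  calc P.card * Q.card * R.card * S.card
      = ∑ w ∈ P, ∑ x ∈ Q, ∑ y ∈ R, ∑ z ∈ S, 1 := by simp [mul_assoc]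
    _ ≤ ∑ w ∈ P, ∑ x ∈ Q, ∑ y ∈ R, ∑ z ∈ S, (f w x y + f w x z + f w y z + f x y z) := by
        refine sum_le_sum fun w hw => sum_le_sum fun x hx => sum_le_sum fun y hy =>
          sum_le_sum fun z hz => ?_
        have := h w hw x hx y hy z hz
        simp only [K4, f] at *
        grind
    _ = _ := by
        simp only [sum_add_distrib, sum_const, smul_eq_mul, nonEdges, f, sum_mul, mul_sum]
        simp only [mul_comm]

theorem false_of_odd (hV : MissLE E V D) (hN : 4 * D + 9 ≤ V.card) {A B : Finset α}
    (hAB : Disjoint A B) (hU : A ∪ B = V) (hA : 0 < A.card) (hB : 0 < B.card)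
    (h0 : ∀ w ∈ A, ∀ x ∈ A, ∀ y ∈ A, ∀ z ∈ A, ¬ K4 E w x y z)
    (h2 : ∀ w ∈ A, ∀ x ∈ A, ∀ y ∈ B, ∀ z ∈ B, ¬ K4 E w x y z)
    (h4 : ∀ w ∈ B, ∀ x ∈ B, ∀ y ∈ B, ∀ z ∈ B, ¬ K4 E w x y z) : False := by
  have hAV : A ⊆ V := hU ▸ subset_union_left
  have hBV : B ⊆ V := hU ▸ subset_union_right
  have e0 := card_mul_le_nonEdges h0
  have e2 := card_mul_le_nonEdges h2
  have e4 := card_mul_le_nonEdges h4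
  have d0 := nonEdges_add_le hV hAB hU hAV hAV
  have d2 := nonEdges_add_le hV hAB hU hBV hBV
  have hc : A.card + B.card = V.card := by rw [← hU, card_union_of_disjoint hAB]
  rw [inter_self] at d0 d2
  rw [nonEdges_rotate B B A, nonEdges_rotate B A B] at d2
  set a := A.card
  set b := B.card
  set m0 := nonEdges E A A A
  set m1 := nonEdges E A A B
  set m2 := nonEdges E A B B
  set m3 := nonEdges E B B B
  rw [← hc] at hN d0 d2
  zify at *
  have e0' : (a : ℤ) ^ 3 ≤ 4 * m0 := by
    have : (a : ℤ) * a ^ 3 ≤ a * (4 * m0) := by linarith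
    exact le_of_mul_le_mul_left this hA
  have e4' : (b : ℤ) ^ 3 ≤ 4 * m3 := by
    have : (b : ℤ) * b ^ 3 ≤ b * (4 * m3) := by linarith
    exact le_of_mul_le_mul_left this hB
  have k1 : (4 : ℤ) * m1 ≤ 4 * (D * (a * a)) + 4 * (a * (a + b)) - a ^ 3 := by linarith
  have k2 : (4 : ℤ) * m2 ≤ 4 * (D * (b * b)) + 4 * (b * (a + b)) - b ^ 3 := by linarith
  have k3 := mul_le_mul_of_nonneg_left k1 hB.le
  have k4 := mul_le_mul_of_nonneg_left k2 hA.le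
  have hab : (0 : ℤ) < a * b := mul_pos hA hB
  have k5 : (a * b : ℤ) * (a + b) ^ 2 ≤ (a * b) * ((a + b) * (4 * D + 8)) := by
    linarith
  have k6 := le_of_mul_le_mul_left k5 hab
  rw [pow_two] at k6
  have k7 := le_of_mul_le_mul_left k6 (by linarith)
  linarith

theorem false_of_even (hV : MissLE E V D) (hN : 4 * D + 17 ≤ V.card) {A B : Finset α}
    (hAB : Disjoint A B) (hU : A ∪ B = V) (hA : V.card < 4 * A.card) (hB : V.card < 4 * B.card)
    (h1 : ∀ w ∈ A, ∀ x ∈ A, ∀ y ∈ A, ∀ z ∈ B, ¬ K4 E w x y z)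
    (h3 : ∀ w ∈ A, ∀ x ∈ B, ∀ y ∈ B, ∀ z ∈ B, ¬ K4 E w x y z) : False := by
  have hAV : A ⊆ V := hU ▸ subset_union_left
  have hBV : B ⊆ V := hU ▸ subset_union_right
  have e1 := card_mul_le_nonEdges h1
  have e3 := card_mul_le_nonEdges h3
  have d0 := nonEdges_add_le hV hAB hU hAV hAV
  have d1 := nonEdges_add_le hV hAB hU hAV hBV
  have d2 := nonEdges_add_le hV hAB hU hBV hBV
  have hc : A.card + B.card = V.card := by rw [← hU, card_union_of_disjoint hAB]
  rw [inter_self] at d0 d2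
  rw [disjoint_iff_inter_eq_empty.1 hAB, nonEdges_swap A B A, nonEdges_rotate B A A] at d1
  rw [nonEdges_rotate B B A, nonEdges_rotate B A B] at d2
  set a := A.card
  set b := B.card
  set m0 := nonEdges E A A A
  set m1 := nonEdges E A A B
  set m2 := nonEdges E A B B
  set m3 := nonEdges E B B B
  rw [← hc] at hN hA hB d0 d2
  have ha0 : 0 < a := by omega
  have hb0 : 0 < b := by omega
  simp only [card_empty, zero_mul, add_zero] at d1
  zify at *
  have hab : (0 : ℤ) < a * b := mul_pos ha0 hb0
  have k1 : (3 * a - b : ℤ) * (a ^ 2 * b) < (3 * a - b) * (4 * m1) := by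
    have f1 := mul_le_mul_of_nonneg_left d0 hb0.le
    have f2 := mul_le_mul_of_nonneg_left hN (mul_pos ha0 hab).le
    have f3 := mul_lt_mul_of_pos_left hA hab
    have f4 := mul_pos ha0 hab
    linarith
  have k2 : (3 * b - a : ℤ) * (b ^ 2 * a) < (3 * b - a) * (4 * m2) := by
    have f1 := mul_le_mul_of_nonneg_left d2 ha0.le
    have f2 := mul_le_mul_of_nonneg_left hN (mul_pos hb0 hab).le
    have f3 := mul_lt_mul_of_pos_left hB hab
    have f4 := mul_pos hb0 hab
    linarith
  have k3 := lt_of_mul_lt_mul_left k1 (by linarith)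
  have k4 := lt_of_mul_lt_mul_left k2 (by linarith)
  have k5 := mul_le_mul_of_nonneg_left hN hab.le
  linarith

end Count
end K43

namespace K43

variable {α β : Type*} [DecidableEq α] [DecidableEq β] {E : Finset (Finset α)} {V : Finset α}
  {D : ℕ} {col : α → β} {Y : Finset β}

/-- The colours of three vertices of a `K4` in `V` determine the colour of the fourth one. -/
def ColorDetermined (E : Finset (Finset α)) (V : Finset α) (col : α → β) : Prop :=
  ∀ a ∈ V, ∀ b ∈ V, ∀ c ∈ V, ∀ d ∈ V, ∀ a' ∈ V, ∀ b' ∈ V, ∀ c' ∈ V, ∀ d' ∈ V,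
    K4 E a b c d → K4 E a' b' c' d' → col a = col a' → col b = col b' → col c = col c' →
      col d = col d'

theorem exists_edge_color (hV : MissLE E V D) (hN : 4 * D ≤ V.card)
    (hcl : ∀ y ∈ Y, V.card < 4 * (V.filter (col · = y)).card) {x y : α} (hx : x ∈ V)
    (hy : y ∈ V) (hxy : x ≠ y) {j : β} (hj : j ∈ Y) :
    ∃ c ∈ V, col c = j ∧ {x, y, c} ∈ E := by
  by_contra! h
  have h1 := hcl j hj
  have h2 : (V.filter (col · = j)).card ≤ (miss E V x y).card := by
    refine card_le_card fun v hv => ?_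
    rw [mem_filter] at hv
    exact mem_filter.2 ⟨hv.1, h v hv.1 hv.2⟩
  have h3 := hV x hx y hy hxy
  omega

theorem exists_K4 (hE : ∀ e ∈ E, e.card = 3) (hV : MissLE E V D) (hN : 3 * D < V.card)
    {a b c : α} (ha : a ∈ V) (hb : b ∈ V) (hc : c ∈ V) (h : {a, b, c} ∈ E) :
    ∃ d ∈ V, K4 E a b c d := by
  classical
  have h1 := card_le_K4 hE hV ha hb hc h
  obtain ⟨d, hd⟩ := card_pos.1 (show 0 < (V.filter (K4 E a b c)).card by omega)
  exact ⟨d, (mem_filter.1 hd).1, (mem_filter.1 hd).2⟩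

theorem exists_forced_color (hE : ∀ e ∈ E, e.card = 3) (hV : MissLE E V D)
    (hN : 4 * D < V.card) (hcol : ∀ v ∈ V, col v ∈ Y)
    (hcl : ∀ y ∈ Y, V.card < 4 * (V.filter (col · = y)).card)
    (hdet : ColorDetermined E V col) {x y : α} (hx : x ∈ V)
    (hy : y ∈ V) (hxy : x ≠ y) {k : β} (hk : k ∈ Y) :
    ∃ c ∈ V, {x, y, c} ∈ E ∧ ∀ d ∈ V, K4 E x y c d → col d = k := by
  have h1 : ∀ j : β, ∃ c d : α, j ∈ Y → c ∈ V ∧ d ∈ V ∧ col c = j ∧ K4 E x y c d := by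
    intro j
    by_cases hj : j ∈ Y
    · obtain ⟨c, hc, hcj, he⟩ := exists_edge_color hV hN.le hcl hx hy hxy hj
      obtain ⟨d, hd, h⟩ := exists_K4 hE hV (by omega) hx hy hc he
      exact ⟨c, d, fun _ => ⟨hc, hd, hcj, h⟩⟩
    · exact ⟨x, x, fun h => absurd h hj⟩
  choose c d hcd using h1
  have hinj : Set.InjOn (fun j => col (d j)) Y := by
    intro j hj j' hj' h
    obtain ⟨hc, hd, hcj, hK⟩ := hcd j hj
    obtain ⟨hc', hd', hcj', hK'⟩ := hcd j' hj'
    rw [← hcj, ← hcj']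
    exact hdet x hx y hy _ hd _ hc x hx y hy _ hd' _ hc' hK.swap hK'.swap rfl rfl h
  obtain ⟨j, hj, hjk⟩ := surjOn_of_injOn_of_card_le (fun j => col (d j))
    (fun j hj => hcol _ (hcd j hj).2.1) hinj le_rfl hk
  obtain ⟨hc, hd, -, hK⟩ := hcd j hj
  exact ⟨c j, hc, hK.1, fun d' hd' hK' => hjk ▸
    hdet x hx y hy _ hc _ hd' x hx y hy _ hc _ hd hK' hK rfl rfl rfl⟩

theorem card_le_colorClass (hE : ∀ e ∈ E, e.card = 3) (hV : MissLE E V D)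
    (hN : 4 * D + 2 ≤ V.card) (hcol : ∀ v ∈ V, col v ∈ Y)
    (hcl : ∀ y ∈ Y, V.card < 4 * (V.filter (col · = y)).card)
    (hdet : ColorDetermined E V col) (hY : 2 ≤ Y.card) {i : β} (hi : i ∈ Y) :
    3 * V.card ≤ 9 * D + 2 * (V.filter (col · = i)).card := by
  classical
  have key : ∀ x ∈ V, ∀ y ∈ V, x ≠ y → V.card ≤
      3 * D + ((V.filter (col · = i)).filter fun v => ({x, y, v} : Finset α) ∈ E).card := by
    intro x hx y hy hxy
    obtain ⟨c, hc, he, hf⟩ := exists_forced_color hE hV (by omega) hcol hcl hdet hx hy hxy hi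
    have h1 := card_le_K4 hE hV hx hy hc he
    refine h1.trans (Nat.add_le_add_left (card_le_card fun v hv => ?_) _)
    rw [mem_filter] at hv
    exact mem_filter.2 ⟨mem_filter.2 ⟨hv.1, hf v hv.1 hv.2⟩, hv.2.2.1⟩
  obtain ⟨k, hk, hki⟩ := exists_mem_ne (show 1 < Y.card by omega) i
  obtain ⟨x, hx, y, hy, hxy⟩ := one_lt_card.1 (show 1 < V.card by omega)
  obtain ⟨c, hc, he, hf⟩ := exists_forced_color hE hV (by omega) hcol hcl hdet hx hy hxy hk
  obtain ⟨-, hxc, hyc⟩ := edge_ne hE he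
  have k1 := key x hx y hy hxy
  have k2 := key x hx c hc hxc
  have k3 := key y hy c hc hyc
  have h : ∑ v ∈ V.filter (col · = i), ((if ({x, y, v} : Finset α) ∈ E then 1 else 0)
      + (if ({x, c, v} : Finset α) ∈ E then 1 else 0)
      + (if ({y, c, v} : Finset α) ∈ E then 1 else 0)) ≤ ∑ v ∈ V.filter (col · = i), 2 := by
    refine sum_le_sum fun v hv => ?_
    rw [mem_filter] at hv
    have h1 : ¬ K4 E x y c v := fun h => hki ((hf v hv.1 h).symm.trans hv.2)
    simp only [K4] at h1
    grind
  simp only [sum_add_distrib, ← card_filter, sum_const, smul_eq_mul] at h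
  omega

theorem false_of_three_le (hE : ∀ e ∈ E, e.card = 3) (hV : MissLE E V D)
    (hN : 4 * D + 2 ≤ V.card) (hcol : ∀ v ∈ V, col v ∈ Y)
    (hcl : ∀ y ∈ Y, V.card < 4 * (V.filter (col · = y)).card)
    (hdet : ColorDetermined E V col) (hY : 3 ≤ Y.card) : False := by
  have h1 : ∑ i ∈ Y, 3 * V.card ≤ ∑ i ∈ Y, (9 * D + 2 * (V.filter (col · = i)).card) :=
    sum_le_sum fun i hi => card_le_colorClass hE hV hN hcol hcl hdet (by omega) hi
  rw [sum_add_distrib, ← mul_sum _ _ 2, ← card_eq_sum_card_fiberwise hcol] at h1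
  simp only [sum_const, smul_eq_mul] at h1
  nlinarith

theorem false_of_two (hE : ∀ e ∈ E, e.card = 3) (hV : MissLE E V D)
    (hN : 4 * D + 17 ≤ V.card) (hcol : ∀ v ∈ V, col v ∈ Y)
    (hcl : ∀ y ∈ Y, V.card < 4 * (V.filter (col · = y)).card)
    (hdet : ColorDetermined E V col) (hY : Y.card = 2) : False := by
  obtain ⟨p, q, hpq, rfl⟩ := card_eq_two.1 hY
  have hp := hcl p (by simp)
  have hq := hcl q (by simp)
  have hAB : Disjoint (V.filter (col · = p)) (V.filter (col · = q)) :=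
    disjoint_filter.2 fun v _ h1 h2 => hpq (h1.symm.trans h2)
  have hU : V.filter (col · = p) ∪ V.filter (col · = q) = V := by
    ext v
    have := hcol v
    simp only [mem_union, mem_filter, mem_insert, mem_singleton] at *
    tauto
  have mA : ∀ v, v ∈ V.filter (col · = p) ↔ v ∈ V ∧ col v = p := fun v => mem_filter
  have mB : ∀ v, v ∈ V.filter (col · = q) ↔ v ∈ V ∧ col v = q := fun v => mem_filter
  obtain ⟨a, ha, a', ha', haa⟩ := one_lt_card.1
    (show 1 < (V.filter (col · = p)).card by omega)
  obtain ⟨b, hb, b', hb', hbb⟩ := one_lt_card.1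
    (show 1 < (V.filter (col · = q)).card by omega)
  rw [mA] at ha ha'
  rw [mB] at hb hb'
  obtain ⟨c, hc, hcq, he⟩ := exists_edge_color hV (by omega) hcl ha.1 ha'.1 haa
    (show q ∈ {p, q} by simp)
  obtain ⟨d, hd, hK⟩ := exists_K4 hE hV (by omega) ha.1 ha'.1 hc he
  have hdc := hcol d hd
  simp only [mem_insert, mem_singleton] at hdc
  rcases hdc with hdp | hdq
  · have h2 : ∀ w ∈ V.filter (col · = p), ∀ x ∈ V.filter (col · = p),
        ∀ y ∈ V.filter (col · = q), ∀ z ∈ V.filter (col · = q), ¬ K4 E w x y z := by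
      intro w hw x hx y hy z hz h
      rw [mA] at hw hx
      rw [mB] at hy hz
      have := hdet w hw.1 x hx.1 y hy.1 z hz.1 a ha.1 a' ha'.1 c hc d hd h hK
        (by rw [hw.2, ha.2]) (by rw [hx.2, ha'.2]) (by rw [hy.2, hcq])
      exact hpq (by rw [← hdp, ← this, hz.2])
    obtain ⟨c', hc', hcq', he'⟩ := exists_edge_color hV (by omega) hcl hb.1 hb'.1 hbb
      (show p ∈ {p, q} by simp)
    obtain ⟨d', hd', hK'⟩ := exists_K4 hE hV (by omega) hb.1 hb'.1 hc' he'
    have hdq' : col d' = q := by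
      have hdc' := hcol d' hd'
      simp only [mem_insert, mem_singleton] at hdc'
      refine hdc'.resolve_left fun h => ?_
      exact h2 c' ((mA _).2 ⟨hc', hcq'⟩) d' ((mA _).2 ⟨hd', h⟩) b ((mB _).2 hb) b' ((mB _).2 hb')
        hK'.rotate.rotate
    refine false_of_odd hV (by omega) hAB hU (by omega) (by omega) ?_ h2 ?_
    · intro w hw x hx y hy z hz h
      rw [mA] at hw hx hy hz
      have := hdet w hw.1 x hx.1 y hy.1 z hz.1 a ha.1 a' ha'.1 d hd c hc h hK.swap
        (by rw [hw.2, ha.2]) (by rw [hx.2, ha'.2]) (by rw [hy.2, hdp])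
      exact hpq (by rw [← hcq, ← this, hz.2])
    · intro w hw x hx y hy z hz h
      rw [mB] at hw hx hy hz
      have := hdet w hw.1 x hx.1 y hy.1 z hz.1 b hb.1 b' hb'.1 d' hd' c' hc' h hK'.swap
        (by rw [hw.2, hb.2]) (by rw [hx.2, hb'.2]) (by rw [hy.2, hdq'])
      exact hpq (by rw [← hcq', ← this, hz.2])
  · refine false_of_even hV hN hAB hU hp hq ?_ ?_
    · intro w hw x hx y hy z hz h
      rw [mA] at hw hx hy
      rw [mB] at hz
      have := hdet w hw.1 x hx.1 z hz.1 y hy.1 a ha.1 a' ha'.1 c hc d hd h.swap hK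
        (by rw [hw.2, ha.2]) (by rw [hx.2, ha'.2]) (by rw [hz.2, hcq])
      exact hpq (by rw [← hdq, ← this, hy.2])
    · intro w hw x hx y hy z hz h
      rw [mA] at hw
      rw [mB] at hx hy hz
      have := hdet y hy.1 z hz.1 w hw.1 x hx.1 c hc d hd a ha.1 a' ha'.1 h.rotate.rotate
        hK.rotate.rotate
        (by rw [hy.2, hcq]) (by rw [hz.2, hdq]) (by rw [hw.2, ha.2])
      exact hpq (by rw [← ha'.2, ← this, hx.2])

theorem false_of_colorDetermined (hE : ∀ e ∈ E, e.card = 3) (hV : MissLE E V D)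
    (hN : 4 * D + 17 ≤ V.card) (hcol : ∀ v ∈ V, col v ∈ Y)
    (hcl : ∀ y ∈ Y, V.card < 4 * (V.filter (col · = y)).card)
    (hdet : ColorDetermined E V col) (hY : 2 ≤ Y.card) : False := by
  rcases hY.eq_or_lt with h | h
  · exact false_of_two hE hV hN hcol hcl hdet h.symm
  · exact false_of_three_le hE hV (by omega) hcol hcl hdet h

end K43

namespace K43

variable {α : Type*} [DecidableEq α] {E : Finset (Finset α)} {V : Finset α} {D : ℕ}

/-- No set of at most `u` vertices meets every `K4` of `A × B × C × P`. -/
def Rich (E : Finset (Finset α)) (u : ℕ) (A B C P : Finset α) : Prop :=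
  ∀ U : Finset α, U.card ≤ u →
    ∃ a ∈ A \ U, ∃ b ∈ B \ U, ∃ c ∈ C \ U, ∃ d ∈ P \ U, K4 E a b c d

theorem card_insert_four_le (a b c d : α) (Z : Finset α) :
    (insert a (insert b (insert c (insert d Z)))).card ≤ Z.card + 4 := by
  have h1 := card_insert_le d Z
  have h2 := card_insert_le c (insert d Z)
  have h3 := card_insert_le b (insert c (insert d Z))
  have h4 := card_insert_le a (insert b (insert c (insert d Z)))
  omega

theorem Rich.reach (hE : ∀ e ∈ E, e.card = 3) {s u u' : ℕ} (hu : u' + 5 * s + 10 ≤ u)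
    {A B C P P' : Finset α} (hA : A ⊆ V) (hB : B ⊆ V) (hC : C ⊆ V) (hP : P ⊆ V) (hP' : P' ⊆ V)
    {i j : α} (hr : Rich E (u' + 6) A B C P) (hr' : Rich E (u' + 6) A B C P')
    (rA : ∀ x ∈ A, ∀ y ∈ A, x ≠ y → Reach E V s u x y)
    (rB : ∀ x ∈ B, ∀ y ∈ B, x ≠ y → Reach E V s u x y)
    (rC : ∀ x ∈ C, ∀ y ∈ C, x ≠ y → Reach E V s u x y)
    (rP : ∀ x ∈ P, x ≠ i → Reach E V s u x i)
    (rP' : ∀ x ∈ P', x ≠ j → Reach E V s u x j) : Reach E V (5 * s + 8) u' i j := by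
  intro U hU hi hj
  have hcU : (insert i (insert j U)).card ≤ u' + 2 :=
    (card_insert_le _ _).trans (Nat.succ_le_succ ((card_insert_le _ _).trans (by omega)))
  obtain ⟨a, ha, b, hb, c, hc, d, hd, hK⟩ := hr (insert i (insert j U)) (by omega)
  have hcU' := card_insert_four_le a b c d (insert i (insert j U))
  obtain ⟨a', ha', b', hb', c', hc', d', hd', hK'⟩ :=
    hr' (insert a (insert b (insert c (insert d (insert i (insert j U)))))) (by omega)
  have hcU'' := card_insert_four_le a' b' c' d'
    (insert a (insert b (insert c (insert d (insert i (insert j U))))))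
  obtain ⟨hab, hac, hbc⟩ := edge_ne hE hK.1
  obtain ⟨-, had, hbd⟩ := edge_ne hE hK.2.1
  obtain ⟨-, -, hcd⟩ := edge_ne hE hK.2.2.1
  obtain ⟨hab', hac', hbc'⟩ := edge_ne hE hK'.1
  obtain ⟨-, had', hbd'⟩ := edge_ne hE hK'.2.1
  obtain ⟨-, -, hcd'⟩ := edge_ne hE hK'.2.2.1
  simp only [mem_sdiff, mem_insert, not_or] at ha hb hc hd ha' hb' hc' hd'
  obtain ⟨W, hWV, hWZ, hWc, hW⟩ := exists_connector (E := E) (V := V) (s := s) (u := u)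
    ![a, b, c, d, j] ![a', b', c', i, d'] (by
      intro l
      fin_cases l
      · exact rA a ha.1 a' ha'.1 (by grind)
      · exact rB b hb.1 b' hb'.1 (by grind)
      · exact rC c hc.1 c' hc'.1 (by grind)
      · exact rP d hd.1 (by grind)
      · exact (rP' d' hd'.1 (by grind)).symm)
    (insert a' (insert b' (insert c' (insert d'
      (insert a (insert b (insert c (insert d (insert i (insert j U))))))))))
    (by intro l; fin_cases l <;> simp) (by intro l; fin_cases l <;> simp) (by omega)
  simp only [disjoint_insert_right] at hWZ
  refine ⟨{a, b, c, d, a', b', c', d'} ∪ W, ?_, ?_, ?_, ?_, ?_, ?_, ?_⟩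
  · refine union_subset ?_ hWV
    simp only [insert_subset_iff, singleton_subset_iff]
    exact ⟨hA ha.1, hB hb.1, hC hc.1, hP hd.1, hA ha'.1, hB hb'.1, hC hc'.1, hP' hd'.1⟩
  · simp only [disjoint_union_left, disjoint_insert_left, disjoint_singleton_left]
    tauto
  · simp only [mem_union, mem_insert, mem_singleton]
    grind
  · simp only [mem_union, mem_insert, mem_singleton]
    grind
  · have h4 : ({a', b', c', d'} : Finset α).card ≤ 4 := card_le_four
    have h8 := card_insert_four_le a b c d {a', b', c', d'}
    have := card_union_le {a, b, c, d, a', b', c', d'} W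
    omega
  · have h := hW ![a', b', c', i, d'] (fun l => Or.inr rfl) (by
      intro l m h
      fin_cases l <;> fin_cases m <;> simp at h ⊢ <;> grind)
    convert (hK.tile hE).tiled.disjUnion h ?_ using 1
    · ext v
      simp [Fin.exists_fin_succ]
      grind
    · rw [disjoint_left]
      simp [Fin.exists_fin_succ]
      grind
  · have h := hW ![a, b, c, d, j] (fun l => Or.inl rfl) (by
      intro l m h
      fin_cases l <;> fin_cases m <;> simp at h ⊢ <;> grind)
    convert (hK'.tile hE).tiled.disjUnion h ?_ using 1
    · ext v
      simp [Fin.exists_fin_succ]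
      grind
    · rw [disjoint_left]
      simp [Fin.exists_fin_succ]
      grind

end K43

namespace K43

variable {α : Type*} [DecidableEq α] {E : Finset (Finset α)} {V : Finset α} {D : ℕ}

/-- Every `r`-subset of `V` contains two distinct vertices that are reachable from each other. -/
def HasReachPair (E : Finset (Finset α)) (V : Finset α) (s u r : ℕ) : Prop :=
  ∀ Y ⊆ V, Y.card = r → ∃ x ∈ Y, ∃ y ∈ Y, x ≠ y ∧ Reach E V s u x y

open Classical in
theorem HasReachPair.down (hE : ∀ e ∈ E, e.card = 3) (hV : MissLE E V D) {s u u' v r g : ℕ}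
    (hs : 3 ≤ s) (hu : u' + 5 * s + 10 ≤ u) (hv : u ≤ v) (hr : 2 ≤ r)
    (hnb : ∀ x ∈ V, V.card + g ≤ 4 * (V.filter (Reach E V 3 v x)).card)
    (hg : 4 * (r ^ 2 * (u' + 2) + r ^ 4 * (u' + 6)) < g) (hN : 4 * D + g + 17 ≤ V.card)
    (h : HasReachPair E V s u (r + 1)) : HasReachPair E V (5 * s + 8) u' r := by
  by_contra hcon
  simp only [HasReachPair, not_forall, not_exists, not_and] at hcon
  obtain ⟨Y, hYV, hYr, hind⟩ := hcon
  have hind' : ∀ x ∈ Y, ∀ y ∈ Y, x ≠ y → ¬ Reach E V s u x y := fun x hx y hy hxy hR =>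
    hind x hx y hy hxy (hR.mono (by omega) (by omega))
  let R : α → α → Prop := fun w y => w = y ∨ Reach E V s u w y
  have hex : ∀ w, ∃ y, w ∈ V → y ∈ Y ∧ R w y := by
    intro w
    by_contra! hw
    have hwV : w ∈ V := (hw w).1
    have hw' : ∀ y ∈ Y, ¬ R w y := fun y hy => (hw y).2 hy
    have hwY : w ∉ Y := fun hwY => hw' w hwY (.inl rfl)
    obtain ⟨x, hx, y, hy, hxy, hR⟩ := h (insert w Y) (insert_subset hwV hYV)
      (by rw [card_insert_of_notMem hwY, hYr])
    rw [mem_insert] at hx hy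
    rcases hx with rfl | hx <;> rcases hy with rfl | hy
    · exact hxy rfl
    · exact hw' y hy (.inr hR)
    · exact hw' x hx (.inr hR.symm)
    · exact hind' x hx y hy hxy hR
  choose col hcol using hex
  let Amb : Finset α := V.filter fun w => ∃ y ∈ Y, y ≠ col w ∧ R w y
  have hAmb : Amb.card ≤ r ^ 2 * (u' + 2) := by
    have hsub : Amb ⊆ (Y ×ˢ Y).biUnion fun q => if q.1 = q.2 then ∅ else
        V.filter fun w => Reach E V s u q.1 w ∧ Reach E V s u w q.2 := by
      intro w hw
      obtain ⟨hwV, y, hy, hyc, hRy⟩ := mem_filter.1 hw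
      obtain ⟨hc, hRc⟩ := hcol w hwV
      have h1 : Reach E V s u w y := hRy.resolve_left fun h1 => by
        subst h1
        exact hind' w hy _ hc hyc (hRc.resolve_left hyc)
      have h2 : Reach E V s u w (col w) := hRc.resolve_left fun h2 => by
        rw [← h2] at hc hyc
        exact hind' w hc y hy hyc.symm h1
      refine mem_biUnion.2 ⟨(y, col w), mem_product.2 ⟨hy, hc⟩, ?_⟩
      rw [if_neg hyc]
      exact mem_filter.2 ⟨hwV, h1.symm, h2⟩
    refine (card_le_card hsub).trans ((card_biUnion_le_card_mul _ _ (u' + 2) ?_).trans ?_)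
    · rintro ⟨y, y'⟩ hq
      rw [mem_product] at hq
      split_ifs with hyy
      · simp
      · by_contra! hlt
        exact hind y hq.1 y' hq.2 hyy ((Reach.trans_of_card (by omega) (filter_subset _ _) hlt
          fun z hz => (mem_filter.1 hz).2).mono (by omega) le_rfl)
    · rw [card_product, hYr, pow_two]
  let W : α → Finset α := fun y => (V \ Amb).filter (col · = y)
  have hWV : ∀ y, W y ⊆ V := fun y => (filter_subset _ _).trans sdiff_subset
  have huniq : ∀ w ∈ V \ Amb, ∀ y ∈ Y, R w y → col w = y := by
    intro w hw y hy hRy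
    rw [mem_sdiff] at hw
    by_contra hne
    exact hw.2 (mem_filter.2 ⟨hw.1, y, hy, Ne.symm hne, hRy⟩)
  have hWR : ∀ y, ∀ w ∈ W y, w ≠ y → Reach E V s u w y := by
    intro y w hw hne
    obtain ⟨hw1, rfl⟩ := mem_filter.1 hw
    exact (hcol w (mem_sdiff.1 hw1).1).2.resolve_left hne
  have hWW : ∀ y, ∀ w ∈ W y, ∀ w' ∈ W y, w ≠ w' → Reach E V s u w w' := by
    intro y w hw w' hw' hne
    rcases eq_or_ne w y with rfl | hwy
    · exact (hWR w w' hw' hne.symm).symm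
    rcases eq_or_ne w' y with rfl | hwy'
    · exact hWR w' w hw hne
    obtain ⟨hw1, hwc⟩ := mem_filter.1 hw
    obtain ⟨hw1', hwc'⟩ := mem_filter.1 hw'
    have hyY : y ∈ Y := hwc ▸ (hcol w (mem_sdiff.1 hw1).1).1
    have hn : ∀ z ∈ Y.erase y, ¬ R w z := fun z hz hRz =>
      (mem_erase.1 hz).1 ((huniq w hw1 z (mem_erase.1 hz).2 hRz).symm.trans hwc)
    have hn' : ∀ z ∈ Y.erase y, ¬ R w' z := fun z hz hRz =>
      (mem_erase.1 hz).1 ((huniq w' hw1' z (mem_erase.1 hz).2 hRz).symm.trans hwc')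
    obtain ⟨a, ha, b, hb, hab, hR⟩ := h (insert w (insert w' (Y.erase y)))
      (insert_subset (hWV y hw) (insert_subset (hWV y hw') ((erase_subset _ _).trans hYV))) (by
        rw [card_insert_of_notMem, card_insert_of_notMem, card_erase_of_mem hyY, hYr]
        · omega
        · exact fun hm => hn' w' hm (.inl rfl)
        · rw [mem_insert, not_or]
          exact ⟨hne, fun hm => hn w hm (.inl rfl)⟩)
    rw [mem_insert, mem_insert] at ha hb
    rcases ha with rfl | rfl | ha <;> rcases hb with rfl | rfl | hb
    · exact absurd rfl hab
    · exact hR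
    · exact absurd (.inr hR) (hn b hb)
    · exact hR.symm
    · exact absurd rfl hab
    · exact absurd (.inr hR) (hn' b hb)
    · exact absurd (.inr hR.symm) (hn a ha)
    · exact absurd (.inr hR.symm) (hn' a ha)
    · exact absurd hR (hind' a (mem_of_mem_erase ha) b (mem_of_mem_erase hb) hab)
  have hhit : ∀ q : α × α × α × α, ∃ U : Finset α, U.card ≤ u' + 6 ∧
      (¬ Rich E (u' + 6) (W q.1) (W q.2.1) (W q.2.2.1) (W q.2.2.2) →
        ∀ a ∈ W q.1 \ U, ∀ b ∈ W q.2.1 \ U, ∀ c ∈ W q.2.2.1 \ U, ∀ d ∈ W q.2.2.2 \ U,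
          ¬ K4 E a b c d) := by
    intro q
    by_cases hq : Rich E (u' + 6) (W q.1) (W q.2.1) (W q.2.2.1) (W q.2.2.2)
    · exact ⟨∅, by simp, fun h' => absurd hq h'⟩
    · have hq' := hq
      unfold Rich at hq'
      push Not at hq'
      obtain ⟨U, hU, hU'⟩ := hq'
      exact ⟨U, hU, fun _ => hU'⟩
  choose Hit hHc hHit using hhit
  set X : Finset α := Amb ∪ (Y ×ˢ Y ×ˢ Y ×ˢ Y).biUnion Hit
  have hXc : X.card ≤ r ^ 2 * (u' + 2) + r ^ 4 * (u' + 6) := by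
    refine (card_union_le _ _).trans (add_le_add hAmb
      ((card_biUnion_le_card_mul _ _ _ fun q _ => hHc q).trans_eq ?_))
    simp only [card_product, hYr]
    ring
  have hVX := le_card_sdiff X V
  have hsd : V \ X ⊆ V \ Amb := sdiff_subset_sdiff subset_rfl subset_union_left
  refine false_of_colorDetermined (V := V \ X) (col := col) (Y := Y) hE
    (hV.mono sdiff_subset) (by omega) (fun w hw => (hcol w (mem_sdiff.1 hw).1).1) ?_ ?_ (by omega)
  · intro y hy
    have hsub : V.filter (Reach E V 3 v y) \ X ⊆ (V \ X).filter (col · = y) := by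
      intro w hw
      rw [mem_sdiff, mem_filter] at hw
      have hw' := mem_sdiff.2 ⟨hw.1.1, hw.2⟩
      exact mem_filter.2 ⟨hw', huniq w (hsd hw') y hy (.inr (hw.1.2.symm.mono hs hv))⟩
    have h1 := card_le_card hsub
    have h2 := le_card_sdiff X (V.filter (Reach E V 3 v y))
    have h3 := hnb y (hYV hy)
    have h4 : (V \ X).card ≤ V.card := card_le_card sdiff_subset
    omega
  · have hrich : ∀ a ∈ V \ X, ∀ b ∈ V \ X, ∀ c ∈ V \ X, ∀ d ∈ V \ X, K4 E a b c d →
        Rich E (u' + 6) (W (col a)) (W (col b)) (W (col c)) (W (col d)) := by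
      intro a ha b hb c hc d hd hK
      by_contra hnr
      have hsub : Hit (col a, col b, col c, col d) ⊆ X :=
        (subset_biUnion_of_mem Hit (by
          simp only [mem_product]
          exact ⟨(hcol a (mem_sdiff.1 ha).1).1, (hcol b (mem_sdiff.1 hb).1).1,
            (hcol c (mem_sdiff.1 hc).1).1, (hcol d (mem_sdiff.1 hd).1).1⟩)).trans
          subset_union_right
      have hm : ∀ z ∈ V \ X, z ∈ W (col z) \ Hit (col a, col b, col c, col d) := fun z hz =>
        mem_sdiff.2 ⟨mem_filter.2 ⟨hsd hz, rfl⟩, fun hz' => (mem_sdiff.1 hz).2 (hsub hz')⟩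
      exact hHit (col a, col b, col c, col d) hnr a (hm a ha) b (hm b hb) c (hm c hc) d
        (hm d hd) hK
    intro a ha b hb c hc d hd a' ha' b' hb' c' hc' d' hd' hK hK' h1 h2 h3
    by_contra hne
    have r1 := hrich a ha b hb c hc d hd hK
    have r2 := hrich a' ha' b' hb' c' hc' d' hd' hK'
    rw [← h1, ← h2, ← h3] at r2
    exact hind _ (hcol d (mem_sdiff.1 hd).1).1 _ (hcol d' (mem_sdiff.1 hd').1).1 hne
      (Rich.reach hE hu (hWV _) (hWV _) (hWV _) (hWV _) (hWV _) r1 r2 (hWW _) (hWW _) (hWW _)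
        (hWR _) (hWR _))

end K43

namespace K43

variable {α : Type*} [DecidableEq α] {E : Finset (Finset α)} {V : Finset α} {D : ℕ}

open Classical in
theorem hasReachPair_four {u v g : ℕ} (hv : u + 9 ≤ v)
    (hnb : ∀ x ∈ V, V.card + g ≤ 4 * (V.filter (Reach E V 3 v x)).card)
    (hg : 64 * (u + 2) < g) : HasReachPair E V 7 u 4 := by
  intro Y hYV hY
  by_contra! hind
  let Z : α → Finset α := fun x => V.filter (Reach E V 3 v x)
  let I : Finset α := (Y ×ˢ Y).biUnion fun q => if q.1 = q.2 then ∅ else Z q.1 ∩ Z q.2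
  have hI : I.card ≤ 16 * (u + 2) := by
    refine (card_biUnion_le_card_mul _ _ (u + 2) ?_).trans_eq (by rw [card_product, hY])
    rintro ⟨x, y⟩ hq
    rw [mem_product] at hq
    split_ifs with hxy
    · simp
    · by_contra! hlt
      refine hind x hq.1 y hq.2 hxy (Reach.trans_of_card (s := 3) (by omega)
        (inter_subset_left.trans (filter_subset _ _)) hlt fun z hz => ?_)
      rw [mem_inter, mem_filter, mem_filter] at hz
      exact ⟨hz.1.2, hz.2.2.symm⟩
  have hd : (Y : Set α).PairwiseDisjoint fun x => Z x \ I := by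
    intro x hx y hy hxy
    refine disjoint_left.2 fun z hz hz' => ?_
    rw [mem_sdiff] at hz hz'
    refine hz.2 (mem_biUnion.2 ⟨(x, y), mem_product.2 ⟨hx, hy⟩, ?_⟩)
    rw [if_neg hxy]
    exact mem_inter.2 ⟨hz.1, hz'.1⟩
  have h1 : (Y.biUnion fun x => Z x \ I).card ≤ V.card :=
    card_le_card (biUnion_subset.2 fun x _ => sdiff_subset.trans (filter_subset _ _))
  rw [card_biUnion hd] at h1
  have h2 : ∑ x ∈ Y, (V.card + g) ≤ ∑ x ∈ Y, (4 * (Z x \ I).card + 4 * I.card) := by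
    refine sum_le_sum fun x hx => ?_
    have := hnb x (hYV hx)
    have := le_card_sdiff I (Z x)
    simp only [Z] at *
    omega
  rw [sum_add_distrib, sum_add_distrib, ← mul_sum] at h2
  simp only [sum_const, hY, smul_eq_mul] at h2
  omega

theorem reach_of_card (hE : ∀ e ∈ E, e.card = 3) (hV : MissLE E V D) {G M : ℕ}
    (hN : 4 * D + G + 17 ≤ V.card) (hG : 500000 ≤ G) (hM : 2358 * V.card ≤ M * G)
    (hN' : 3 * D + 3 * M + 2 ≤ V.card) {x y : α} (hx : x ∈ V) (hy : y ∈ V) (hxy : x ≠ y) :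
    Reach E V 223 900 x y := by
  classical
  have hM0 : 0 < M := by
    rcases Nat.eq_zero_or_pos M with rfl | h
    · omega
    · exact h
  have hnb : ∀ x ∈ V, V.card + 500000 ≤ 4 * (V.filter (Reach E V 3 1179 x)).card := by
    intro x hx
    have h1 := card_reach hE hV hx 1179 M hN'
    have h2 := Nat.mul_le_mul_left M hN
    have h3 := Nat.mul_le_mul_left M hG
    refine Nat.le_of_mul_le_mul_left ?_ hM0
    linarith
  have h4 : HasReachPair E V 7 1170 4 := hasReachPair_four (by norm_num) hnb (by norm_num)
  have h3 : HasReachPair E V 43 1125 3 :=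
    HasReachPair.down (s := 7) hE hV (by norm_num) (by norm_num) (by norm_num) (by norm_num) hnb
      (by norm_num) (by omega) h4
  have h2 : HasReachPair E V 223 900 2 :=
    HasReachPair.down (s := 43) hE hV (by norm_num) (by norm_num) (by norm_num) (by norm_num) hnb
      (by norm_num) (by omega) h3
  obtain ⟨a, ha, b, hb, hab, hR⟩ := h2 {x, y} (insert_subset hx (singleton_subset_iff.2 hy))
    (card_pair hxy)
  rw [mem_insert, mem_singleton] at ha hb
  rcases ha with rfl | rfl <;> rcases hb with rfl | rfl
  · exact absurd rfl hab
  · exact hR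
  · exact hR.symm
  · exact absurd rfl hab

theorem exists_edge (hV : MissLE E V D) (hN : D + 2 ≤ V.card) :
    ∃ a ∈ V, ∃ b ∈ V, ∃ c ∈ V, {a, b, c} ∈ E := by
  obtain ⟨a, ha, b, hb, hab⟩ := one_lt_card.1 (show 1 < V.card by omega)
  have h := card_le_nbr hV ha hb hab
  obtain ⟨c, hc⟩ := card_pos.1 (show 0 < (V.filter fun v => ({a, b, v} : Finset α) ∈ E).card by
    omega)
  rw [mem_filter] at hc
  exact ⟨a, ha, b, hb, c, hc.1, hc.2⟩

theorem exists_absorber (hE : ∀ e ∈ E, e.card = 3) (hV : MissLE E V D) {G M : ℕ}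
    (hN : 4 * D + G + 17 ≤ V.card) (hG : 500000 ≤ G) (hM : 2358 * V.card ≤ M * G)
    (hN' : 3 * D + 3 * M + 2 ≤ V.card) {X : Finset α} (hXV : X ⊆ V) (hX : X.card = 4) :
    ∃ A ⊆ V, Disjoint A X ∧ Tiled E A ∧ Tiled E (A ∪ X) := by
  have hc := card_sdiff_of_subset hXV
  have hVX := hV.mono (sdiff_subset (t := X))
  obtain ⟨a, ha, b, hb, c, hc, he⟩ := exists_edge hVX (by omega)
  obtain ⟨d, hd, hK⟩ := exists_K4 hE hVX (by omega) ha hb hc he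
  obtain ⟨p, q, r, t, hpq, hpr, hpt, hqr, hqt, hrt, rfl⟩ := card_eq_four.1 hX
  obtain ⟨hab, hac, hbc⟩ := edge_ne hE hK.1
  obtain ⟨-, had, hbd⟩ := edge_ne hE hK.2.1
  obtain ⟨-, -, hcd⟩ := edge_ne hE hK.2.2.1
  have hKX : Disjoint {a, b, c, d} ({p, q, r, t} : Finset α) := by
    refine disjoint_of_subset_left (u := V \ {p, q, r, t}) ?_ sdiff_disjoint
    simp only [insert_subset_iff, singleton_subset_iff]
    exact ⟨ha, hb, hc, hd⟩
  have hZ := card_insert_four_le a b c d {p, q, r, t}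
  have himage : ∀ x y z w : α, univ.image ![x, y, z, w] = {x, y, z, w} := by
    intro x y z w
    ext v
    simp [Fin.exists_fin_succ, eq_comm]
  have hinj : ∀ x y z w : α, x ≠ y → x ≠ z → x ≠ w → y ≠ z → y ≠ w → z ≠ w →
      Function.Injective ![x, y, z, w] := by
    intro x y z w h1 h2 h3 h4 h5 h6 l m h
    fin_cases l <;> fin_cases m <;> simp at h ⊢ <;> grind
  simp only [insert_subset_iff, singleton_subset_iff] at hXV
  simp only [mem_sdiff, mem_insert, mem_singleton, not_or] at ha hb hc hd
  obtain ⟨W, hWV, hWZ, -, hW⟩ := exists_connector (E := E) (V := V) (s := 223) (u := 900)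
    ![a, b, c, d] ![p, q, r, t] (by
      intro l
      fin_cases l
      · exact reach_of_card hE hV hN hG hM hN' ha.1 hXV.1 ha.2.1
      · exact reach_of_card hE hV hN hG hM hN' hb.1 hXV.2.1 hb.2.2.1
      · exact reach_of_card hE hV hN hG hM hN' hc.1 hXV.2.2.1 hc.2.2.2.1
      · exact reach_of_card hE hV hN hG hM hN' hd.1 hXV.2.2.2 hd.2.2.2.2)
    (insert a (insert b (insert c (insert d {p, q, r, t}))))
    (by intro l; fin_cases l <;> simp) (by intro l; fin_cases l <;> simp) (by omega)
  have hZ' : insert a (insert b (insert c (insert d {p, q, r, t})))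
      = {a, b, c, d} ∪ ({p, q, r, t} : Finset α) := by
    simp only [insert_union, singleton_union]
  rw [hZ', disjoint_union_right] at hWZ
  refine ⟨{a, b, c, d} ∪ W, union_subset ?_ hWV, disjoint_union_left.2 ⟨hKX, hWZ.2⟩, ?_, ?_⟩
  · simp only [insert_subset_iff, singleton_subset_iff]
    exact ⟨ha.1, hb.1, hc.1, hd.1⟩
  · rw [← himage]
    exact hW _ (fun l => Or.inl rfl) (hinj _ _ _ _ hab hac had hbc hbd hcd)
  · have h := hW ![p, q, r, t] (fun l => Or.inr rfl) (hinj _ _ _ _ hpq hpr hpt hqr hqt hrt)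
    rw [himage] at h
    rw [union_assoc, union_comm W]
    exact (hK.tile hE).tiled.disjUnion h (disjoint_union_right.2 ⟨hKX, hWZ.1.symm⟩)

end K43

namespace K43

variable {α : Type*} [DecidableEq α] {E : Finset (Finset α)} {V : Finset α} {D : ℕ}

/-- `P` consists of pairwise disjoint tiles and edges inside `V`. -/
def Packing (E : Finset (Finset α)) (V : Finset α) (P : Finset (Finset α)) : Prop :=
  (P : Set (Finset α)).PairwiseDisjoint id ∧ ∀ A ∈ P, A ⊆ V ∧ (Tile E A ∨ A ∈ E)

/-- Tiles have weight three and edges have weight one. -/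
def weight (P : Finset (Finset α)) : ℕ :=
  ∑ A ∈ P, (2 * A.card - 5)

omit [DecidableEq α] in
theorem weight_singleton (A : Finset α) : weight {A} = 2 * A.card - 5 := by
  simp [weight]

theorem weight_insert_le (A : Finset α) (P : Finset (Finset α)) :
    weight (insert A P) ≤ 2 * A.card - 5 + weight P := by
  by_cases h : A ∈ P
  · rw [insert_eq_of_mem h]
    exact Nat.le_add_left _ _
  · exact (sum_insert h).le

/-- No packing in `V` has larger weight than `P`. -/
def MaxPacking (E : Finset (Finset α)) (V : Finset α) (P : Finset (Finset α)) : Prop :=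
  Packing E V P ∧ ∀ P', Packing E V P' → weight P' ≤ weight P

omit [DecidableEq α] in
theorem exists_maxPacking (E : Finset (Finset α)) (V : Finset α) : ∃ P, MaxPacking E V P := by
  classical
  obtain ⟨P, hP, hmax⟩ := exists_max_image (V.powerset.powerset.filter (Packing E V)) weight
    ⟨∅, by simp [Packing]⟩
  refine ⟨P, (mem_filter.1 hP).2, fun P' hP' => hmax P' (mem_filter.2 ⟨?_, hP'⟩)⟩
  exact mem_powerset.2 fun A hA => mem_powerset.2 (hP'.2 A hA).1

omit [DecidableEq α] in
theorem Packing.nonempty (hE : ∀ e ∈ E, e.card = 3) {P : Finset (Finset α)}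
    (hP : Packing E V P) {A : Finset α} (hA : A ∈ P) : A.Nonempty := by
  rcases (hP.2 A hA).2 with h | h
  · exact card_pos.1 (by rw [h.1]; norm_num)
  · exact card_pos.1 (by rw [hE A h]; norm_num)

theorem MaxPacking.exchange (hE : ∀ e ∈ E, e.card = 3) {P R Q : Finset (Finset α)}
    (hP : MaxPacking E V P) (hR : R ⊆ P) (hQ : Packing E V Q)
    (hd : ∀ A ∈ Q, ∀ B ∈ P, B ∉ R → Disjoint A B) : weight Q ≤ weight R := by
  have hdis : Disjoint (P \ R) Q := disjoint_left.2 fun A hA hA' => by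
    rw [mem_sdiff] at hA
    obtain ⟨x, hx⟩ := hQ.nonempty hE hA'
    exact disjoint_left.1 (hd A hA' A hA.1 hA.2) hx hx
  have hpack : Packing E V (P \ R ∪ Q) := by
    refine ⟨?_, fun A hA => ?_⟩
    · rw [coe_union, Set.pairwiseDisjoint_union]
      refine ⟨hP.1.1.subset (by simp), hQ.1, fun A hA B hB _ => ?_⟩
      have hA' := mem_sdiff.1 (mem_coe.1 hA)
      exact (hd B hB A hA'.1 hA'.2).symm
    · rcases mem_union.1 hA with h | h
      · exact hP.1.2 A (mem_sdiff.1 h).1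
      · exact hQ.2 A h
  have h1 := hP.2 _ hpack
  have h2 : weight (P \ R ∪ Q) = weight (P \ R) + weight Q := sum_union hdis
  have h3 : weight (P \ R) + weight R = weight P := sum_sdiff hR
  omega

theorem Packing.eq_of_mem {P : Finset (Finset α)} (hP : Packing E V P) {A B : Finset α}
    (hA : A ∈ P) (hB : B ∈ P) {x : α} (hxA : x ∈ A) (hxB : x ∈ B) : A = B := by
  by_contra hne
  exact disjoint_left.1 (hP.1 hA hB hne) hxA hxB

open Classical in
theorem Packing.four_mul_card_tiles_le {P : Finset (Finset α)} (hP : Packing E V P) :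
    4 * (P.filter (Tile E)).card ≤ V.card := by
  have h1 : ((P.filter (Tile E)).biUnion id).card ≤ V.card :=
    card_le_card (biUnion_subset.2 fun A hA => (hP.2 A (mem_filter.1 hA).1).1)
  rw [card_biUnion (hP.1.subset (coe_subset.2 (filter_subset _ _)))] at h1
  simp only [id] at h1
  rw [sum_const_nat (m := 4) fun A hA => (mem_filter.1 hA).2.1] at h1
  omega

open Classical in
/-- The vertices that extend the edge `T` to a tile. -/
noncomputable def good (E : Finset (Finset α)) (V T : Finset α) : Finset α :=
  V.filter fun z => z ∉ T ∧ Tile E (insert z T)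

open Classical in
theorem MaxPacking.good_subset (hE : ∀ e ∈ E, e.card = 3) {P : Finset (Finset α)}
    (hP : MaxPacking E V P) {T : Finset α} (hTP : T ∈ P) (hTE : T ∈ E) :
    good E V T ⊆ (P.filter (Tile E)).biUnion id := by
  intro z hz
  obtain ⟨hzV, hzT, hzt⟩ := mem_filter.1 hz
  have hpack : Packing E V {insert z T} := by
    refine ⟨by simp, fun A hA => ?_⟩
    rw [mem_singleton.1 hA]
    exact ⟨insert_subset hzV (hP.1.2 T hTP).1, .inl hzt⟩
  have hT3 := hE T hTE
  by_contra hzn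
  by_cases hzP : ∃ T' ∈ P, z ∈ T'
  · obtain ⟨T', hT'P, hzT'⟩ := hzP
    have hT'E : T' ∈ E := (hP.1.2 T' hT'P).2.resolve_left fun h =>
      hzn (mem_biUnion.2 ⟨T', mem_filter.2 ⟨hT'P, h⟩, hzT'⟩)
    have h := hP.exchange hE (R := {T, T'})
      (insert_subset hTP (singleton_subset_iff.2 hT'P)) hpack (by
        intro A hA B hB hBR
        rw [mem_singleton.1 hA, disjoint_insert_left]
        rw [mem_insert, mem_singleton, not_or] at hBR
        exact ⟨fun h => hBR.2 (hP.1.eq_of_mem hB hT'P h hzT'),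
          hP.1.1 hTP hB (Ne.symm hBR.1)⟩)
    have h2 := weight_insert_le T {T'}
    rw [weight_singleton, hE T' hT'E, hT3] at h2
    rw [weight_singleton, hzt.1] at h
    omega
  · push Not at hzP
    have h := hP.exchange hE (R := {T}) (singleton_subset_iff.2 hTP) hpack (by
        intro A hA B hB hBR
        rw [mem_singleton.1 hA, disjoint_insert_left]
        rw [mem_singleton] at hBR
        exact ⟨hzP B hB, hP.1.1 hTP hB (Ne.symm hBR)⟩)
    rw [weight_singleton, weight_singleton, hzt.1, hT3] at h
    omega

theorem MaxPacking.eq_of_mem_good (hE : ∀ e ∈ E, e.card = 3) {P : Finset (Finset α)}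
    (hP : MaxPacking E V P) {T T' Q : Finset α} (hT : T ∈ P) (hTE : T ∈ E) (hT' : T' ∈ P)
    (hTE' : T' ∈ E) (hTT : T ≠ T') (hQ : Q ∈ P) (hQt : Tile E Q) {v v' : α} (hv : v ∈ Q)
    (hv' : v' ∈ Q) (hg : v ∈ good E V T) (hg' : v' ∈ good E V T') : v = v' := by
  classical
  by_contra hne
  obtain ⟨hvV, hvT, hvt⟩ := mem_filter.1 hg
  obtain ⟨hvV', hvT', hvt'⟩ := mem_filter.1 hg'
  have hQT : Q ≠ T := fun h => by rw [h] at hv; exact hvT hv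
  have hQT' : Q ≠ T' := fun h => by rw [h] at hv'; exact hvT' hv'
  have hdT := hP.1.1 hQ hT hQT
  have hdT' := hP.1.1 hQ hT' hQT'
  have hd : Disjoint (insert v T) (insert v' T') := by
    simp only [disjoint_insert_left, disjoint_insert_right, mem_insert, not_or]
    exact ⟨⟨Ne.symm hne, disjoint_left.1 hdT hv'⟩, disjoint_left.1 hdT' hv, hP.1.1 hT hT' hTT⟩
  have hne2 : insert v T ≠ insert v' T' := fun h => by
    have hm := mem_insert_self v T
    exact disjoint_left.1 hd hm (h ▸ hm)
  have hpack : Packing E V {insert v T, insert v' T'} := by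
    refine ⟨?_, ?_⟩
    · rw [coe_insert, coe_singleton, Set.pairwiseDisjoint_insert]
      refine ⟨by simp, fun B hB _ => ?_⟩
      rw [Set.mem_singleton_iff.1 hB]
      exact hd
    · intro A hA
      rcases mem_insert.1 hA with rfl | hA
      · exact ⟨insert_subset hvV (hP.1.2 T hT).1, .inl hvt⟩
      · rw [mem_singleton.1 hA]
        exact ⟨insert_subset hvV' (hP.1.2 T' hT').1, .inl hvt'⟩
  have h := hP.exchange hE (R := {Q, T, T'}) (by simp [insert_subset_iff, *]) hpack (by
    intro A hA B hB hBR
    simp only [mem_insert, mem_singleton, not_or] at hBR hA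
    have h1 := hP.1.1 hQ hB (Ne.symm hBR.1)
    have h2 := hP.1.1 hT hB (Ne.symm hBR.2.1)
    have h3 := hP.1.1 hT' hB (Ne.symm hBR.2.2)
    rcases hA with rfl | rfl
    · exact disjoint_insert_left.2 ⟨disjoint_left.1 h1 hv, h2⟩
    · exact disjoint_insert_left.2 ⟨disjoint_left.1 h1 hv', h3⟩)
  have h1 := weight_insert_le Q {T, T'}
  have h2 := weight_insert_le T {T'}
  have h3 : weight {insert v T, insert v' T'} = _ := sum_pair hne2
  rw [weight_singleton, hE T' hTE', hE T hTE] at h2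
  rw [hQt.1] at h1
  rw [hvt.1, hvt'.1] at h3
  omega

open Classical in
theorem MaxPacking.card_edges_le (hE : ∀ e ∈ E, e.card = 3) (hV : MissLE E V D)
    (hN : 4 * D < V.card) {P : Finset (Finset α)} (hP : MaxPacking E V P) :
    (P.filter (· ∈ E)).card ≤ 3 := by
  by_contra! hc
  have hQ : ∀ Q ∈ P.filter (Tile E),
      ∑ T ∈ P.filter (· ∈ E), (good E V T ∩ Q).card ≤ (P.filter (· ∈ E)).card := by
    intro Q hQ
    obtain ⟨hQP, hQt⟩ := mem_filter.1 hQ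
    by_contra! hlt
    have hlt' : ∑ T ∈ P.filter (· ∈ E), 1 < ∑ T ∈ P.filter (· ∈ E), (good E V T ∩ Q).card := by
      simpa using hlt
    obtain ⟨T, hT, h1⟩ := exists_lt_of_sum_lt hlt'
    have h4 : (good E V T ∩ Q).card ≤ 4 := hQt.1 ▸ card_le_card inter_subset_right
    rw [← add_sum_erase _ _ hT] at hlt
    have hpos : 0 < ∑ T ∈ (P.filter (· ∈ E)).erase T, (good E V T ∩ Q).card := by omega
    obtain ⟨T', hT', h0⟩ := exists_ne_zero_of_sum_ne_zero hpos.ne'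
    obtain ⟨v', hv'⟩ := card_pos.1 (Nat.pos_of_ne_zero h0)
    obtain ⟨v, hv, hne⟩ := exists_mem_ne h1 v'
    rw [mem_erase, mem_filter] at hT'
    rw [mem_filter] at hT
    rw [mem_inter] at hv hv'
    exact hne (hP.eq_of_mem_good hE hT.1 hT.2 hT'.2.1 hT'.2.2 (Ne.symm hT'.1) hQP hQt hv.2 hv'.2
      hv.1 hv'.1)
  have h1 := sum_le_sum hQ
  rw [sum_comm] at h1
  have h2 : ∑ T ∈ P.filter (· ∈ E), V.card ≤ ∑ T ∈ P.filter (· ∈ E),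
      (3 * D + ∑ Q ∈ P.filter (Tile E), (good E V T ∩ Q).card) := by
    refine sum_le_sum fun T hT => ?_
    rw [mem_filter] at hT
    refine (card_le_good hE hV hT.2 (hP.1.2 T hT.1).1).trans (Nat.add_le_add_left ?_ _)
    refine le_trans (card_le_card ?_) card_biUnion_le
    intro z hz
    obtain ⟨Q, hQ, hzQ⟩ := mem_biUnion.1 (hP.good_subset hE hT.1 hT.2 hz)
    exact mem_biUnion.2 ⟨Q, hQ, mem_inter.2 ⟨hz, hzQ⟩⟩
  rw [sum_add_distrib] at h2
  simp only [sum_const, smul_eq_mul] at h1 h2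
  have h3 := hP.1.four_mul_card_tiles_le
  set e := (P.filter (· ∈ E)).card
  have h4 : e * V.card ≤ e * (3 * D + (P.filter (Tile E)).card) := by linarith
  have h5 := Nat.le_of_mul_le_mul_left h4 (by omega)
  omega

open Classical in
theorem MaxPacking.card_biUnion_edges_le (hE : ∀ e ∈ E, e.card = 3) (hV : MissLE E V D)
    (hN : 4 * D < V.card) {P : Finset (Finset α)} (hP : MaxPacking E V P) :
    ((P.filter (· ∈ E)).biUnion id).card ≤ 9 :=
  (card_biUnion_le_card_mul _ _ 3 fun A hA => (hE A (mem_filter.1 hA).2).le).trans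
    (Nat.mul_le_mul_right 3 (hP.card_edges_le hE hV hN))

open Classical in
theorem MaxPacking.card_uncovered_lt (hE : ∀ e ∈ E, e.card = 3) (hV : MissLE E V D) {G M : ℕ}
    (hN : 4 * D + G ≤ V.card) (hG : 0 < G) (hM : 3 * V.card + 36 * M < M * G)
    {P : Finset (Finset α)} (hP : MaxPacking E V P) : (V \ P.biUnion id).card < 2 * M := by
  by_contra! hc
  set L := V \ P.biUnion id with hL
  obtain ⟨g⟩ : Nonempty (Fin M × Fin 2 ↪ L) := by
    refine Function.Embedding.nonempty_of_card_le ?_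
    simp only [Fintype.card_prod, Fintype.card_fin, Fintype.card_coe]
    omega
  let x : Fin M → α := fun i => g (i, 0)
  let y : Fin M → α := fun i => g (i, 1)
  have hgL : ∀ q, (g q : α) ∈ V ∧ ∀ A ∈ P, (g q : α) ∉ A := by
    intro q
    have := (g q).2
    simp only [hL, mem_sdiff, mem_biUnion, id, not_exists, not_and] at this
    exact this
  have hginj : ∀ q q', (g q : α) = g q' → q = q' := fun q q' h => g.injective (Subtype.ext h)
  let nb : Fin M → Finset α := fun i => V.filter fun v => ({x i, y i, v} : Finset α) ∈ E
  have hnbc : ∀ i, V.card ≤ D + (nb i).card := fun i =>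
    card_le_nbr hV (hgL _).1 (hgL _).1 fun h => by simpa using hginj _ _ h
  have hcov : ∀ i, nb i ⊆ P.biUnion id := by
    intro i v hv
    obtain ⟨hvV, hve⟩ := mem_filter.1 hv
    by_contra hn
    simp only [mem_biUnion, id, not_exists, not_and] at hn
    have h := hP.exchange hE (R := ∅) (Q := {{x i, y i, v}}) (by simp) (by
        refine ⟨by simp, fun A hA => ?_⟩
        rw [mem_singleton.1 hA]
        refine ⟨?_, .inr hve⟩
        simp only [insert_subset_iff, singleton_subset_iff]
        exact ⟨(hgL _).1, (hgL _).1, hvV⟩) (by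
        intro A hA B hB _
        rw [mem_singleton.1 hA]
        simp only [disjoint_insert_left, disjoint_singleton_left]
        exact ⟨(hgL _).2 B hB, (hgL _).2 B hB, hn B hB⟩)
    rw [weight_singleton, hE _ hve] at h
    simp [weight] at h
  have hedges : ((P.filter (· ∈ E)).biUnion id).card ≤ 9 :=
    hP.card_biUnion_edges_le hE hV (by omega)
  have hQ : ∀ Q ∈ P.filter (Tile E), ∑ i, (nb i ∩ Q).card ≤ 3 * M + 3 := by
    intro Q hQ
    obtain ⟨hQP, hQt⟩ := mem_filter.1 hQ
    by_contra! hlt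
    have hswap : ∑ i, (nb i ∩ Q).card = ∑ v ∈ Q, (univ.filter fun i => v ∈ nb i).card := by
      simp_rw [inter_comm _ Q, ← filter_mem_eq_inter, card_filter]
      rw [sum_comm]
    rw [hswap] at hlt
    have hdeg : ∀ v ∈ Q, 4 ≤ (univ.filter fun i => v ∈ nb i).card := by
      intro v hv
      rw [← add_sum_erase _ _ hv] at hlt
      have h1 : ∑ w ∈ Q.erase v, (univ.filter fun i => w ∈ nb i).card ≤ (Q.erase v).card * M :=
        sum_le_card_nsmul _ _ _ fun w _ => (card_filter_le _ _).trans_eq (by simp)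
      rw [card_erase_of_mem hv, hQt.1] at h1
      omega
    obtain ⟨f, hf, hfn⟩ := (all_card_le_biUnion_card_iff_exists_injective
      (fun v : Q => univ.filter fun i => (v : α) ∈ nb i)).1 (by
        intro s
        rcases s.eq_empty_or_nonempty with rfl | ⟨v, hv⟩
        · simp
        · calc s.card ≤ Fintype.card Q := card_le_univ s
            _ = 4 := by rw [Fintype.card_coe, hQt.1]
            _ ≤ _ := hdeg v v.2
            _ ≤ _ := card_le_card (subset_biUnion_of_mem
              (fun v : Q => univ.filter fun i => (v : α) ∈ nb i) hv))
    let t : Q → Finset α := fun v => {x (f v), y (f v), (v : α)}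
    have hfe : ∀ v, t v ∈ E ∧ t v ⊆ V := by
      intro v
      obtain ⟨h1, h2⟩ := mem_filter.1 (mem_filter.1 (hfn v)).2
      refine ⟨h2, ?_⟩
      simp only [t, insert_subset_iff, singleton_subset_iff]
      exact ⟨(hgL _).1, (hgL _).1, h1⟩
    have hdis : ∀ v w, v ≠ w → Disjoint (t v) (t w) := by
      intro v w hvw
      have hfvw : f v ≠ f w := fun h => hvw (hf h)
      have hgQ : ∀ (q) (v : Q), (g q : α) ≠ v := fun q v h => (hgL q).2 Q hQP (h ▸ v.2)
      have hgg : ∀ k l, (g (f v, k) : α) ≠ g (f w, l) := fun k l h =>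
        hfvw (Prod.ext_iff.1 (hginj _ _ h)).1
      simp only [t, x, y, disjoint_insert_left, disjoint_singleton_left, mem_insert,
        mem_singleton, not_or]
      exact ⟨⟨hgg _ _, hgg _ _, hgQ _ _⟩, ⟨hgg _ _, hgg _ _, hgQ _ _⟩,
        (hgQ _ _).symm, (hgQ _ _).symm, fun h => hvw (Subtype.ext h)⟩
    have htinj : Function.Injective t := by
      intro v w h
      by_contra hvw
      have h1 := hdis v w hvw
      rw [h, disjoint_self] at h1
      exact insert_ne_empty _ _ h1
    have h := hP.exchange hE (R := {Q}) (Q := univ.image t) (singleton_subset_iff.2 hQP) (by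
        refine ⟨?_, ?_⟩
        · intro A hA B hB hAB
          simp only [coe_image, coe_univ, Set.image_univ, Set.mem_range] at hA hB
          obtain ⟨v, rfl⟩ := hA
          obtain ⟨w, rfl⟩ := hB
          exact hdis v w fun h => hAB (h ▸ rfl)
        · intro A hA
          obtain ⟨v, -, rfl⟩ := mem_image.1 hA
          exact ⟨(hfe v).2, .inr (hfe v).1⟩) (by
        intro A hA B hB hBR
        obtain ⟨v, -, rfl⟩ := mem_image.1 hA
        rw [mem_singleton] at hBR
        simp only [t, disjoint_insert_left, disjoint_singleton_left]
        exact ⟨(hgL _).2 B hB, (hgL _).2 B hB,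
          fun h => hBR (hP.1.eq_of_mem hB hQP h v.2)⟩)
    have h2 : weight (univ.image t) = 4 := by
      rw [weight, sum_image (htinj.injOn), sum_congr rfl fun v _ => by rw [hE _ (hfe v).1]]
      simp [hQt.1]
    rw [weight_singleton, hQt.1] at h
    omega
  have h1 := sum_le_sum hQ
  rw [sum_comm] at h1
  have h2 : ∀ i ∈ (univ : Finset (Fin M)), V.card ≤
      (D + 9) + ∑ Q ∈ P.filter (Tile E), (nb i ∩ Q).card := by
    intro i _
    have hsub : nb i ⊆ (P.filter (· ∈ E)).biUnion id ∪
        (P.filter (Tile E)).biUnion fun Q => nb i ∩ Q := by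
      intro v hv
      obtain ⟨A, hA, hvA⟩ := mem_biUnion.1 (hcov i hv)
      rw [mem_union, mem_biUnion, mem_biUnion]
      rcases (hP.1.2 A hA).2 with h | h
      · exact .inr ⟨A, mem_filter.2 ⟨hA, h⟩, mem_inter.2 ⟨hv, hvA⟩⟩
      · exact .inl ⟨A, mem_filter.2 ⟨hA, h⟩, hvA⟩
    have k1 := (card_le_card hsub).trans (card_union_le _ _)
    have k2 : ((P.filter (Tile E)).biUnion fun Q => nb i ∩ Q).card ≤ _ := card_biUnion_le
    have k3 := hnbc i
    omega
  have h3 := sum_le_sum h2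
  rw [sum_add_distrib] at h3
  simp only [sum_const, smul_eq_mul, card_univ, Fintype.card_fin] at h1 h3
  have h4 := Nat.mul_le_mul_right (3 * M + 3) hP.1.four_mul_card_tiles_le
  have h5 := Nat.mul_le_mul_left M hN
  linarith

theorem exists_almost_tiling (hE : ∀ e ∈ E, e.card = 3) (hV : MissLE E V D) {G M : ℕ}
    (hN : 4 * D + G ≤ V.card) (hG : 0 < G) (hM : 3 * V.card + 36 * M < M * G) :
    ∃ S ⊆ V, Tiled E S ∧ (V \ S).card ≤ 2 * M + 9 := by
  classical
  obtain ⟨P, hP⟩ := exists_maxPacking E V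
  refine ⟨(P.filter (Tile E)).biUnion id,
    biUnion_subset.2 fun A hA => (hP.1.2 A (mem_filter.1 hA).1).1,
    Tiled.biUnion _ _ (fun A hA => (mem_filter.1 hA).2.tiled) fun A hA B hB hAB =>
      hP.1.1 (mem_filter.1 hA).1 (mem_filter.1 hB).1 hAB, ?_⟩
  have h1 := hP.card_uncovered_lt hE hV hN hG hM
  have h2 : ((P.filter (· ∈ E)).biUnion id).card ≤ 9 :=
    hP.card_biUnion_edges_le hE hV (by omega)
  have hsub : V \ (P.filter (Tile E)).biUnion id ⊆
      (V \ P.biUnion id) ∪ (P.filter (· ∈ E)).biUnion id := by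
    intro v hv
    simp only [mem_sdiff, mem_union, mem_biUnion, mem_filter, id, not_exists, not_and] at hv ⊢
    by_cases h : ∃ A ∈ P, v ∈ A
    · obtain ⟨A, hA, hvA⟩ := h
      exact .inr ⟨A, ⟨hA, (hP.1.2 A hA).2.resolve_left fun ht => hv.2 A ⟨hA, ht⟩ hvA⟩, hvA⟩
    · exact .inl ⟨hv.1, fun A hA hvA => h ⟨A, hA, hvA⟩⟩
  have h3 := (card_le_card hsub).trans (card_union_le _ _)
  omega

end K43

namespace K43

section Sampling

variable {ι α : Type*} [Fintype ι] [DecidableEq ι] [Fintype α]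

theorem sum_sum_update (j : ι) (h : (ι → α) → ℝ) :
    ∑ f, ∑ v, h (Function.update f j v) = Fintype.card α * ∑ f, h f := by
  let e : (ι → α) × α → (ι → α) × α := fun q => (Function.update q.1 j q.2, q.1 j)
  have he : Function.Involutive e := fun q => by simp [e]
  calc ∑ f, ∑ v, h (Function.update f j v) = ∑ q : (ι → α) × α, h (e q).1 := by
        rw [Fintype.sum_prod_type]
    _ = ∑ q : (ι → α) × α, h q.1 := Equiv.sum_comp he.toPerm fun q => h q.1
    _ = Fintype.card α * ∑ f, h f := by
        rw [Fintype.sum_prod_type]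
        simp [mul_sum]

variable [DecidableEq α]

theorem card_mul_sum_mul_ite (j : ι) (F : (ι → α) → ℝ) (B : (ι → α) → Finset α)
    (hF : ∀ f v, F (Function.update f j v) = F f)
    (hB : ∀ f v, B (Function.update f j v) = B f) (a b : ℝ) :
    Fintype.card α * ∑ f, F f * (if f j ∈ B f then a else b)
      = ∑ f, F f * (b * Fintype.card α + (a - b) * (B f).card) := by
  rw [← sum_sum_update j]
  refine sum_congr rfl fun f _ => ?_
  simp only [hF, hB, Function.update_self, ← mul_sum]
  congr 1
  have h : ∀ v, (if v ∈ B f then a else b) = b + (a - b) * if v ∈ B f then 1 else 0 := by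
    intro v
    split_ifs <;> ring
  simp_rw [h, sum_add_distrib, ← mul_sum]
  simp [mul_comm]

theorem card_mem_le (j : ι) (B : (ι → α) → Finset α)
    (hB : ∀ f v, B (Function.update f j v) = B f) {z : ℝ} (hz : ∀ f, ((B f).card : ℝ) ≤ z) :
    (Fintype.card α : ℝ) * (univ.filter fun f : ι → α => f j ∈ B f).card
      ≤ z * (Fintype.card α : ℝ) ^ Fintype.card ι := by
  have h := card_mul_sum_mul_ite j (fun _ => 1) B (fun _ _ => rfl) hB 1 0
  simp only [one_mul, zero_mul, zero_add, sub_zero] at h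
  rw [card_filter]
  push_cast
  rw [h]
  calc ∑ f : ι → α, ((B f).card : ℝ) ≤ ∑ f : ι → α, z := sum_le_sum fun f _ => hz f
    _ = _ := by simp [mul_comm]

theorem sum_prod_ite_le [Nonempty α] (K : Finset ι) (B : (ι → α) → Finset α)
    (hB : ∀ f j v, j ∉ K → B (Function.update f j v) = B f) {a β : ℝ} (ha : 1 ≤ a) (hβ0 : 0 ≤ β)
    (hβ : ∀ f, ((B f).card : ℝ) ≤ β * Fintype.card α) (J : Finset ι) (hJ : Disjoint J K) :
    ∑ f : ι → α, ∏ k ∈ J, (if f k ∈ B f then a else 1)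
      ≤ (1 + (a - 1) * β) ^ J.card * (Fintype.card α : ℝ) ^ Fintype.card ι := by
  have hn : (0 : ℝ) < Fintype.card α := Nat.cast_pos.2 Fintype.card_pos
  induction J using Finset.induction_on with
  | empty => simp
  | insert j J hj ih =>
    rw [disjoint_insert_left] at hJ
    have ih := ih hJ.2
    let F : (ι → α) → ℝ := fun f => ∏ k ∈ J, (if f k ∈ B f then a else 1)
    have hF : ∀ f v, F (Function.update f j v) = F f := by
      intro f v
      refine prod_congr rfl fun k hk => ?_
      rw [hB f j v hJ.1, Function.update_of_ne (show k ≠ j by rintro rfl; exact hj hk)]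
    have hF0 : ∀ f, 0 ≤ F f := fun f => prod_nonneg fun k _ => by split_ifs <;> linarith
    have key := card_mul_sum_mul_ite j F B hF (fun f v => hB f j v hJ.1) a 1
    have hle : ∑ f, F f * (1 * Fintype.card α + (a - 1) * (B f).card)
        ≤ Fintype.card α * ((1 + (a - 1) * β) * ∑ f, F f) := by
      rw [mul_sum, mul_sum]
      refine sum_le_sum fun f _ => ?_
      have := mul_le_mul_of_nonneg_left (hβ f) (sub_nonneg.2 ha)
      have := mul_le_mul_of_nonneg_left this (hF0 f)
      linarith
    rw [← key] at hle
    have hle := le_of_mul_le_mul_left hle hn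
    have hprod : ∀ f : ι → α, ∏ k ∈ insert j J, (if f k ∈ B f then a else 1)
        = F f * (if f j ∈ B f then a else 1) := fun f => by rw [prod_insert hj, mul_comm]
    simp_rw [hprod]
    refine hle.trans ?_
    rw [card_insert_of_notMem hj, pow_succ', mul_assoc]
    refine mul_le_mul_of_nonneg_left ih ?_
    have := mul_nonneg (sub_nonneg.2 ha) hβ0
    linarith

theorem card_many_mem_le [Nonempty α] (K : Finset ι) (B : (ι → α) → Finset α)
    (hB : ∀ f j v, j ∉ K → B (Function.update f j v) = B f) {β γ : ℝ} (hγ0 : 0 ≤ γ)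
    (hγ1 : γ ≤ 1) (hβ0 : 0 ≤ β) (hβ1 : β ≤ 1 / 4)
    (hβ : ∀ f, ((B f).card : ℝ) ≤ β * Fintype.card α) :
    ((univ.filter fun f : ι → α => (β + γ / 2) * Fintype.card ι
        ≤ ((univ \ K).filter fun k => f k ∈ B f).card).card : ℝ)
      ≤ Real.exp (-(γ ^ 2 / 4) * Fintype.card ι) * (Fintype.card α : ℝ) ^ Fintype.card ι := by
  set m : ℝ := (Fintype.card ι : ℝ) with hm
  set N : ℝ := (Fintype.card α : ℝ) ^ Fintype.card ι with hN
  have hm0 : 0 ≤ m := Nat.cast_nonneg _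
  have hN0 : 0 ≤ N := by positivity
  have h1 := sum_prod_ite_le K B hB (Real.one_le_exp hγ0) hβ0 hβ (univ \ K) sdiff_disjoint
  have hexp : Real.exp γ - 1 ≤ γ + γ ^ 2 := by
    have := (abs_le.1 (Real.abs_exp_sub_one_sub_id_le (x := γ) (abs_le.2 ⟨by linarith, hγ1⟩))).2
    linarith
  have h2 : (1 + (Real.exp γ - 1) * β) ^ (univ \ K).card ≤ Real.exp ((γ + γ ^ 2) * β * m) := by
    have hb : 1 + (Real.exp γ - 1) * β ≤ Real.exp ((γ + γ ^ 2) * β) := by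
      refine le_trans ?_ (Real.add_one_le_exp _)
      have := mul_le_mul_of_nonneg_right hexp hβ0
      linarith
    have h0 : 0 ≤ 1 + (Real.exp γ - 1) * β := by
      have := mul_nonneg (sub_nonneg.2 (Real.one_le_exp hγ0)) hβ0
      linarith
    refine (pow_le_pow_left₀ h0 hb _).trans ?_
    rw [← Real.exp_nat_mul, Real.exp_le_exp, mul_comm]
    refine mul_le_mul_of_nonneg_left ?_ (by positivity)
    rw [hm]
    exact_mod_cast card_le_univ _
  have h3 : ((univ.filter fun f : ι → α => (β + γ / 2) * m
        ≤ ((univ \ K).filter fun k => f k ∈ B f).card).card : ℝ)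
        * Real.exp (γ * ((β + γ / 2) * m))
      ≤ ∑ f : ι → α, ∏ k ∈ univ \ K, (if f k ∈ B f then Real.exp γ else 1) := by
    rw [← nsmul_eq_mul, ← sum_const]
    refine le_trans (sum_le_sum fun f hf => ?_) (sum_le_sum_of_subset_of_nonneg
      (filter_subset _ _) fun f _ _ => prod_nonneg fun k _ => ?_)
    · rw [prod_ite, prod_const_one, mul_one, prod_const, ← Real.exp_nat_mul, Real.exp_le_exp,
        mul_comm]
      exact mul_le_mul_of_nonneg_right (mem_filter.1 hf).2 hγ0
    · split_ifs <;> positivity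
  have h4 := h3.trans (h1.trans (mul_le_mul_of_nonneg_right h2 hN0))
  refine le_of_mul_le_mul_right (h4.trans ?_) (Real.exp_pos (γ * ((β + γ / 2) * m)))
  rw [mul_right_comm (Real.exp (-(γ ^ 2 / 4) * m)), ← Real.exp_add]
  refine mul_le_mul_of_nonneg_right (Real.exp_le_exp.2 ?_) hN0
  have := mul_le_mul_of_nonneg_left hβ1 (mul_nonneg (sq_nonneg γ) hm0)
  linarith

end Sampling
end K43

namespace K43

section Hosts

variable {ι α : Type*} [Fintype ι] [DecidableEq ι] [Fintype α] [DecidableEq α]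
  {E : Finset (Finset α)} {D : ℕ}

open Classical in
theorem card_not_missLE_le [Nonempty α] (hV : MissLE E univ D) {β γ : ℝ} (hγ0 : 0 ≤ γ)
    (hγ1 : γ ≤ 1) (hβ0 : 0 ≤ β) (hβ1 : β ≤ 1 / 4) (hD : (D : ℝ) ≤ β * Fintype.card α)
    {X : Finset α} (hX : X.card = 4) {D' : ℕ} (hD' : (β + γ / 2) * Fintype.card ι + 6 ≤ D') :
    ((univ.filter fun f : ι → α => ¬ MissLE E (univ.image f ∪ X) D').card : ℝ)
      ≤ (Fintype.card ι + 4) ^ 2 * (Real.exp (-(γ ^ 2 / 4) * Fintype.card ι)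
        * (Fintype.card α : ℝ) ^ Fintype.card ι) := by
  let val : (ι → α) → ι ⊕ X → α := fun f => Sum.elim f (fun x => x)
  let sup : ι ⊕ X → Finset ι := Sum.elim (fun k => {k}) (fun _ => ∅)
  let B : ι ⊕ X → ι ⊕ X → (ι → α) → Finset α := fun p q f =>
    if val f p = val f q then ∅ else miss E univ (val f p) (val f q)
  have hsup : ∀ p, (sup p).card ≤ 1 := by rintro (k | x) <;> simp [sup]
  have hval : ∀ f j v p, j ∉ sup p → val (Function.update f j v) p = val f p := by
    rintro f j v (k | x) hj
    · simp only [sup, Sum.elim_inl, mem_singleton] at hj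
      simp only [val, Sum.elim_inl]
      exact Function.update_of_ne (Ne.symm hj) _ _
    · rfl
  have hB : ∀ p q f j v, j ∉ sup p ∪ sup q → B p q (Function.update f j v) = B p q f := by
    intro p q f j v hj
    rw [mem_union, not_or] at hj
    simp only [B, hval f j v p hj.1, hval f j v q hj.2]
  have hBc : ∀ p q f, ((B p q f).card : ℝ) ≤ β * Fintype.card α := by
    intro p q f
    refine le_trans ?_ hD
    simp only [B]
    split_ifs with h
    · simp
    · exact_mod_cast hV _ (mem_univ _) _ (mem_univ _) h
  have hsub : (univ.filter fun f : ι → α => ¬ MissLE E (univ.image f ∪ X) D') ⊆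
      (univ : Finset ((ι ⊕ X) × (ι ⊕ X))).biUnion fun pq =>
        univ.filter fun f : ι → α => (β + γ / 2) * Fintype.card ι
          ≤ ((univ \ (sup pq.1 ∪ sup pq.2)).filter fun k => f k ∈ B pq.1 pq.2 f).card := by
    intro f hf
    have hf := (mem_filter.1 hf).2
    simp only [MissLE, not_forall, not_le] at hf
    obtain ⟨a, ha, b, hb, hab, hlt⟩ := hf
    have hex : ∀ z ∈ univ.image f ∪ X, ∃ p, val f p = z := by
      intro z hz
      rcases mem_union.1 hz with h | h
      · obtain ⟨k, -, rfl⟩ := mem_image.1 h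
        exact ⟨.inl k, rfl⟩
      · exact ⟨.inr ⟨z, h⟩, rfl⟩
    obtain ⟨p, rfl⟩ := hex a ha
    obtain ⟨q, rfl⟩ := hex b hb
    refine mem_biUnion.2 ⟨(p, q), mem_univ _, mem_filter.2 ⟨mem_univ _, ?_⟩⟩
    have hm : miss E (univ.image f ∪ X) (val f p) (val f q) ⊆
        (((univ \ (sup p ∪ sup q)).filter fun k => f k ∈ B p q f).image f
          ∪ (sup p ∪ sup q).image f) ∪ X := by
      intro z hz
      obtain ⟨hz1, hz2⟩ := mem_filter.1 hz
      rcases mem_union.1 hz1 with h | h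
      · obtain ⟨k, -, rfl⟩ := mem_image.1 h
        refine mem_union_left _ ?_
        by_cases hk : k ∈ sup p ∪ sup q
        · exact mem_union_right _ (mem_image_of_mem f hk)
        · refine mem_union_left _ (mem_image_of_mem f (mem_filter.2
            ⟨mem_sdiff.2 ⟨mem_univ _, hk⟩, ?_⟩))
          simp only [B, if_neg hab]
          exact mem_filter.2 ⟨mem_univ _, hz2⟩
      · exact mem_union_right _ h
    have h1 := card_le_card hm
    have h2 := card_union_le (((univ \ (sup p ∪ sup q)).filter fun k => f k ∈ B p q f).image f
          ∪ (sup p ∪ sup q).image f) X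
    have h3 := card_union_le (((univ \ (sup p ∪ sup q)).filter fun k => f k ∈ B p q f).image f)
      ((sup p ∪ sup q).image f)
    have h4 : (((univ \ (sup p ∪ sup q)).filter fun k => f k ∈ B p q f).image f).card ≤ _ :=
      card_image_le
    have h5 : ((sup p ∪ sup q).image f).card ≤ _ := card_image_le
    have h6 := card_union_le (sup p) (sup q)
    have h7 := hsup p
    have h8 := hsup q
    have h9 : D' ≤ ((univ \ (sup p ∪ sup q)).filter fun k => f k ∈ B p q f).card + 6 := by
      omega
    have h10 : (D' : ℝ) ≤ ((univ \ (sup p ∪ sup q)).filter fun k => f k ∈ B p q f).card + 6 := by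
      exact_mod_cast h9
    linarith
  calc _ ≤ ((∑ pq : (ι ⊕ X) × (ι ⊕ X), (univ.filter fun f : ι → α =>
          (β + γ / 2) * Fintype.card ι ≤ ((univ \ (sup pq.1 ∪ sup pq.2)).filter
            fun k => f k ∈ B pq.1 pq.2 f).card).card : ℕ) : ℝ) := by
        exact_mod_cast (card_le_card hsub).trans card_biUnion_le
    _ ≤ ∑ pq : (ι ⊕ X) × (ι ⊕ X), (Real.exp (-(γ ^ 2 / 4) * Fintype.card ι)
        * (Fintype.card α : ℝ) ^ Fintype.card ι) := by
        push_cast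
        exact sum_le_sum fun pq _ => card_many_mem_le (sup pq.1 ∪ sup pq.2) (B pq.1 pq.2)
          (hB pq.1 pq.2) hγ0 hγ1 hβ0 hβ1 (hBc pq.1 pq.2)
    _ = _ := by
        rw [sum_const, nsmul_eq_mul]
        simp [hX, pow_two]

open Classical in
theorem card_absorbing_ge [Nonempty α] (hE : ∀ e ∈ E, e.card = 3) (hV : MissLE E univ D)
    {β γ : ℝ} (hγ0 : 0 ≤ γ)
    (hγ1 : γ ≤ 1) (hβ0 : 0 ≤ β) (hβ1 : β ≤ 1 / 4) (hD : (D : ℝ) ≤ β * Fintype.card α)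
    {X Z : Finset α} (hX : X.card = 4) {D' G M : ℕ}
    (hD' : (β + γ / 2) * Fintype.card ι + 6 ≤ D')
    (hexp : (Fintype.card ι + 4) ^ 2 * Real.exp (-(γ ^ 2 / 4) * Fintype.card ι) ≤ 1 / 4)
    (hZ : 4 * Fintype.card ι * (Z.card + 4 + Fintype.card ι) ≤ Fintype.card α)
    (hN : 4 * D' + G + 17 ≤ Fintype.card ι + 4) (hG : 500000 ≤ G)
    (hM : 2358 * (Fintype.card ι + 4) ≤ M * G)
    (hN' : 3 * D' + 3 * M + 2 ≤ Fintype.card ι + 4) :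
    Fintype.card α ^ Fintype.card ι ≤ 2 * (univ.filter fun f : ι → α => ∃ J : Finset ι,
      Disjoint (J.image f) Z ∧ Disjoint (J.image f) X ∧ Tiled E (J.image f) ∧
        Tiled E (J.image f ∪ X)).card := by
  set good := univ.filter fun f : ι → α => ∃ J : Finset ι,
      Disjoint (J.image f) Z ∧ Disjoint (J.image f) X ∧ Tiled E (J.image f) ∧
        Tiled E (J.image f ∪ X) with hgood
  let C : ι → (ι → α) → Finset α := fun i f => Z ∪ X ∪ (univ.erase i).image f
  have hn : (0 : ℝ) < Fintype.card α := Nat.cast_pos.2 Fintype.card_pos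
  have hcover : (univ : Finset (ι → α)) ⊆ good ∪
      ((univ.filter fun f : ι → α => ¬ MissLE E (univ.image f ∪ X) D') ∪
        (univ : Finset ι).biUnion fun i => univ.filter fun f : ι → α => f i ∈ C i f) := by
    intro f _
    by_contra hf
    simp only [mem_union, mem_filter, mem_univ, true_and, mem_biUnion, not_or, not_not,
      not_exists, C, mem_image, mem_erase, not_and, and_true, hgood] at hf
    obtain ⟨hnot, hmiss, hC⟩ := hf
    have hinj : Function.Injective f := by
      intro i j hij
      by_contra hne
      exact (hC i).2 j (Ne.symm hne) hij.symm
    have hXd : Disjoint (univ.image f) X := by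
      rw [disjoint_left]
      intro z hz
      obtain ⟨i, -, rfl⟩ := mem_image.1 hz
      exact (hC i).1.2
    have hc : (univ.image f ∪ X).card = Fintype.card ι + 4 := by
      rw [card_union_of_disjoint hXd, card_image_of_injective _ hinj, hX, card_univ]
    obtain ⟨A, hA, hAX, hA1, hA2⟩ := exists_absorber hE hmiss (by omega) hG (by rwa [hc])
      (by rwa [hc]) (X := X) subset_union_right hX
    have hAf : (univ.filter fun i => f i ∈ A).image f = A := by
      ext z
      simp only [mem_image, mem_filter, mem_univ, true_and]
      refine ⟨fun ⟨i, hi, h⟩ => h ▸ hi, fun hz => ?_⟩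
      rcases mem_union.1 (hA hz) with h | h
      · obtain ⟨i, -, rfl⟩ := mem_image.1 h
        exact ⟨i, hz, rfl⟩
      · exact absurd h (disjoint_left.1 hAX hz)
    refine hnot (univ.filter fun i => f i ∈ A) ?_ ?_ ?_ ?_
    · rw [disjoint_left]
      intro z hz
      obtain ⟨i, -, rfl⟩ := mem_image.1 hz
      exact (hC i).1.1
    · rwa [hAf]
    · rwa [hAf]
    · rwa [hAf]
  have h1 := (card_le_card hcover).trans ((card_union_le _ _).trans
    (Nat.add_le_add_left (card_union_le _ _) _))
  have h2 := card_not_missLE_le (ι := ι) hV hγ0 hγ1 hβ0 hβ1 hD hX hD'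
  have h3 : (((univ : Finset ι).biUnion fun i =>
      univ.filter fun f : ι → α => f i ∈ C i f).card : ℝ)
      ≤ 1 / 4 * (Fintype.card α : ℝ) ^ Fintype.card ι := by
    refine le_of_mul_le_mul_left ?_ hn
    calc (Fintype.card α : ℝ) * ((univ : Finset ι).biUnion fun i =>
          univ.filter fun f : ι → α => f i ∈ C i f).card
        ≤ Fintype.card α * ∑ i : ι, ((univ.filter fun f : ι → α => f i ∈ C i f).card : ℝ) := by
          refine mul_le_mul_of_nonneg_left ?_ hn.le
          exact_mod_cast card_biUnion_le
      _ ≤ ∑ i : ι, (((Z.card + 4 + Fintype.card ι : ℕ) : ℝ)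
          * (Fintype.card α : ℝ) ^ Fintype.card ι) := by
          rw [mul_sum]
          refine sum_le_sum fun i _ => card_mem_le i (C i) ?_ ?_
          · intro f v
            simp only [C]
            congr 1
            refine image_congr fun k hk => ?_
            exact Function.update_of_ne (by simpa using hk) _ _
          · intro f
            have k1 := card_union_le (Z ∪ X) ((univ.erase i).image f)
            have k2 := card_union_le Z X
            have k3 : ((univ.erase i).image f).card ≤ Fintype.card ι :=
              card_image_le.trans (card_le_univ _)
            have k4 : (C i f).card ≤ Z.card + 4 + Fintype.card ι := by
              simp only [C]
              omega
            exact_mod_cast k4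
      _ ≤ _ := by
          have hZ' : (4 * Fintype.card ι * ((Z.card + 4 + Fintype.card ι : ℕ) : ℝ) : ℝ)
              ≤ Fintype.card α := by exact_mod_cast hZ
          have := mul_le_mul_of_nonneg_right hZ'
            (by positivity : (0 : ℝ) ≤ (Fintype.card α : ℝ) ^ Fintype.card ι)
          rw [sum_const, nsmul_eq_mul, card_univ]
          linarith
  have h4 : ((Fintype.card ι : ℝ) + 4) ^ 2 * (Real.exp (-(γ ^ 2 / 4) * Fintype.card ι)
        * (Fintype.card α : ℝ) ^ Fintype.card ι)
      ≤ 1 / 4 * (Fintype.card α : ℝ) ^ Fintype.card ι := by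
    rw [← mul_assoc]
    exact mul_le_mul_of_nonneg_right hexp (by positivity)
  have h5 : (Fintype.card α : ℝ) ^ Fintype.card ι ≤ good.card +
      ((univ.filter fun f : ι → α => ¬ MissLE E (univ.image f ∪ X) D').card +
      ((univ : Finset ι).biUnion fun i =>
        univ.filter fun f : ι → α => f i ∈ C i f).card) := by
    rw [card_univ, Fintype.card_fun] at h1
    exact_mod_cast h1
  have h6 : (Fintype.card α : ℝ) ^ Fintype.card ι ≤ 2 * good.card := by linarith
  exact_mod_cast h6

end Hosts
end K43

namespace K43

theorem eventually_sq_mul_exp_le {c : ℝ} (hc : 0 < c) :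
    ∀ᶠ m : ℕ in Filter.atTop, ((m : ℝ) + 4) ^ 2 * Real.exp (-c * m) ≤ 1 / 4 := by
  have hr : |Real.exp (-c)| < 1 := by
    rw [abs_of_pos (Real.exp_pos _), Real.exp_lt_one_iff]
    linarith
  have h := tendsto_pow_const_mul_const_pow_of_abs_lt_one 2 hr
  filter_upwards [h.eventually_le_const (show (0 : ℝ) < 1 / 100 by norm_num),
    Filter.eventually_ge_atTop 1] with m hm hm1
  have hm1' : (1 : ℝ) ≤ m := by exact_mod_cast hm1
  have he : Real.exp (-c * m) = Real.exp (-c) ^ m := by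
    rw [← Real.exp_nat_mul]
    ring_nf
  rw [he]
  have hp : (0 : ℝ) ≤ Real.exp (-c) ^ m := by positivity
  have h25 : ((m : ℝ) + 4) ^ 2 ≤ 25 * (m : ℝ) ^ 2 := by nlinarith
  nlinarith [mul_le_mul_of_nonneg_right h25 hp]

open Classical in
/-- For a suitable constant `m`, at least half of all `m`-tuples contain an absorber of any given
four vertices that avoids a given small set. -/
theorem exists_sampling {γ : ℝ} (hγ0 : 0 < γ) (hγ1 : γ ≤ 1 / 4) :
    ∃ m : ℕ, 0 < m ∧ ∀ (n : ℕ) (E : Finset (Finset (Fin n))) (D : ℕ), (∀ e ∈ E, e.card = 3) →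
      MissLE E univ D → (D : ℝ) ≤ (1 / 4 - γ) * n → ∀ Z X : Finset (Fin n), X.card = 4 →
      4 * m * (Z.card + 4 + m) ≤ n →
      n ^ m ≤ 2 * (univ.filter fun f : Fin m → Fin n => ∃ J : Finset (Fin m),
        Disjoint (J.image f) Z ∧ Disjoint (J.image f) X ∧ Tiled E (J.image f) ∧
          Tiled E (J.image f ∪ X)).card := by
  obtain ⟨m, hm, hm'⟩ := ((eventually_sq_mul_exp_le (c := γ ^ 2 / 4) (by positivity)).and
    (Filter.eventually_ge_atTop ⌈500001 / γ⌉₊)).exists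
  have hγm : 500001 ≤ γ * m := by
    have := Nat.ceil_le.1 hm'
    rwa [div_le_iff₀ hγ0, mul_comm] at this
  have hm4 : (2000004 : ℝ) ≤ m := by nlinarith [Nat.cast_nonneg (α := ℝ) m]
  have hm0 : 0 < m := by
    rw [← Nat.cast_pos (α := ℝ)]
    linarith
  refine ⟨m, hm0, fun n E D hE hV hD Z X hX hZ => ?_⟩
  have hn : 0 < n := by
    have : 0 < 4 * m * (Z.card + 4 + m) := by positivity
    omega
  have : Nonempty (Fin n) := ⟨⟨0, hn⟩⟩
  have hinv : 1 / γ ≤ m / 500001 := by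
    rw [div_le_div_iff₀ hγ0 (by norm_num)]
    linarith
  set D' := ⌈(1 / 4 - γ / 2) * m⌉₊ + 6 with hD'
  set G := ⌊γ * m⌋₊ with hG
  set M := ⌈5000 / γ⌉₊ with hM
  have hnn : 0 ≤ (1 / 4 - γ / 2) * (m : ℝ) := by
    have : 0 ≤ 1 / 4 - γ / 2 := by linarith
    positivity
  have hD1 : (D' : ℝ) ≤ (1 / 4 - γ / 2) * m + 7 := by
    rw [hD']
    push_cast
    linarith [Nat.ceil_lt_add_one hnn]
  have hD2 : (1 / 4 - γ / 2) * m + 6 ≤ (D' : ℝ) := by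
    rw [hD']
    push_cast
    linarith [Nat.le_ceil ((1 / 4 - γ / 2) * (m : ℝ))]
  have hG1 : (G : ℝ) ≤ γ * m := Nat.floor_le (by positivity)
  have hG2 : γ * m - 1 ≤ (G : ℝ) := (Nat.sub_one_lt_floor _).le
  have hM1 : (M : ℝ) ≤ 5000 * (1 / γ) + 1 := by
    have := (Nat.ceil_lt_add_one (show 0 ≤ 5000 / γ by positivity)).le
    rw [mul_one_div]
    exact this
  have hM2 : 5000 * (1 / γ) ≤ (M : ℝ) := by
    rw [mul_one_div]
    exact Nat.le_ceil _
  have hMG : 5000 * m - 5000 * (1 / γ) ≤ (M : ℝ) * G := by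
    calc 5000 * m - 5000 * (1 / γ) = 5000 * (1 / γ) * (γ * m - 1) := by field_simp
      _ ≤ (M : ℝ) * G := mul_le_mul hM2 hG2 (by linarith) (by positivity)
  have key := card_absorbing_ge (ι := Fin m) (α := Fin n) hE hV (β := 1 / 4 - γ) (γ := γ) hγ0.le
    (by linarith) (by linarith) (by linarith) (by simpa using hD) hX (Z := Z) (D' := D') (G := G)
    (M := M)
  simp only [Fintype.card_fin] at key
  refine key ?_ hm hZ ?_ ?_ ?_ ?_
  · linarith
  · rw [← Nat.cast_le (α := ℝ)]
    push_cast
    linarith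
  · rw [← Nat.cast_le (α := ℝ)]
    push_cast
    linarith
  · rw [← Nat.cast_le (α := ℝ)]
    push_cast
    linarith
  · rw [← Nat.cast_le (α := ℝ)]
    push_cast
    linarith

end K43

namespace K43

section Rounds

variable {n m : ℕ} {E : Finset (Finset (Fin n))}

open Classical in
/-- The four-sets that cannot be absorbed by a part of `B` with tileable complement in `B`. -/
noncomputable def unabsorbed (E : Finset (Finset (Fin n))) (B : Finset (Fin n)) :
    Finset (Finset (Fin n)) :=
  (powersetCard 4 univ).filter fun X =>
    ¬ ∃ A ⊆ B, Disjoint A X ∧ Tiled E (B \ A) ∧ Tiled E (A ∪ X)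

theorem mem_unabsorbed {B X : Finset (Fin n)} : X ∈ unabsorbed E B ↔ X.card = 4 ∧
    ¬ ∃ A ⊆ B, Disjoint A X ∧ Tiled E (B \ A) ∧ Tiled E (A ∪ X) := by
  classical
  unfold unabsorbed
  simp only [mem_filter, mem_powersetCard, subset_univ, true_and]

theorem card_unabsorbed_le (B : Finset (Fin n)) : (unabsorbed E B).card ≤ n ^ 4 := by
  classical
  unfold unabsorbed
  refine (card_filter_le _ _).trans ?_
  rw [card_powersetCard, card_univ, Fintype.card_fin]
  exact Nat.choose_le_pow n 4

theorem unabsorbed_union_subset {A B : Finset (Fin n)} (hA : Tiled E A) (hAB : Disjoint A B) :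
    unabsorbed E (B ∪ A) ⊆ unabsorbed E B := by
  intro X hX
  rw [mem_unabsorbed] at hX ⊢
  refine ⟨hX.1, ?_⟩
  rintro ⟨C, hC, hCX, h1, h2⟩
  refine hX.2 ⟨C, hC.trans subset_union_left, hCX, ?_, h2⟩
  have hAC : Disjoint A C := hAB.mono_right hC
  rw [union_sdiff_distrib, sdiff_eq_self_of_disjoint hAC]
  exact h1.disjUnion hA (hAB.symm.mono_left sdiff_subset)

theorem tiled_union_of_unabsorbed_eq_empty {B X : Finset (Fin n)} (h : unabsorbed E B = ∅)
    (hX : X.card = 4) (hBX : Disjoint B X) : Tiled E (B ∪ X) := by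
  have hX' : X ∉ unabsorbed E B := by simp [h]
  rw [mem_unabsorbed] at hX'
  push Not at hX'
  obtain ⟨A, hA, -, h1, h2⟩ := hX' hX
  have := h1.disjUnion h2 (disjoint_union_right.2
    ⟨sdiff_disjoint, hBX.mono_left sdiff_subset⟩)
  rwa [← union_assoc, sdiff_union_of_subset hA] at this

/-- At least half of all `m`-tuples contain an absorber avoiding `Z`, for every four-set. -/
def ManyAbsorbers (E : Finset (Finset (Fin n))) (m : ℕ) (Z : Finset (Fin n)) : Prop :=
  ∀ (X : Finset (Fin n)) [DecidablePred fun f : Fin m → Fin n => ∃ J : Finset (Fin m),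
      Disjoint (J.image f) Z ∧ Disjoint (J.image f) X ∧ Tiled E (J.image f) ∧
        Tiled E (J.image f ∪ X)], X.card = 4 →
    n ^ m ≤ 2 * (univ.filter fun f : Fin m → Fin n => ∃ J : Finset (Fin m),
      Disjoint (J.image f) Z ∧ Disjoint (J.image f) X ∧ Tiled E (J.image f) ∧
        Tiled E (J.image f ∪ X)).card

theorem exists_popular_absorber (hn : 0 < n) {Z : Finset (Fin n)} (hZ : ManyAbsorbers E m Z)
    {U : Finset (Finset (Fin n))} (hU : ∀ X ∈ U, X.card = 4) (hne : U.Nonempty) :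
    ∃ A U' : Finset _, Disjoint A Z ∧ A.card ≤ m ∧ Tiled E A ∧ U' ⊆ U ∧
      U.card ≤ 2 ^ (m + 1) * U'.card ∧ ∀ X ∈ U', Disjoint A X ∧ Tiled E (A ∪ X) := by
  classical
  let R : Finset (Fin n) → (Fin m → Fin n) × Finset (Fin m) → Prop := fun X p =>
    Disjoint (p.2.image p.1) Z ∧ Disjoint (p.2.image p.1) X ∧ Tiled E (p.2.image p.1) ∧
      Tiled E (p.2.image p.1 ∪ X)
  have hrow : ∀ X ∈ U, n ^ m ≤ 2 * (univ.filter (R X)).card := by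
    intro X hX
    refine (hZ X (hU X hX)).trans (Nat.mul_le_mul_left 2 ?_)
    refine le_trans (card_le_card ?_) (card_image_le (f := Prod.fst))
    intro f hf
    obtain ⟨J, hJ⟩ := (mem_filter.1 hf).2
    exact mem_image.2 ⟨(f, J), mem_filter.2 ⟨mem_univ _, hJ⟩, rfl⟩
  have hdc : ∑ X ∈ U, (univ.filter (R X)).card = ∑ p, (U.filter fun X => R X p).card :=
    sum_card_bipartiteAbove_eq_sum_card_bipartiteBelow R
  have hpos : 0 < n ^ m := by positivity
  have hcard : (univ : Finset ((Fin m → Fin n) × Finset (Fin m))).card = n ^ m * 2 ^ m := by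
    simp
  have hsum : U.card * n ^ m ≤ ∑ p, 2 * (U.filter fun X => R X p).card := by
    rw [← mul_sum, ← hdc, mul_sum, ← smul_eq_mul, ← sum_const]
    exact sum_le_sum hrow
  obtain ⟨p, hp⟩ : ∃ p, U.card ≤ 2 ^ (m + 1) * (U.filter fun X => R X p).card := by
    by_contra! hcon
    have hlt : ∑ p, 2 ^ (m + 1) * (U.filter fun X => R X p).card < n ^ m * 2 ^ m * U.card := by
      rw [← hcard, ← smul_eq_mul, ← sum_const]
      refine sum_lt_sum_of_nonempty ?_ fun p _ => hcon p
      rw [← card_pos, hcard]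
      positivity
    rw [← mul_sum] at hlt hsum
    rw [pow_succ] at hlt
    have h2 : 0 < 2 ^ m := by positivity
    nlinarith [Nat.mul_le_mul_left (2 ^ m) hsum]
  have hU' : (U.filter fun X => R X p).Nonempty := by
    rw [← card_pos]
    by_contra h0
    rw [Nat.eq_zero_of_not_pos h0] at hp
    have := hne.card_pos
    omega
  obtain ⟨X, hX⟩ := hU'
  have hRX := (mem_filter.1 hX).2
  refine ⟨p.2.image p.1, U.filter fun X => R X p, hRX.1, ?_, hRX.2.2.1, filter_subset _ _, hp,
    fun Y hY => ?_⟩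
  · refine card_image_le.trans ((card_le_univ _).trans ?_)
    simp
  · have hRY := (mem_filter.1 hY).2
    exact ⟨hRY.2.1, hRY.2.2.2⟩

theorem exists_improvement (hn : 0 < n) {W B : Finset (Fin n)} (hB : Tiled E B)
    (hZ : ManyAbsorbers E m (W ∪ B)) :
    ∃ A : Finset (Fin n), Disjoint A (W ∪ B) ∧ A.card ≤ m ∧ Tiled E A ∧
      2 ^ (m + 1) * (unabsorbed E (B ∪ A)).card ≤
        (2 ^ (m + 1) - 1) * (unabsorbed E B).card := by
  rcases (unabsorbed E B).eq_empty_or_nonempty with h0 | hne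
  · exact ⟨∅, disjoint_empty_left _, by simp, .empty, by simp [h0]⟩
  have hU : ∀ X ∈ unabsorbed E B, X.card = 4 := fun X hX => (mem_unabsorbed.1 hX).1
  obtain ⟨A, U', hAZ, hAm, hA, hU', hcard, habs⟩ := exists_popular_absorber hn hZ hU hne
  have hAB : Disjoint A B := (disjoint_union_right.1 hAZ).2
  refine ⟨A, hAZ, hAm, hA, ?_⟩
  have hsub : unabsorbed E (B ∪ A) ⊆ unabsorbed E B \ U' := by
    intro X hX
    refine mem_sdiff.2 ⟨unabsorbed_union_subset hA hAB hX, fun hXU => ?_⟩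
    refine (mem_unabsorbed.1 hX).2 ⟨A, subset_union_right, (habs X hXU).1, ?_, (habs X hXU).2⟩
    rwa [union_sdiff_cancel_right hAB.symm]
  have h1 := card_le_card hsub
  rw [card_sdiff_of_subset hU'] at h1
  have h2 := card_le_card hU'
  have h3 : (unabsorbed E (B ∪ A)).card + U'.card ≤ (unabsorbed E B).card := by omega
  have h4 := Nat.mul_le_mul_left (2 ^ (m + 1)) h3
  rw [Nat.sub_mul, one_mul]
  rw [mul_add] at h4
  omega

theorem exists_decay (hn : 0 < n) {W : Finset (Fin n)} (T : ℕ)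
    (hW : ∀ Z : Finset (Fin n), Z.card ≤ W.card + T * m → ManyAbsorbers E m Z) :
    ∃ B : Finset (Fin n), Disjoint B W ∧ B.card ≤ T * m ∧ Tiled E B ∧
      (2 ^ (m + 1)) ^ T * (unabsorbed E B).card ≤ (2 ^ (m + 1) - 1) ^ T * n ^ 4 := by
  induction T with
  | zero =>
    refine ⟨∅, disjoint_empty_left _, by simp, .empty, ?_⟩
    simpa using card_unabsorbed_le (E := E) ∅
  | succ T ih =>
    obtain ⟨B, hBW, hBc, hB, hdec⟩ := ih fun Z hZ => hW Z (hZ.trans (by gcongr; omega))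
    obtain ⟨A, hA, hAm, hAt, himp⟩ := exists_improvement (W := W) hn hB
      (hW (W ∪ B) ((card_union_le _ _).trans (by gcongr; exact hBc.trans (by gcongr; omega))))
    rw [disjoint_union_right] at hA
    refine ⟨B ∪ A, disjoint_union_left.2 ⟨hBW, hA.1⟩, ?_, hB.disjUnion hAt hA.2.symm, ?_⟩
    · refine (card_union_le _ _).trans ?_
      rw [add_mul, one_mul]
      exact add_le_add hBc hAm
    · calc (2 ^ (m + 1)) ^ (T + 1) * (unabsorbed E (B ∪ A)).card
          = (2 ^ (m + 1)) ^ T * (2 ^ (m + 1) * (unabsorbed E (B ∪ A)).card) := by ring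
        _ ≤ (2 ^ (m + 1)) ^ T * ((2 ^ (m + 1) - 1) * (unabsorbed E B).card) := by gcongr
        _ = (2 ^ (m + 1) - 1) * ((2 ^ (m + 1)) ^ T * (unabsorbed E B).card) := by ring
        _ ≤ (2 ^ (m + 1) - 1) * ((2 ^ (m + 1) - 1) ^ T * n ^ 4) := by gcongr
        _ = (2 ^ (m + 1) - 1) ^ (T + 1) * n ^ 4 := by ring

theorem exists_universal_absorber (hn : 0 < n) {W : Finset (Fin n)} (T : ℕ)
    (hW : ∀ Z : Finset (Fin n), Z.card ≤ W.card + T * m → ManyAbsorbers E m Z)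
    (hT : (2 ^ (m + 1) - 1) ^ T * n ^ 4 < (2 ^ (m + 1)) ^ T) :
    ∃ B : Finset (Fin n), Disjoint B W ∧ B.card ≤ T * m ∧ Tiled E B ∧
      ∀ X : Finset (Fin n), X.card = 4 → Disjoint B X → Tiled E (B ∪ X) := by
  obtain ⟨B, hBW, hBc, hB, hdec⟩ := exists_decay hn T hW
  refine ⟨B, hBW, hBc, hB, fun X hX hBX => tiled_union_of_unabsorbed_eq_empty ?_ hX hBX⟩
  rw [← card_eq_zero]
  by_contra h0
  have := Nat.mul_le_mul_left ((2 ^ (m + 1)) ^ T) (Nat.one_le_iff_ne_zero.2 h0)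
  omega

theorem exists_absorbing_set (k s : ℕ)
    (h : ∀ W : Finset (Fin n), W.card ≤ k * s → ∃ B : Finset (Fin n), Disjoint B W ∧
      B.card ≤ s ∧ Tiled E B ∧
        ∀ X : Finset (Fin n), X.card = 4 → Disjoint B X → Tiled E (B ∪ X)) :
    ∃ W : Finset (Fin n), W.card ≤ k * s ∧ ∀ Y : Finset (Fin n), Disjoint W Y → 4 ∣ Y.card →
      Y.card ≤ 4 * k → Tiled E (W ∪ Y) := by
  induction k with
  | zero =>
    refine ⟨∅, by simp, fun Y _ _ hY => ?_⟩
    rw [card_eq_zero.1 (by omega : Y.card = 0)]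
    simpa using Tiled.empty
  | succ k ih =>
    obtain ⟨W, hWc, hW⟩ := ih fun W hW => h W (hW.trans (by gcongr; omega))
    obtain ⟨B, hBW, hBc, hB, habs⟩ := h W (hWc.trans (by gcongr; omega))
    refine ⟨W ∪ B, (card_union_le _ _).trans (by rw [add_mul]; omega), fun Y hWY h4 hY => ?_⟩
    rw [disjoint_union_left] at hWY
    rcases Y.eq_empty_or_nonempty with rfl | hne
    · rw [union_empty]
      have := hW ∅ (disjoint_empty_right _) (by simp) (by simp)
      rw [union_empty] at this
      exact this.disjUnion hB hBW.symm
    obtain ⟨X, hXY, hX⟩ := exists_subset_card_eq (Nat.le_of_dvd hne.card_pos h4)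
    have hc : (Y \ X).card = Y.card - 4 := by rw [card_sdiff_of_subset hXY, hX]
    have h1 := hW (Y \ X) (hWY.1.mono_right sdiff_subset) (by omega) (by omega)
    have h2 := habs X hX (hWY.2.mono_right hXY)
    have h3 := h1.disjUnion h2 (by
      rw [disjoint_union_left, disjoint_union_right, disjoint_union_right]
      exact ⟨⟨hBW.symm, hWY.1.mono_right hXY⟩,
        (hWY.2.mono_right sdiff_subset).symm, sdiff_disjoint⟩)
    convert h3 using 1
    rw [union_union_union_comm, sdiff_union_of_subset hXY]

end Rounds

theorem eventually_pow_div_mul_lt {a L : ℕ} (ha : 0 < a) (hL : 0 < L) :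
    ∀ᶠ n : ℕ in Filter.atTop, (a - 1) ^ (n / L) * n ^ 4 < a ^ (n / L) := by
  have ha' : (0 : ℝ) < a := Nat.cast_pos.2 ha
  have ha1 : (1 : ℝ) ≤ a := by exact_mod_cast ha
  have hr : |((a : ℝ) - 1) / a| < 1 := by
    rw [abs_of_nonneg (div_nonneg (by linarith) ha'.le), div_lt_one ha']
    linarith
  have h := (tendsto_pow_const_mul_const_pow_of_abs_lt_one 4 hr).comp
    (Nat.tendsto_div_const_atTop hL.ne')
  have hL' : (0 : ℝ) < L := Nat.cast_pos.2 hL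
  filter_upwards [h.eventually_lt_const (show (0 : ℝ) < 1 / (2 * L) ^ 4 by positivity),
    Filter.eventually_ge_atTop L] with n hn hnL
  simp only [Function.comp_apply] at hn
  set T := n / L with hT
  have hT1 : 1 ≤ T := (Nat.one_le_div_iff hL).2 hnL
  have hnT : n ≤ 2 * L * T := by
    have := Nat.lt_mul_div_succ n hL
    rw [← hT] at this
    nlinarith
  have hnT' : (n : ℝ) ≤ 2 * L * T := by exact_mod_cast hnT
  rw [lt_div_iff₀ (by positivity), div_pow, mul_div_assoc', div_mul_eq_mul_div,
    div_lt_one (by positivity)] at hn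
  rw [← Nat.cast_lt (α := ℝ)]
  push_cast [Nat.cast_sub (Nat.one_le_iff_ne_zero.2 ha.ne')]
  have hp : (0 : ℝ) ≤ ((a : ℝ) - 1) ^ T := pow_nonneg (by linarith) _
  calc ((a : ℝ) - 1) ^ T * n ^ 4 ≤ ((a : ℝ) - 1) ^ T * (2 * L * T) ^ 4 := by gcongr
    _ = (T : ℝ) ^ 4 * ((a : ℝ) - 1) ^ T * (2 * L) ^ 4 := by ring
    _ < (a : ℝ) ^ T := hn

end K43

namespace K43

theorem exists_tiled_univ {γ : ℝ} (hγ0 : 0 < γ) (hγ1 : γ ≤ 1 / 4) :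
    ∃ n₀ : ℕ, ∀ n : ℕ, n₀ ≤ n → 4 ∣ n → ∀ (E : Finset (Finset (Fin n))) (D : ℕ),
      (∀ e ∈ E, e.card = 3) → MissLE E univ D → (D : ℝ) ≤ (1 / 4 - γ) * n →
      Tiled E univ := by
  obtain ⟨m, hm0, hm⟩ := exists_sampling hγ0 hγ1
  set M := ⌈4 / γ⌉₊ with hM
  set k := 2 * M + 9 with hk
  set L := 8 * m ^ 2 * (k + 1) + ⌈k * m / γ⌉₊ with hL
  have hL0 : 0 < L := by positivity
  obtain ⟨n₁, hn₁⟩ := Filter.eventually_atTop.1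
    (eventually_pow_div_mul_lt (a := 2 ^ (m + 1)) (by positivity) hL0)
  refine ⟨n₁ + 8 * m * (4 + m) + 1 + ⌈148 / γ⌉₊, fun n hn h4 E D hE hV hD => ?_⟩
  have hn0 : 0 < n := by omega
  have hnR : (0 : ℝ) < n := Nat.cast_pos.2 hn0
  set T := n / L with hT
  have hTL : L * T ≤ n := Nat.mul_div_le n L
  have hTL1 : 8 * m ^ 2 * (k + 1) * T ≤ n := le_trans (by gcongr; omega) hTL
  have hTL2 : (k : ℝ) * (T * m) ≤ γ * n := by
    have h1 : ((⌈k * m / γ⌉₊ * T : ℕ) : ℝ) ≤ n := by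
      rw [Nat.cast_le]
      exact le_trans (by gcongr; omega) hTL
    have h2 : (k * m / γ : ℝ) * T ≤ n := by
      refine le_trans ?_ h1
      push_cast
      gcongr
      exact Nat.le_ceil _
    rw [div_mul_eq_mul_div, div_le_iff₀ hγ0] at h2
    linarith
  have hmany : ∀ Z : Finset (Fin n), Z.card ≤ (k + 1) * (T * m) → ManyAbsorbers E m Z := by
    intro Z hZ X _ hX
    convert hm n E D hE hV hD Z X hX ?_
    have h1 := Nat.mul_le_mul_left (4 * m) hZ
    have h2 : 8 * m * (4 + m) ≤ n := by omega
    nlinarith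
  obtain ⟨W, hWc, hW⟩ := exists_absorbing_set (E := E) k (T * m) fun W hW =>
    exists_universal_absorber hn0 T (fun Z hZ => hmany Z (by rw [add_mul, one_mul]; omega))
      (hn₁ n (by omega))
  have hWR : (W.card : ℝ) ≤ γ * n := by
    refine le_trans ?_ hTL2
    exact_mod_cast hWc
  set V := (univ : Finset (Fin n)) \ W with hVdef
  have hVc : (V.card : ℝ) = n - W.card := by
    rw [hVdef, card_sdiff_of_subset (subset_univ W), Nat.cast_sub (card_le_univ W |>.trans
      (by simp)), card_univ, Fintype.card_fin]
  set G := ⌊γ * n⌋₊ with hG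
  have hG1 : (G : ℝ) ≤ γ * n := Nat.floor_le (by positivity)
  have hG2 : γ * n - 1 ≤ (G : ℝ) := (Nat.sub_one_lt_floor _).le
  have hn148 : 148 / γ < n := by
    refine lt_of_le_of_lt (Nat.le_ceil _) ?_
    rw [Nat.cast_lt]
    omega
  have hγn : 148 < γ * n := by
    rwa [div_lt_iff₀ hγ0, mul_comm] at hn148
  obtain ⟨S, hSV, hS, hSc⟩ := exists_almost_tiling hE (hV.mono (subset_univ V)) (G := G) (M := M)
    (by
      rw [← Nat.cast_le (α := ℝ)]
      push_cast
      rw [hVc]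
      linarith)
    (by
      rw [← Nat.cast_pos (α := ℝ)]
      linarith)
    (by
      rw [← Nat.cast_lt (α := ℝ)]
      push_cast
      rw [hVc]
      have hM' : 4 / γ ≤ (M : ℝ) := Nat.le_ceil _
      have h1 : 4 / γ * (γ * n - 37) ≤ (M : ℝ) * (G - 36) :=
        mul_le_mul hM' (by linarith) (by linarith) (by positivity)
      have h2 : 4 / γ * (γ * n - 37) = 4 * n - 148 / γ := by
        field_simp
        ring
      have h3 : (0 : ℝ) ≤ W.card := by positivity
      nlinarith)
  have hWV : Disjoint W V := disjoint_sdiff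
  have hWY : Disjoint W (V \ S) := hWV.mono_right sdiff_subset
  have hW0 := hW ∅ (disjoint_empty_right _) (by simp) (by simp)
  rw [union_empty] at hW0
  have hWV' : W ∪ V = univ := union_sdiff_of_subset (subset_univ W)
  have hcard : W.card + (S.card + (V \ S).card) = n := by
    rw [add_comm S.card, card_sdiff_add_card_eq_card hSV, ← card_union_of_disjoint hWV, hWV',
      card_univ, Fintype.card_fin]
  have hdvd : 4 ∣ (V \ S).card := by
    have h1 := hW0.four_dvd
    have h2 := hS.four_dvd
    omega
  have := (hW (V \ S) hWY hdvd (by omega)).disjUnion hS (by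
    rw [disjoint_union_left]
    exact ⟨hWV.mono_right hSV, sdiff_disjoint⟩)
  rwa [union_assoc, sdiff_union_of_subset hSV, hWV'] at this

section Conversion

variable {n : ℕ} {E : Finset (Finset (Fin n))}

theorem Tile.isCopy {A : Finset (Fin n)} (hA : Tile E A) : IsCopy E (cliqueEdges 4 3) A := by
  have hmap : univ.map (A.orderEmbOfFin hA.1).toEmbedding = A := by simp
  refine ⟨(A.orderEmbOfFin hA.1).toEmbedding, hmap, fun e he => hA.2 _ ?_ ?_⟩
  · conv_rhs => rw [← hmap]
    exact map_subset_map.2 (subset_univ e)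
  · rw [card_map]
    exact (mem_powersetCard.1 he).2

theorem Tiled.hasFactorOn {S : Finset (Fin n)} (hS : Tiled E S) :
    HasFactorOn E (cliqueEdges 4 3) S := by
  induction hS with
  | empty => exact ⟨∅, by simp, by simp, by simp⟩
  | @union A S hA _ hAS ih =>
    obtain ⟨P, hP, hd, rfl⟩ := ih
    refine ⟨insert A P, ?_, ?_, ?_⟩
    · simpa using ⟨hA.isCopy, hP⟩
    · rw [coe_insert]
      refine hd.insert fun B hB _ => ?_
      exact hAS.mono_right (subset_biUnion_of_mem id hB)
    · simp

theorem degOn_pair_add_card_miss_le {a b : Fin n} (hab : a ≠ b) :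
    degOn E 3 {a, b} + (miss E univ a b).card ≤ n := by
  have hle : degOn E 3 {a, b} ≤ (univ.filter fun v => ({a, b, v} : Finset (Fin n)) ∈ E).card := by
    unfold degOn
    rw [← card_image_of_injective (univ.filter fun v => ({a, b, v} : Finset (Fin n)) ∈ E)
      (singleton_injective (α := Fin n))]
    refine (Set.ncard_le_ncard ?_ (finite_toSet _)).trans_eq (Set.ncard_coe_finset _)
    rintro S ⟨hS, -, hSE⟩
    rw [card_pair hab] at hS
    obtain ⟨v, rfl⟩ := card_eq_one.1 hS
    rw [mem_coe, mem_image]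
    refine ⟨v, mem_filter.2 ⟨mem_univ v, ?_⟩, rfl⟩
    convert hSE using 1
    ext
    simp
    tauto
  have := card_filter_add_card_filter_not (s := (univ : Finset (Fin n)))
    (fun v => ({a, b, v} : Finset (Fin n)) ∈ E)
  rw [card_univ, Fintype.card_fin] at this
  unfold miss
  omega

end Conversion

end K43

/-- Every large 3-graph with minimum codegree at least `(3/4 + γ) n` has a `K₄³`-factor. -/
theorem K43_factor (γ : ℝ) (hγ : 0 < γ) :
    ∃ n₀ : ℕ, ∀ n : ℕ, n₀ ≤ n → 4 ∣ n →
      ∀ E : Finset (Finset (Fin n)), (∀ e ∈ E, e.card = 3) →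
      (∀ T : Finset (Fin n), T.card = 2 → (3 / 4 + γ) * (n : ℝ) ≤ (degOn E 3 T : ℝ)) →
      HasFactorOn E (cliqueEdges 4 3) (Finset.univ : Finset (Fin n)) := by
  set c := min γ (1 / 4) with hc
  have hc0 : 0 < c := lt_min hγ (by norm_num)
  obtain ⟨n₀, h₀⟩ := K43.exists_tiled_univ hc0 (min_le_right _ _)
  refine ⟨n₀, fun n hn h4 E hE hdeg => (h₀ n hn h4 E ⌊(1 / 4 - c) * n⌋₊ hE ?_ ?_).hasFactorOn⟩
  · intro a _ b _ hab
    refine Nat.le_floor ?_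
    have h1 := hdeg {a, b} (card_pair hab)
    have h2 : ((degOn E 3 {a, b} : ℕ) : ℝ) + (K43.miss E univ a b).card ≤ n := by
      exact_mod_cast K43.degOn_pair_add_card_miss_le hab
    have h3 : c * n ≤ γ * n := by
      gcongr
      exact min_le_left _ _
    linarith
  · refine Nat.floor_le (mul_nonneg ?_ (by positivity))
    linarith [min_le_right γ (1 / 4)]
end

section
/- There exists an absolute constant C > 0 (independent of n and t) such that for every integer t ≥ 4 there is an integer n₀ with the following property: for every n ≥ n₀ divisible by t, there exists a 3-graph H on n vertices with δ₂(H) ≥ (1 − C·(log t)/t²)·n − 1 that contains no K_t³-factor. Consequently t³(n, t) ≥ (1 − C·(log t)/t²)·n. -/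
open Finset

lemma card_functions_mapsTo {D : Type*} [Fintype D] [DecidableEq D] {q : ℕ} (hq : 0 < q)
    (B : Finset (Fin q)) (S : Finset D) :
    (#{f : D → Fin q | ∀ s ∈ S, f s ∈ B} : ℝ) =
      ((#B : ℝ) / q) ^ #S * (q : ℝ) ^ Fintype.card D := by
  have h : ({f : D → Fin q | ∀ s ∈ S, f s ∈ B} : Finset (D → Fin q)) =
      Fintype.piFinset fun s => if s ∈ S then B else univ := by
    ext f
    simp only [mem_filter_univ, Fintype.mem_piFinset]
    refine forall_congr' fun s => ?_
    by_cases hs : s ∈ S <;> simp [hs]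
  have hq' : (q : ℝ) ≠ 0 := by positivity
  rw [h, Fintype.card_piFinset]
  have h2 : ∀ s : D, ((#(if s ∈ S then B else univ) : ℕ) : ℝ) =
      (if s ∈ S then (#B : ℝ) / q else 1) * q := by
    intro s
    by_cases hs : s ∈ S <;> simp [hs, hq']
  push_cast
  simp_rw [h2]
  rw [prod_mul_distrib, prod_ite_mem, prod_const, univ_inter, prod_const, card_univ]

lemma card_functions_exists_mapsTo_le {D : Type*} [Fintype D] [DecidableEq D] {q : ℕ}
    (hq : 0 < q) (B : Finset (Fin q)) (𝒮 : Finset (Finset D)) {k : ℕ}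
    (h𝒮 : ∀ S ∈ 𝒮, #S = k) :
    (#{f : D → Fin q | ∃ S ∈ 𝒮, ∀ s ∈ S, f s ∈ B} : ℝ) ≤
      #𝒮 * ((#B : ℝ) / q) ^ k * (q : ℝ) ^ Fintype.card D := by
  have h : ({f : D → Fin q | ∃ S ∈ 𝒮, ∀ s ∈ S, f s ∈ B} : Finset (D → Fin q)) =
      𝒮.biUnion fun S => {f : D → Fin q | ∀ s ∈ S, f s ∈ B} := by
    ext f; simp
  rw [h]
  calc (_ : ℝ) ≤ ∑ S ∈ 𝒮, (#{f : D → Fin q | ∀ s ∈ S, f s ∈ B} : ℝ) := by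
        exact_mod_cast card_biUnion_le
    _ = ∑ S ∈ 𝒮, ((#B : ℝ) / q) ^ k * (q : ℝ) ^ Fintype.card D :=
        sum_congr rfl fun S hS => by rw [card_functions_mapsTo hq, h𝒮 S hS]
    _ = _ := by rw [sum_const, nsmul_eq_mul, mul_assoc]

lemma choose_mul_one_sub_inv_pow_lt {q a : ℕ} (hq : 0 < q) (ha : 2 < a)
    (h : 6 * q * (2 * Real.log q + 1) ≤ ((a : ℝ) - 1) * (a - 2)) :
    ((q ^ 2).choose a : ℝ) * (((q - 1 : ℕ) : ℝ) / q) ^ a.choose 3 < 1 / 2 := by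
  have hq' : (0 : ℝ) < q := by exact_mod_cast hq
  have ha' : (2 : ℝ) < a := by exact_mod_cast ha
  have h1 : ((q ^ 2).choose a : ℝ) ≤ Real.exp (2 * a * Real.log q) := by
    calc ((q ^ 2).choose a : ℝ) ≤ (((q ^ 2) ^ a : ℕ) : ℝ) := by
          exact_mod_cast Nat.choose_le_pow _ _
      _ = Real.exp (Real.log q) ^ (2 * a) := by
          rw [Real.exp_log hq']; push_cast; ring
      _ = _ := by rw [← Real.exp_nat_mul]; push_cast; rfl
  have h2 : (((q - 1 : ℕ) : ℝ) / q) ^ a.choose 3 ≤ Real.exp (-(a.choose 3 / q : ℝ)) := by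
    have : ((q - 1 : ℕ) : ℝ) / q ≤ Real.exp (-(1 / q : ℝ)) := by
      have := Real.add_one_le_exp (-(1 / q : ℝ))
      rw [Nat.cast_sub hq, sub_div, div_self hq'.ne']
      push_cast
      linarith
    calc _ ≤ Real.exp (-(1 / q : ℝ)) ^ a.choose 3 := by gcongr
      _ = _ := by rw [← Real.exp_nat_mul]; congr 1; ring
  have h3 : (a.choose 3 : ℝ) = a * (a - 1) * (a - 2) / 6 := by
    rw [Nat.cast_choose_eq_descPochhammer_div]
    simp [descPochhammer_succ_right, Nat.factorial]
  have h4 : 2 * a * Real.log q + -(a.choose 3 / q : ℝ) ≤ -1 := by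
    have h5 : a * (2 * Real.log q + 1) ≤ (a.choose 3 / q : ℝ) := by
      rw [le_div_iff₀ hq', h3]
      nlinarith
    nlinarith
  calc _ ≤ Real.exp (2 * a * Real.log q) * Real.exp (-(a.choose 3 / q : ℝ)) := by gcongr
    _ ≤ Real.exp (-1) := by rw [← Real.exp_add]; gcongr
    _ < 1 / 2 := by
      rw [Real.exp_neg, ← one_div]
      have := Real.exp_one_gt_d9
      gcongr
      linarith

lemma sq_mul_choose_mul_inv_pow_lt {q : ℕ} (hq : 0 < q) :
    ((q ^ 2 * (q ^ 2 * (q ^ 2).choose (8 * q)) : ℕ) : ℝ) * ((1 : ℝ) / q) ^ (8 * q) < 1 / 2 := by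
  have hq' : (0 : ℝ) < q := by exact_mod_cast hq
  have h1 : ((q ^ 2).choose (8 * q) : ℝ) ≤ ((q : ℝ) ^ 2) ^ (8 * q) / (8 * q).factorial := by
    exact_mod_cast Nat.choose_le_pow_div (α := ℝ) (8 * q) (q ^ 2)
  have h2 : ((8 * q : ℕ) : ℝ) ^ (8 * q) / (8 * q).factorial ≤ 3 ^ (8 * q) := by
    calc _ ≤ Real.exp ((8 * q : ℕ) : ℝ) := Real.pow_div_factorial_le_exp _ (by positivity) _
      _ = Real.exp 1 ^ (8 * q) := by rw [← Real.exp_nat_mul, mul_one]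
      _ ≤ 3 ^ (8 * q) := by gcongr; linarith [Real.exp_one_lt_d9]
  have h3 : (q : ℝ) ≤ 2 ^ q := by exact_mod_cast Nat.lt_two_pow_self.le
  calc _ = (q : ℝ) ^ 4 * ((q ^ 2).choose (8 * q) : ℝ) * (1 / q) ^ (8 * q) := by
        push_cast; ring
    _ ≤ (2 ^ q) ^ 4 * (((q : ℝ) ^ 2) ^ (8 * q) / (8 * q).factorial) * (1 / q) ^ (8 * q) := by
        gcongr
    _ = (2 ^ q) ^ 4 * (((8 * q : ℕ) : ℝ) ^ (8 * q) / (8 * q).factorial) * (1 / 8) ^ (8 * q) := by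
        have : (q : ℝ) ^ (8 * q) ≠ 0 := by positivity
        push_cast
        rw [mul_pow, div_pow, div_pow, one_pow]
        field_simp
        rw [pow_right_comm]
    _ ≤ (2 ^ q) ^ 4 * 3 ^ (8 * q) * (1 / 8) ^ (8 * q) := by gcongr
    _ = (16 * (3 / 8) ^ 8) ^ q := by
        rw [pow_mul, pow_mul, ← pow_mul, mul_comm q 4, pow_mul, ← mul_pow, ← mul_pow]
        norm_num
    _ ≤ (16 * (3 / 8) ^ 8) ^ 1 := pow_le_pow_of_le_one (by norm_num) (by norm_num) hq
    _ < 1 / 2 := by norm_num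

lemma exists_sparse_triples {q a : ℕ} (hq : 0 < q) (ha : 2 < a)
    (h : 6 * q * (2 * Real.log q + 1) ≤ ((a : ℝ) - 1) * (a - 2)) :
    ∃ R : Finset (Finset (Fin (q ^ 2))), (∀ e ∈ R, #e = 3) ∧
      (∀ i j, #{k | {k, i, j} ∈ R} < 8 * q) ∧ ∀ A, #A = a → ∃ e ∈ R, e ⊆ A := by
  set z : Fin q := ⟨0, hq⟩
  let 𝒜 : Finset (Finset (Finset (Fin (q ^ 2)))) :=
    (powersetCard a univ).image (powersetCard 3)
  let ℬ : Finset (Finset (Finset (Fin (q ^ 2)))) :=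
    {S ∈ (univ ×ˢ univ ×ˢ powersetCard (8 * q) univ).image
      fun x : Fin (q ^ 2) × Fin (q ^ 2) × Finset (Fin (q ^ 2)) =>
        x.2.2.image fun k => ({k, x.1, x.2.1} : Finset (Fin (q ^ 2))) | #S = 8 * q}
  have h𝒜 : ∀ S ∈ 𝒜, #S = a.choose 3 := by
    simp only [𝒜, mem_image, mem_powersetCard_univ]
    rintro _ ⟨A, rfl, rfl⟩
    rw [card_powersetCard]
  have h𝒜card : #𝒜 ≤ (q ^ 2).choose a :=
    card_image_le.trans (by simp)
  have hℬ : ∀ S ∈ ℬ, #S = 8 * q := fun S hS => (mem_filter.1 hS).2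
  have hℬcard : #ℬ ≤ q ^ 2 * (q ^ 2 * (q ^ 2).choose (8 * q)) :=
    (card_filter_le _ _).trans (card_image_le.trans (by simp))
  obtain ⟨f, hf⟩ : ∃ f : Finset (Fin (q ^ 2)) → Fin q,
      ¬ ((∃ S ∈ 𝒜, ∀ s ∈ S, f s ∈ ({z}ᶜ : Finset (Fin q))) ∨
        ∃ S ∈ ℬ, ∀ s ∈ S, f s ∈ ({z} : Finset (Fin q))) := by
    by_contra! hcon
    have hsub : (univ : Finset (Finset (Fin (q ^ 2)) → Fin q)) ⊆
        ({f | ∃ S ∈ 𝒜, ∀ s ∈ S, f s ∈ ({z}ᶜ : Finset (Fin q))} : Finset _) ∪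
        ({f | ∃ S ∈ ℬ, ∀ s ∈ S, f s ∈ ({z} : Finset (Fin q))} : Finset _) := by
      intro f _
      rw [mem_union, mem_filter_univ, mem_filter_univ]
      exact hcon f
    have hcard := (card_le_card hsub).trans (card_union_le _ _)
    rw [card_univ, Fintype.card_fun, Fintype.card_fin] at hcard
    have h1 := card_functions_exists_mapsTo_le hq ({z}ᶜ : Finset (Fin q)) 𝒜 h𝒜
    have h2 := card_functions_exists_mapsTo_le hq ({z} : Finset (Fin q)) ℬ hℬ
    rw [card_compl, Fintype.card_fin, card_singleton] at h1
    rw [card_singleton, Nat.cast_one] at h2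
    have h3 : (#𝒜 : ℝ) * (((q - 1 : ℕ) : ℝ) / q) ^ a.choose 3 < 1 / 2 :=
      lt_of_le_of_lt (by gcongr) (choose_mul_one_sub_inv_pow_lt hq ha h)
    have h4 : (#ℬ : ℝ) * ((1 : ℝ) / q) ^ (8 * q) < 1 / 2 :=
      lt_of_le_of_lt (by gcongr) (sq_mul_choose_mul_inv_pow_lt hq)
    have hpos : (0 : ℝ) < (q : ℝ) ^ Fintype.card (Finset (Fin (q ^ 2))) := by positivity
    rify at hcard
    nlinarith
  push Not at hf
  obtain ⟨hf𝒜, hfℬ⟩ := hf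
  refine ⟨univ.filter fun e => #e = 3 ∧ f e = z, by simp +contextual, fun i j => ?_, fun A hA => ?_⟩
  · by_contra! hcon
    obtain ⟨W, hW, hWcard⟩ := exists_subset_card_eq hcon
    have hW' : ∀ k ∈ W, #{k, i, j} = 3 ∧ f {k, i, j} = z := fun k hk => by
      simpa using hW hk
    have hinj : Set.InjOn (fun k => ({k, i, j} : Finset (Fin (q ^ 2)))) W := by
      intro k hk l hl hkl
      have hk3 := (hW' k hk).1
      have hmem : k ∈ ({l, i, j} : Finset (Fin (q ^ 2))) := by
        rw [← show ({k, i, j} : Finset (Fin (q ^ 2))) = {l, i, j} from hkl]; simp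
      simp only [mem_insert, mem_singleton] at hmem
      rcases hmem with rfl | rfl | rfl
      · rfl
      · have := card_le_two (a := k) (b := j)
        simp at hk3
        omega
      · have := card_le_two (a := i) (b := k)
        simp at hk3
        omega
    obtain ⟨s, hs, hsf⟩ := hfℬ (W.image fun k => {k, i, j}) (by
      simp only [ℬ, mem_filter, mem_image, mem_product, mem_univ, true_and,
        mem_powersetCard_univ]
      exact ⟨⟨(i, j, W), hWcard, rfl⟩, by rw [card_image_of_injOn hinj, hWcard]⟩)
    obtain ⟨k, hk, rfl⟩ := mem_image.1 hs
    exact hsf (by simpa using (hW' k hk).2)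
  · obtain ⟨s, hs, hsf⟩ := hf𝒜 (powersetCard 3 A)
      (mem_image_of_mem _ (mem_powersetCard_univ.2 hA))
    rw [mem_powersetCard] at hs
    exact ⟨s, by simpa [hs.2] using hsf, hs.1⟩

lemma exists_map_card_fiber_le (n : ℕ) {m : ℕ} (hm : 0 < m) :
    ∃ π : Fin n → Fin m, ∀ i, #{v | π v = i} ≤ n / m + 1 := by
  refine ⟨fun v => ⟨v % m, Nat.mod_lt _ hm⟩, fun i => ?_⟩
  have hinj : Set.InjOn (fun v : Fin n => (v : ℕ) / m)
      ({v : Fin n | (⟨v % m, Nat.mod_lt _ hm⟩ : Fin m) = i} : Finset (Fin n)) := by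
    intro v hv w hw hvw
    simp only [coe_filter, mem_univ, true_and, Set.mem_ofPred_eq, Fin.ext_iff] at hv hw hvw
    rw [Fin.ext_iff, ← Nat.div_add_mod (v : ℕ) m, ← Nat.div_add_mod (w : ℕ) m, hv, hw, hvw]
  rw [← card_image_of_injOn hinj, ← card_range (n / m + 1)]
  refine card_le_card fun x hx => ?_
  obtain ⟨v, -, rfl⟩ := mem_image.1 hx
  exact mem_range.2 (Nat.lt_succ_of_le (Nat.div_le_div_right v.2.le))

/-- The complement of the blow-up of `R` along `π`, in which every triple inside a part is
added to the blow-up. -/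
def blowupCompl {n m : ℕ} (π : Fin n → Fin m) (R : Finset (Finset (Fin m))) :
    Finset (Finset (Fin n)) :=
  {e | #e = 3 ∧ e.image π ∉ R ∧ #(e.image π) ≠ 1}

lemma card_filter_insert_mem_le_degOn {n : ℕ} (E : Finset (Finset (Fin n)))
    {T : Finset (Fin n)} (hT : #T = 2) : #{w | w ∉ T ∧ insert w T ∈ E} ≤ degOn E 3 T := by
  rw [degOn, ← Set.ncard_coe_finset,
    ← Set.ncard_image_of_injective _ (singleton_injective (α := Fin n))]
  refine Set.ncard_le_ncard ?_ (Set.toFinite _)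
  rintro _ ⟨w, hw, rfl⟩
  simp only [coe_filter, mem_univ, true_and, Set.mem_ofPred_eq] at hw
  simpa [hT] using hw

lemma le_degOn_blowupCompl {n m K M : ℕ} {π : Fin n → Fin m} {R : Finset (Finset (Fin m))}
    (hπ : ∀ i, #{v | π v = i} ≤ M) (hR : ∀ e ∈ R, #e = 3) (hK : 0 < K)
    (hRK : ∀ i j, #{k | {k, i, j} ∈ R} < K) {T : Finset (Fin n)} (hT : #T = 2) :
    n ≤ degOn (blowupCompl π R) 3 T + 2 + K * M := by
  obtain ⟨u, v, huv, rfl⟩ := card_eq_two.1 hT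
  obtain ⟨N, hN, hbad⟩ : ∃ N : Finset (Fin m), #N ≤ K ∧ ∀ w : Fin n,
      (insert w {u, v} : Finset (Fin n)).image π ∈ R ∨
        #((insert w {u, v} : Finset (Fin n)).image π) = 1 → π w ∈ N := by
    simp only [image_insert, image_singleton]
    by_cases h : π u = π v
    · refine ⟨{π u}, by rwa [card_singleton], fun w hw => ?_⟩
      rcases hw with hw | hw
      · have h3 := hR _ hw
        rw [h, pair_eq_singleton] at h3
        have := card_le_two (a := π w) (b := π v)
        omega
      · obtain ⟨x, hx⟩ := card_eq_one.1 hw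
        have h1 : π w ∈ ({x} : Finset (Fin m)) := by rw [← hx]; simp
        have h2 : π u ∈ ({x} : Finset (Fin m)) := by rw [← hx]; simp
        simp_all
    · refine ⟨univ.filter fun k => {k, π u, π v} ∈ R, (hRK _ _).le, fun w hw => ?_⟩
      rcases hw with hw | hw
      · simpa using hw
      · have h2 := card_le_card (subset_insert (π w) {π u, π v})
        rw [card_pair h, hw] at h2
        omega
  have hcover : (univ : Finset (Fin n)) ⊆
      ({w | w ∉ ({u, v} : Finset (Fin n)) ∧ insert w {u, v} ∈ blowupCompl π R} : Finset _) ∪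
        {u, v} ∪ N.biUnion fun i => {w | π w = i} := by
    intro w _
    by_cases hw : w ∈ ({u, v} : Finset (Fin n))
    · exact mem_union_left _ (mem_union_right _ hw)
    by_cases hwN : π w ∈ N
    · exact mem_union_right _ (mem_biUnion.2 ⟨_, hwN, by simp⟩)
    refine mem_union_left _ (mem_union_left _ ?_)
    have := mt (hbad w) hwN
    push Not at this
    rw [mem_filter_univ, blowupCompl, mem_filter_univ, card_insert_of_notMem hw, hT]
    exact ⟨hw, rfl, this⟩
  have h1 := card_le_card hcover
  have h2 := card_filter_insert_mem_le_degOn (blowupCompl π R) hT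
  have h3 : #(N.biUnion fun i => ({w | π w = i} : Finset (Fin n))) ≤ K * M :=
    (card_biUnion_le_card_mul _ _ _ fun i _ => hπ i).trans (Nat.mul_le_mul_right _ hN)
  have h4 := card_union_le (({w | w ∉ ({u, v} : Finset (Fin n)) ∧
    insert w {u, v} ∈ blowupCompl π R} : Finset _) ∪ {u, v})
      (N.biUnion fun i => ({w | π w = i} : Finset (Fin n)))
  have h5 := card_union_le ({w | w ∉ ({u, v} : Finset (Fin n)) ∧
    insert w {u, v} ∈ blowupCompl π R} : Finset _) {u, v}
  rw [card_univ, Fintype.card_fin] at h1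
  omega

lemma not_isCopy_blowupCompl {n m t a : ℕ} {π : Fin n → Fin m} {R : Finset (Finset (Fin m))}
    (hR : ∀ e ∈ R, #e = 3) (hRa : ∀ A, #A = a → ∃ e ∈ R, e ⊆ A) (hta : 2 * a ≤ t + 1)
    (A : Finset (Fin n)) : ¬ IsCopy (blowupCompl π R) (cliqueEdges t 3) A := by
  rintro ⟨f, rfl, hf⟩
  have hgood : ∀ e ⊆ univ.map f, #e = 3 → e.image π ∉ R ∧ #(e.image π) ≠ 1 := by
    intro e he h3
    obtain ⟨e', -, rfl⟩ := subset_map_iff.1 he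
    rw [card_map] at h3
    have := hf e' (by simp [cliqueEdges, h3])
    rw [blowupCompl, mem_filter_univ] at this
    exact this.2
  have hfiber : ∀ i ∈ (univ.map f).image π, #{v ∈ univ.map f | π v = i} ≤ 2 := by
    intro i _
    by_contra! hcon
    obtain ⟨e, he, h3⟩ := exists_subset_card_eq (n := 3) hcon
    refine (hgood e (he.trans (filter_subset _ _)) h3).2 (card_eq_one.2 ⟨i, ?_⟩)
    have hne : e.Nonempty := card_pos.1 (by omega)
    rw [eq_singleton_iff_nonempty_unique_mem]
    refine ⟨hne.image π, fun x hx => ?_⟩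
    obtain ⟨v, hv, rfl⟩ := mem_image.1 hx
    exact (mem_filter.1 (he hv)).2
  have hcard := card_le_mul_card_image (univ.map f) 2 hfiber
  rw [card_map, card_univ, Fintype.card_fin] at hcard
  obtain ⟨B, hB, hBa⟩ := exists_subset_card_eq (s := (univ.map f).image π) (n := a) (by omega)
  obtain ⟨e, heR, heB⟩ := hRa B hBa
  obtain ⟨e', he', hinj, rfl⟩ := exists_subset_injOn_image_eq_of_surjOn
    (univ.map f : Finset (Fin n)) e (f := π) fun x hx => by
      simpa only [coe_image] using mem_coe.2 (hB (heB hx))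
  exact (hgood e' (coe_subset.1 he') (by rw [← hR _ heR, card_image_of_injOn hinj])).1 heR

lemma not_hasFactorOn_of_forall_not_isCopy {n : ℕ} {V : Type} [Fintype V] [DecidableEq V]
    (hn : 0 < n) {E : Finset (Finset (Fin n))} {EF : Finset (Finset V)}
    (h : ∀ A, ¬ IsCopy E EF A) : ¬ HasFactorOn E EF univ := by
  rintro ⟨P, hP, -, hU⟩
  obtain ⟨A, hA, -⟩ := mem_biUnion.1 (hU ▸ mem_univ (⟨0, hn⟩ : Fin n))
  exact h A (hP A hA)

lemma not_isCopy_empty {n t : ℕ} (ht : 3 ≤ t) (A : Finset (Fin n)) :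
    ¬ IsCopy ∅ (cliqueEdges t 3) A := by
  rintro ⟨f, -, hf⟩
  obtain ⟨e, -, he⟩ := exists_subset_card_eq (s := (univ : Finset (Fin t))) (n := 3) (by simpa)
  exact notMem_empty _ (hf e (by simp [cliqueEdges, he]))

lemma exists_sparse_parameter {t : ℕ} (ht : 4 ≤ t) (h : 10000 * Real.log t < (t : ℝ) ^ 2) :
    ∃ q : ℕ, 0 < q ∧ (t : ℝ) ^ 2 ≤ 480 * Real.log t * q ∧
      6 * q * (2 * Real.log q + 1) ≤ ((((t + 1) / 2 : ℕ) : ℝ) - 1) * (((t + 1) / 2 : ℕ) - 2) := by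
  have ht' : (4 : ℝ) ≤ t := by exact_mod_cast ht
  have hL : 1 ≤ Real.log t := by
    rw [Real.le_log_iff_exp_le (by linarith)]
    linarith [Real.exp_one_lt_d9]
  have ht100 : (100 : ℝ) ≤ t := by nlinarith
  set x : ℝ := (t : ℝ) ^ 2 / (240 * Real.log t) with hx
  have hxL : 240 * Real.log t * x = (t : ℝ) ^ 2 := by rw [hx]; field_simp
  have hx2 : 2 ≤ x := by
    rw [hx, le_div_iff₀ (by positivity)]; linarith
  have hqx : (⌊x⌋₊ : ℝ) ≤ x := Nat.floor_le (by linarith)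
  have hxq : x < ⌊x⌋₊ + 1 := Nat.lt_floor_add_one x
  set q := ⌊x⌋₊
  have hq1 : (1 : ℝ) < q := by linarith
  refine ⟨q, by exact_mod_cast zero_lt_one.trans hq1, by nlinarith, ?_⟩
  have hlog : Real.log q ≤ 2 * Real.log t := by
    have : Real.log q ≤ Real.log ((t : ℝ) ^ 2) :=
      Real.log_le_log (by linarith) (by nlinarith)
    simpa [Real.log_pow] using this
  have ha : (t : ℝ) / 2 ≤ ((t + 1) / 2 : ℕ) := by
    have : t ≤ (t + 1) / 2 * 2 := by omega
    have : (t : ℝ) ≤ ((t + 1) / 2 : ℕ) * 2 := by exact_mod_cast this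
    linarith
  calc 6 * q * (2 * Real.log q + 1) ≤ 6 * x * (5 * Real.log t) := by
        gcongr
        linarith
    _ = (t : ℝ) ^ 2 / 8 := by linarith
    _ ≤ (3 * t / 8) * (3 * t / 8) := by nlinarith
    _ ≤ _ := by gcongr <;> linarith

/-- Lower bound on the codegree threshold for `K_t³`-factors: there are 3-graphs with
minimum codegree at least `(1 - C log t / t²) n - 1` and no `K_t³`-factor. -/
theorem lower_bound_Kt3 :
    ∃ C : ℝ, 0 < C ∧ ∀ t : ℕ, 4 ≤ t →
      ∃ n₀ : ℕ, ∀ n : ℕ, n₀ ≤ n → t ∣ n →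
        ∃ E : Finset (Finset (Fin n)), (∀ e ∈ E, e.card = 3) ∧
          (∀ T : Finset (Fin n), T.card = 2 →
            (1 - C * Real.log t / (t : ℝ) ^ 2) * n - 1 ≤ (degOn E 3 T : ℝ)) ∧
          ¬ HasFactorOn E (cliqueEdges t 3) (Finset.univ : Finset (Fin n)) := by
  refine ⟨10000, by norm_num, fun t ht => ?_⟩
  have ht0 : (0 : ℝ) < (t : ℝ) ^ 2 := by positivity
  rcases le_or_gt ((t : ℝ) ^ 2) (10000 * Real.log t) with h | h
  · refine ⟨1, fun n hn _ => ⟨∅, by simp, fun T _ => ?_,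
      not_hasFactorOn_of_forall_not_isCopy hn (not_isCopy_empty (by omega))⟩⟩
    have h1 : 1 ≤ 10000 * Real.log t / (t : ℝ) ^ 2 := (one_le_div ht0).2 h
    have h2 : (0 : ℝ) ≤ degOn (∅ : Finset (Finset (Fin n))) 3 T := Nat.cast_nonneg _
    have h3 : (0 : ℝ) ≤ n := Nat.cast_nonneg _
    nlinarith
  · obtain ⟨q, hq, htq, hqa⟩ := exists_sparse_parameter ht h
    obtain ⟨R, hR, hRdeg, hRind⟩ := exists_sparse_triples hq (a := (t + 1) / 2)
      (by
        by_contra! hcon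
        have ht4 : t = 4 := by omega
        subst ht4
        have : 1 ≤ Real.log (4 : ℕ) := by
          rw [Real.le_log_iff_exp_le (by norm_num)]
          norm_num
          linarith [Real.exp_one_lt_d9]
        norm_num at h this
        linarith) hqa
    refine ⟨t ^ 2 * (8 * q + 1), fun n hn _ => ?_⟩
    obtain ⟨π, hπ⟩ := exists_map_card_fiber_le n (m := q ^ 2) (by positivity)
    refine ⟨blowupCompl π R, by simp +contextual [blowupCompl], fun T hT => ?_,
      not_hasFactorOn_of_forall_not_isCopy (lt_of_lt_of_le (by positivity) hn)
        (not_isCopy_blowupCompl hR hRind (by omega))⟩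
    have hdeg := le_degOn_blowupCompl hπ hR (by omega) hRdeg hT
    have hdiv : ((n / q ^ 2 : ℕ) : ℝ) ≤ n / (q : ℝ) ^ 2 := by
      exact_mod_cast Nat.cast_div_le (α := ℝ) (m := n) (n := q ^ 2)
    have hq' : (0 : ℝ) < q := by exact_mod_cast hq
    have hn' : (t : ℝ) ^ 2 * (8 * q + 1) ≤ n := by exact_mod_cast hn
    have hL : 1 ≤ Real.log t := by
      rw [Real.le_log_iff_exp_le (by positivity)]
      have : (4 : ℝ) ≤ t := by exact_mod_cast ht
      linarith [Real.exp_one_lt_d9]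
    have hdeg' : (n : ℝ) ≤
        degOn (blowupCompl π R) 3 T + 2 + 8 * q * (((n / q ^ 2 : ℕ) : ℝ) + 1) := by
      exact_mod_cast hdeg
    have h1 : 8 * (q : ℝ) * (n / (q : ℝ) ^ 2) ≤ 3840 * Real.log t / (t : ℝ) ^ 2 * n := by
      have : 8 * (q : ℝ) * (n / (q : ℝ) ^ 2) = 8 / q * n := by field_simp
      rw [this]
      gcongr ?_ * _
      rw [div_le_div_iff₀ hq' ht0]
      linarith
    have h2 : 8 * (q : ℝ) + 1 ≤ 6160 * Real.log t / (t : ℝ) ^ 2 * n := by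
      rw [div_mul_eq_mul_div, le_div_iff₀ ht0]
      nlinarith
    have h3 : 8 * (q : ℝ) * ((n / q ^ 2 : ℕ) : ℝ) ≤ 8 * q * (n / (q : ℝ) ^ 2) := by gcongr
    have h4 : 10000 * Real.log t / (t : ℝ) ^ 2 * n =
        3840 * Real.log t / (t : ℝ) ^ 2 * n + 6160 * Real.log t / (t : ℝ) ^ 2 * n := by ring
    linarith
end

section
/- For all integers k, m ≥ 2 and every constant α > 0, there exist a constant η = η(α, k, m) > 0 and an integer n₀ = n₀(α, k, m) such that for every k-graph H on n ≥ n₀ vertices and all vertices x, y ∈ V(H): if the pair (x, y) is α-good in H, then x and y are (K_k^k(m), 1, η)-close to each other. -/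
open Finset

/-- A `(k-1)`-set `S` is `α`-good for the vertices `x` and `y`. -/
def AlphaGoodSet {n : ℕ} (E : Finset (Finset (Fin n))) (k : ℕ) (α : ℝ) (x y : Fin n)
    (S : Finset (Fin n)) : Prop :=
  S.card = k - 1 ∧ x ∉ S ∧ y ∉ S ∧ α * (n : ℝ) ≤ (degOn E k S : ℝ) ∧
    insert x S ∈ E ∧ insert y S ∈ E

/-- The pair `(x,y)` is `α`-good. -/
def AlphaGoodPair {n : ℕ} (E : Finset (Finset (Fin n))) (k : ℕ) (α : ℝ) (x y : Fin n) :
    Prop :=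
  α * (n.choose (k - 1) : ℝ) ≤ (({S : Finset (Fin n) | AlphaGoodSet E k α x y S}).ncard : ℝ)

/-- The maps from the vertices of the complete partite hypergraph with `d` parts of size `m`,
all of whose transversals land in the family `P` of `d`-tuples. -/
def blowupHoms {α : Type*} [Fintype α] [DecidableEq α] {d : ℕ} (m : ℕ)
    (P : Finset (Fin d → α)) : Finset (Fin d → Fin m → α) :=
  univ.filter fun g => ∀ φ : Fin d → Fin m, (fun i => g i (φ i)) ∈ P

lemma card_eq_sum_card_cons {β : Type*} [Fintype β] [DecidableEq β] {d : ℕ}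
    (A : Finset (Fin (d + 1) → β)) :
    #A = ∑ b : β, #{f : Fin d → β | (Fin.cons b f : Fin (d + 1) → β) ∈ A} := by
  have h : #A = ∑ h : Fin (d + 1) → β, if h ∈ A then 1 else 0 := by simp
  rw [h, ← Equiv.sum_comp (Fin.consEquiv fun _ => β), Fintype.sum_prod_type]
  refine sum_congr rfl fun b _ => ?_
  rw [card_filter]
  rfl

lemma sum_card_filter_comm {β γ : Type*} [Fintype β] [Fintype γ] (r : β → γ → Prop)
    [∀ b c, Decidable (r b c)] :
    ∑ b : β, #{c : γ | r b c} = ∑ c : γ, #{b : β | r b c} := by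
  simp only [card_filter]
  exact sum_comm

lemma div_card_pow_le {β : Type*} [Fintype β] [Nonempty β] (z : β → ℝ) (hz : ∀ b, 0 ≤ z b)
    (m : ℕ) :
    ((∑ b, z b) / Fintype.card β) ^ m ≤ (∑ b, z b ^ m) / Fintype.card β := by
  have hc : (Fintype.card β : ℝ) ≠ 0 := by simp
  have := Real.pow_arith_mean_le_arith_mean_pow univ (fun _ : β => (Fintype.card β : ℝ)⁻¹) z
    (fun _ _ => by positivity) (by simp [hc]) (fun b _ => hz b) m
  simpa only [← mul_sum, div_eq_inv_mul] using this

/-- The tuple density of the complete `d`-partite hypergraph with parts of size `m` in `P` is at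
least the density of `P` raised to its number of edges. -/
lemma density_pow_le_blowupHoms {α : Type*} [Fintype α] [DecidableEq α] [Nonempty α] (m : ℕ)
    {d : ℕ} (P : Finset (Fin d → α)) :
    ((#P : ℝ) / (Fintype.card α : ℝ) ^ d) ^ m ^ d ≤
      #(blowupHoms m P) / (Fintype.card α : ℝ) ^ (m * d) := by
  induction d with
  | zero =>
    simp only [pow_zero, div_one, mul_zero, pow_one, Nat.cast_le]
    refine card_le_card_of_injOn (fun _ i => i.elim0) (fun p hp => ?_)
      (fun p _ q _ _ => Subsingleton.elim _ _)
    simp only [blowupHoms, coe_filter, mem_univ, true_and, Set.mem_ofPred_eq]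
    intro φ
    rwa [Subsingleton.elim (fun i : Fin 0 => _) p]
  | succ d ih =>
    have hN : (Fintype.card α : ℝ) ≠ 0 := by simp
    set N : ℝ := (Fintype.card α : ℝ) with hNdef
    have hN0 : 0 < N := by positivity
    let link : (Fin m → α) → Finset (Fin d → α) := fun y =>
      univ.filter fun f => ∀ j, (Fin.cons (y j) f : Fin (d + 1) → α) ∈ P
    let deg : (Fin d → α) → ℕ := fun f => #{a : α | (Fin.cons a f : Fin (d + 1) → α) ∈ P}
    have h1 : #P = ∑ f, deg f := by
      rw [card_eq_sum_card_cons, sum_card_filter_comm]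
    have h2 : ∑ y, #(link y) = ∑ f, deg f ^ m := by
      rw [sum_card_filter_comm]
      refine sum_congr rfl fun f _ => ?_
      rw [← Fintype.card_piFinset_const]
      congr 1
      ext y
      simp
    have h3 : #(blowupHoms m P) = ∑ y, #(blowupHoms m (link y)) := by
      rw [card_eq_sum_card_cons]
      refine sum_congr rfl fun y _ => ?_
      congr 1
      ext g
      simp only [blowupHoms, link, mem_filter, mem_univ, true_and]
      constructor
      · intro h φ j
        convert h (Fin.cons j φ) using 1
        ext i
        refine Fin.cases ?_ (fun i => ?_) i <;> simp
      · intro h φ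
        convert h (fun i => φ i.succ) (φ 0) using 1
        ext i
        refine Fin.cases ?_ (fun i => ?_) i <;> simp
    have hcd : (Fintype.card (Fin d → α) : ℝ) = N ^ d := by simp [hNdef]
    have hcm : (Fintype.card (Fin m → α) : ℝ) = N ^ m := by simp [hNdef]
    have e1 : (#P : ℝ) / N ^ (d + 1) = (∑ f, (deg f : ℝ) / N) / N ^ d := by
      rw [h1, ← sum_div, pow_succ', div_div, Nat.cast_sum]
    have e2 : (∑ y, (#(link y) : ℝ) / N ^ d) / N ^ m = (∑ f, ((deg f : ℝ) / N) ^ m) / N ^ d := by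
      have h2' : ∑ y, (#(link y) : ℝ) = ∑ f, (deg f : ℝ) ^ m := mod_cast h2
      simp only [div_pow]
      rw [← sum_div, ← sum_div, h2', div_right_comm]
    have e3 : (#(blowupHoms m P) : ℝ) / N ^ (m * (d + 1)) =
        (∑ y, (#(blowupHoms m (link y)) : ℝ) / N ^ (m * d)) / N ^ m := by
      rw [h3, ← sum_div, mul_add, mul_one, pow_add, div_div, Nat.cast_sum]
    have j1 := div_card_pow_le (fun f => (deg f : ℝ) / N) (fun f => by positivity) m
    have j2 := div_card_pow_le (fun y => (#(link y) : ℝ) / N ^ d) (fun y => by positivity) (m ^ d)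
    rw [hcd] at j1
    rw [hcm] at j2
    calc ((#P : ℝ) / N ^ (d + 1)) ^ m ^ (d + 1)
        = (((∑ f, (deg f : ℝ) / N) / N ^ d) ^ m) ^ m ^ d := by rw [e1, ← pow_mul, pow_succ' m d]
      _ ≤ ((∑ f, ((deg f : ℝ) / N) ^ m) / N ^ d) ^ m ^ d :=
        pow_le_pow_left₀ (pow_nonneg (div_nonneg
          (sum_nonneg fun f _ => div_nonneg (Nat.cast_nonneg _) hN0.le)
          (pow_nonneg hN0.le _)) _) j1 _
      _ = ((∑ y, (#(link y) : ℝ) / N ^ d) / N ^ m) ^ m ^ d := by rw [e2]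
      _ ≤ _ := j2
      _ ≤ (∑ y, (#(blowupHoms m (link y)) : ℝ) / N ^ (m * d)) / N ^ m :=
        div_le_div_of_nonneg_right (sum_le_sum fun y _ => ih (link y)) (pow_nonneg hN0.le _)
      _ = _ := e3.symm

lemma card_not_injective_le {V α : Type*} [Fintype V] [DecidableEq V] [Fintype α]
    [DecidableEq α] :
    #{f : V → α | ¬ Function.Injective f} ≤
      Fintype.card V ^ 2 * Fintype.card α ^ (Fintype.card V - 1) := by
  have hsub : ({f : V → α | ¬ Function.Injective f} : Finset (V → α)) ⊆
      (univ.offDiag : Finset (V × V)).biUnion fun p => {f : V → α | f p.1 = f p.2} := by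
    intro f hf
    simp only [mem_filter, mem_univ, true_and] at hf
    rw [Function.Injective] at hf
    push Not at hf
    obtain ⟨a, b, hab, hne⟩ := hf
    simp only [mem_biUnion, mem_offDiag, mem_univ, true_and, mem_filter]
    exact ⟨(a, b), hne, hab⟩
  refine (card_le_card hsub).trans ((card_biUnion_le_card_mul _ _
    (Fintype.card α ^ (Fintype.card V - 1)) ?_).trans (Nat.mul_le_mul_right _ ?_))
  · rintro ⟨a, b⟩ hab
    simp only [mem_offDiag, mem_univ, true_and] at hab
    have hc : Fintype.card α ^ (Fintype.card V - 1) =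
        #(univ : Finset ({r : V // r ≠ b} → α)) := by
      rw [card_univ, Fintype.card_fun, Fintype.card_subtype_compl, Fintype.card_subtype_eq]
    rw [hc]
    refine card_le_card_of_injOn (fun f r => f r) (fun _ _ => by simp) ?_
    intro f hf f' hf' h
    simp only [coe_filter, mem_univ, true_and, Set.mem_ofPred_eq] at hf hf'
    have h' : ∀ r, r ≠ b → f r = f' r := fun r hr => congrFun h ⟨r, hr⟩
    funext r
    by_cases hr : r = b
    · rw [hr, ← hf, ← hf', h' a hab]
    · exact h' r hr
  · rw [offDiag_card, card_univ, sq]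
    exact Nat.sub_le _ _

lemma card_image_erase_eq_le {V α : Type*} [Fintype V] [DecidableEq V] [Fintype α]
    [DecidableEq α] (v : V) (S : Finset α) :
    #{f : V → α | (univ.erase v).image f = S} ≤
      Fintype.card α * #S ^ (Fintype.card V - 1) := by
  have hsub : ({f : V → α | (univ.erase v).image f = S} : Finset (V → α)) ⊆
      Fintype.piFinset fun r => if r = v then univ else S := by
    intro f hf
    simp only [mem_filter, mem_univ, true_and] at hf
    rw [Fintype.mem_piFinset]
    intro r
    split_ifs with hr
    · exact mem_univ _
    · rw [← hf]
      exact mem_image_of_mem f (by simpa using hr)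
  refine (card_le_card hsub).trans (le_of_eq ?_)
  rw [Fintype.card_piFinset, ← mul_prod_erase univ _ (mem_univ v), if_pos rfl, card_univ]
  congr 1
  rw [prod_congr rfl (g := fun _ => #S) fun r hr => by rw [if_neg (ne_of_mem_erase hr)],
    prod_const, card_erase_of_mem (mem_univ v), card_univ]

/-- A family of maps is controlled by the images of its injective members with one vertex
left out. -/
lemma card_le_of_image_erase_mem {V α : Type*} [Fintype V] [DecidableEq V] [Fintype α]
    [DecidableEq α] (v : V) (T : Finset (V → α)) (C : Finset (Finset α))
    (hC : ∀ S ∈ C, #S = Fintype.card V - 1)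
    (hT : ∀ f ∈ T, Function.Injective f → (univ.erase v).image f ∈ C) :
    #T ≤ Fintype.card V ^ 2 * Fintype.card α ^ (Fintype.card V - 1) +
      #C * (Fintype.card α * (Fintype.card V - 1) ^ (Fintype.card V - 1)) := by
  have hsub : T ⊆ ({f : V → α | ¬ Function.Injective f} : Finset (V → α)) ∪
      C.biUnion fun S => {f : V → α | (univ.erase v).image f = S} := by
    intro f hf
    by_cases h : Function.Injective f
    · exact mem_union_right _ (mem_biUnion.2 ⟨_, hT f hf h, by simp⟩)
    · exact mem_union_left _ (by simpa using h)
  refine (card_le_card hsub).trans ((card_union_le _ _).trans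
    (add_le_add card_not_injective_le (card_biUnion_le_card_mul _ _ _ fun S hS => ?_)))
  rw [← hC S hS]
  convert card_image_erase_eq_le v S using 3
  exact hC S hS

open Classical in
/-- The tuples whose tail enumerates an `α`-good set for `x` and `y`, and whose head is a further
vertex completing that set to an edge. -/
noncomputable def goodTuples {n : ℕ} (E : Finset (Finset (Fin n))) (d : ℕ) (α : ℝ)
    (x y : Fin n) : Finset (Fin (d + 1) → Fin n) :=
  univ.filter fun f => AlphaGoodSet E (d + 1) α x y (univ.image (Fin.tail f)) ∧
    f 0 ≠ x ∧ f 0 ≠ y ∧ insert (f 0) (univ.image (Fin.tail f)) ∈ E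

lemma mem_goodTuples {n : ℕ} {E : Finset (Finset (Fin n))} {d : ℕ} {α : ℝ} {x y : Fin n}
    {f : Fin (d + 1) → Fin n} :
    f ∈ goodTuples E d α x y ↔ AlphaGoodSet E (d + 1) α x y (univ.image (Fin.tail f)) ∧
      f 0 ≠ x ∧ f 0 ≠ y ∧ insert (f 0) (univ.image (Fin.tail f)) ∈ E := by
  simp [goodTuples]

lemma le_card_goodTuples {n : ℕ} {E : Finset (Finset (Fin n))} {d : ℕ} {α : ℝ} {x y : Fin n}
    (hn : 0 ≤ α * n - 2) (h : AlphaGoodPair E (d + 1) α x y) :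
    α * n.choose d * (α * n - 2) ≤ #(goodTuples E d α x y) := by
  classical
  let G : Finset (Finset (Fin n)) := univ.filter (AlphaGoodSet E (d + 1) α x y)
  let nb : Finset (Fin n) → Finset (Fin n) := fun S =>
    univ.filter fun v => v ≠ x ∧ v ≠ y ∧ insert v S ∈ E
  have hG : α * n.choose d ≤ #G := by
    have h' := h
    unfold AlphaGoodPair at h'
    rw [Nat.add_sub_cancel] at h'
    convert h'
    rw [← Set.ncard_coe_finset]
    simp [G]
  have hnb : ∀ S ∈ G, α * n - 2 ≤ #(nb S) := by
    intro S hS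
    obtain ⟨hc, -, -, hdeg, -, -⟩ := (mem_filter.1 hS).2
    have : degOn E (d + 1) S ≤ #(nb S) + 2 := by
      have hsub : {S' : Finset (Fin n) | #S' = d + 1 - #S ∧ Disjoint S' S ∧ S' ∪ S ∈ E} ⊆
          ((nb S ∪ {x, y}).image fun v => ({v} : Finset (Fin n)) :
            Finset (Finset (Fin n))) := by
        rintro S' ⟨h1, -, h3⟩
        rw [hc, Nat.add_sub_cancel, Nat.add_sub_cancel_left, card_eq_one] at h1
        obtain ⟨v, rfl⟩ := h1
        simp only [coe_image, Set.mem_image, mem_coe]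
        refine ⟨v, ?_, rfl⟩
        simp only [nb, mem_union, mem_filter, mem_univ, true_and, mem_insert, mem_singleton]
        rw [← insert_eq] at h3
        tauto
      refine (Set.ncard_le_ncard hsub (finite_toSet _)).trans ?_
      rw [Set.ncard_coe_finset]
      exact card_image_le.trans ((card_union_le _ _).trans (by gcongr; exact card_le_two))
    have : (degOn E (d + 1) S : ℝ) ≤ #(nb S) + 2 := mod_cast this
    linarith
  have henum : ∀ S : Finset (Fin n), ∃ t : Fin d → Fin n, #S = d → univ.image t = S := by
    intro S
    by_cases hS : #S = d
    · refine ⟨S.orderEmbOfFin hS, fun _ => ?_⟩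
      apply coe_injective
      simp
    · exact ⟨fun _ => x, fun h => absurd h hS⟩
  choose t ht using henum
  have hcard : ∑ S ∈ G, #(nb S) ≤ #(goodTuples E d α x y) := by
    rw [← card_sigma]
    have hGd : ∀ S ∈ G, #S = d := fun S hS => (mem_filter.1 hS).2.1
    refine card_le_card_of_injOn (fun p => (Fin.cons p.2 (t p.1) : Fin (d + 1) → Fin n)) ?_ ?_
    · rintro ⟨S, v⟩ hp
      obtain ⟨hS, hv⟩ := mem_sigma.1 hp
      refine mem_coe.2 (mem_goodTuples.2 ?_)
      simp only [Fin.tail_cons, Fin.cons_zero]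
      rw [ht S (hGd S hS)]
      exact ⟨(mem_filter.1 hS).2, (mem_filter.1 hv).2⟩
    · rintro ⟨S, v⟩ hp ⟨S', v'⟩ hp' heq
      obtain ⟨hS, -⟩ := mem_sigma.1 hp
      obtain ⟨hS', -⟩ := mem_sigma.1 hp'
      obtain ⟨rfl, h2⟩ := Fin.cons_injective2 heq
      have : S = S' := by rw [← ht S (hGd S hS), ← ht S' (hGd S' hS'), h2]
      rw [this]
  calc α * n.choose d * (α * n - 2) ≤ #G * (α * n - 2) := by gcongr
    _ = ∑ S ∈ G, (α * n - 2) := by rw [sum_const, nsmul_eq_mul]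
    _ ≤ ∑ S ∈ G, (#(nb S) : ℝ) := sum_le_sum hnb
    _ ≤ _ := mod_cast hcard

lemma exists_map_eq_image_of_mem_multipartiteEdges {n k m : ℕ} (f : Fin k × Fin m ↪ Fin n)
    {e : Finset (Fin k × Fin m)} (he : e ∈ multipartiteEdges k m) :
    ∃ φ : Fin k → Fin m, e.map f = univ.image fun i => f (i, φ i) := by
  simp only [multipartiteEdges, mem_filter, mem_univ, true_and, card_eq_one] at he
  choose v hv using he
  have hv' : ∀ i, v i ∈ e ∧ (v i).1 = i := fun i => by
    have : v i ∈ e.filter fun w => w.1 = i := by rw [hv i]; exact mem_singleton_self _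
    simpa using this
  refine ⟨fun i => (v i).2, ?_⟩
  have : e = univ.image fun i => (i, (v i).2) := by
    ext w
    simp only [mem_image, mem_univ, true_and]
    constructor
    · intro hw
      refine ⟨w.1, ?_⟩
      have : w ∈ e.filter fun w' => w'.1 = w.1 := by simpa using hw
      rw [hv, mem_singleton] at this
      rw [← this]
    · rintro ⟨i, rfl⟩
      convert (hv' i).1
      exact (hv' i).2.symm
  conv_lhs => rw [this]
  rw [map_eq_image, image_image]
  rfl

/-- Moving the vertex `(0, j)` of an injective blow-up of good tuples to `z ∈ {x, y}` still gives
a copy of the complete partite hypergraph. -/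
lemma hasFactorOn_insert {n d m : ℕ} {E : Finset (Finset (Fin n))} {α : ℝ} {x y z : Fin n}
    (j : Fin m) (f : Fin (d + 1) × Fin m → Fin n) (hf : Function.Injective f)
    (hP : ∀ φ : Fin (d + 1) → Fin m, (fun i => f (i, φ i)) ∈ goodTuples E d α x y)
    (hz : z = x ∨ z = y) (hzS : z ∉ (univ.erase (0, j)).image f) :
    HasFactorOn E (multipartiteEdges (d + 1) m)
      (insert z ((univ.erase (0, j)).image f)) := by
  refine ⟨{insert z ((univ.erase (0, j)).image f)}, ?_, by simp, by simp⟩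
  simp only [mem_singleton, forall_eq]
  have hne : ∀ w, w ≠ (0, j) → f w ≠ z := fun w hw h =>
    hzS (h ▸ mem_image_of_mem f (by simpa using hw))
  have hup : ∀ w, w ≠ (0, j) → Function.update f (0, j) z w = f w := fun w hw =>
    Function.update_of_ne hw _ _
  have hinj : Function.Injective (Function.update f (0, j) z) := by
    intro a b hab
    by_cases ha : a = (0, j) <;> by_cases hb : b = (0, j)
    · rw [ha, hb]
    · rw [ha, hup b hb, Function.update_self] at hab
      exact absurd hab.symm (hne b hb)
    · rw [hb, hup a ha, Function.update_self] at hab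
      exact absurd hab (hne a ha)
    · rw [hup a ha, hup b hb] at hab
      exact hf hab
  refine ⟨⟨_, hinj⟩, ?_, fun e he => ?_⟩
  · rw [map_eq_image, Function.Embedding.coeFn_mk, ← insert_erase (mem_univ (0, j)),
      image_insert, Function.update_self, erase_insert (by simp)]
    congr 1
    exact image_congr fun w hw => hup w (ne_of_mem_erase hw)
  · obtain ⟨φ, hφ⟩ := exists_map_eq_image_of_mem_multipartiteEdges _ he
    rw [hφ, Function.Embedding.coeFn_mk]
    obtain ⟨⟨-, -, -, -, hx, hy⟩, -, -, h0⟩ := mem_goodTuples.1 (hP φ)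
    have hsplit : (univ.image fun i => Function.update f (0, j) z (i, φ i)) =
        insert (Function.update f (0, j) z (0, φ 0))
          (univ.image (Fin.tail fun i => f (i, φ i))) := by
      rw [Fin.univ_succ, cons_eq_insert, image_insert, map_eq_image, image_image]
      congr 1
    rw [hsplit]
    by_cases hj : φ 0 = j
    · rw [hj, Function.update_self]
      rcases hz with rfl | rfl
      exacts [hx, hy]
    · rwa [hup _ (by simpa using hj)]

lemma ne_of_forall_mem_goodTuples {n d m : ℕ} {E : Finset (Finset (Fin n))} {α : ℝ}
    {x y : Fin n} {f : Fin (d + 1) × Fin m → Fin n}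
    (hP : ∀ φ : Fin (d + 1) → Fin m, (fun i => f (i, φ i)) ∈ goodTuples E d α x y)
    (w : Fin (d + 1) × Fin m) : f w ≠ x ∧ f w ≠ y := by
  obtain ⟨i, j⟩ := w
  obtain ⟨⟨-, hx, hy, -⟩, hx0, hy0, -⟩ := mem_goodTuples.1 (hP fun _ => j)
  induction i using Fin.cases with
  | zero => exact ⟨hx0, hy0⟩
  | succ i =>
    have hi : f (i.succ, j) ∈ univ.image (Fin.tail fun i => f (i, j)) :=
      mem_image.2 ⟨i, mem_univ _, rfl⟩
    exact ⟨fun h => hx (h ▸ hi), fun h => hy (h ▸ hi)⟩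

lemma card_blowupHoms_goodTuples_le {n d m : ℕ} (hm : 0 < m) (E : Finset (Finset (Fin n)))
    (α : ℝ) (x y : Fin n) :
    #(blowupHoms m (goodTuples E d α x y)) ≤
      ((d + 1) * m) ^ 2 * n ^ ((d + 1) * m - 1) +
      ({S : Finset (Fin n) | #S = (d + 1) * m - 1 ∧ x ∉ S ∧ y ∉ S ∧
        HasFactorOn E (multipartiteEdges (d + 1) m) (insert x S) ∧
        HasFactorOn E (multipartiteEdges (d + 1) m) (insert y S)}).ncard *
      (n * ((d + 1) * m - 1) ^ ((d + 1) * m - 1)) := by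
  classical
  set C : Finset (Finset (Fin n)) := univ.filter fun S => #S = (d + 1) * m - 1 ∧ x ∉ S ∧ y ∉ S ∧
    HasFactorOn E (multipartiteEdges (d + 1) m) (insert x S) ∧
    HasFactorOn E (multipartiteEdges (d + 1) m) (insert y S) with hC
  have hncard : ({S : Finset (Fin n) | #S = (d + 1) * m - 1 ∧ x ∉ S ∧ y ∉ S ∧
      HasFactorOn E (multipartiteEdges (d + 1) m) (insert x S) ∧
      HasFactorOn E (multipartiteEdges (d + 1) m) (insert y S)}).ncard = #C := by
    rw [← Set.ncard_coe_finset, hC]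
    simp
  have hV : Fintype.card (Fin (d + 1) × Fin m) = (d + 1) * m := by simp
  have key := card_le_of_image_erase_mem ((0, ⟨0, hm⟩) : Fin (d + 1) × Fin m)
    ((blowupHoms m (goodTuples E d α x y)).map
      (Equiv.curry (Fin (d + 1)) (Fin m) (Fin n)).symm.toEmbedding) C
    (fun S hS => by rw [hV]; exact (mem_filter.1 hS).2.1) ?_
  · rwa [card_map, hV, Fintype.card_fin, ← hncard] at key
  · intro f hf hinj
    obtain ⟨g, hg, rfl⟩ := mem_map.1 hf
    have hP := (mem_filter.1 hg).2
    have hxy := ne_of_forall_mem_goodTuples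
      (f := (Equiv.curry (Fin (d + 1)) (Fin m) (Fin n)).symm g) hP
    have hx : x ∉ (univ.erase (0, ⟨0, hm⟩)).image
        ((Equiv.curry (Fin (d + 1)) (Fin m) (Fin n)).symm g) := fun h => by
      obtain ⟨w, -, hw⟩ := mem_image.1 h
      exact (hxy w).1 hw
    have hy : y ∉ (univ.erase (0, ⟨0, hm⟩)).image
        ((Equiv.curry (Fin (d + 1)) (Fin m) (Fin n)).symm g) := fun h => by
      obtain ⟨w, -, hw⟩ := mem_image.1 h
      exact (hxy w).2 hw
    refine mem_filter.2 ⟨mem_univ _, ?_, hx, hy,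
      hasFactorOn_insert _ _ hinj hP (Or.inl rfl) hx,
      hasFactorOn_insert _ _ hinj hP (Or.inr rfl) hy⟩
    rw [card_image_of_injective _ hinj, card_erase_of_mem (mem_univ _), card_univ, hV]

lemma CloseTo.symm {n : ℕ} {V : Type} [Fintype V] [DecidableEq V] {E : Finset (Finset (Fin n))}
    {EF : Finset (Finset V)} {i : ℕ} {η : ℝ} {x y : Fin n} (h : CloseTo E EF i η x y) :
    CloseTo E EF i η y x := by
  unfold CloseTo at h ⊢
  convert h using 5
  tauto

lemma le_card_goodTuples_of_large {n : ℕ} {E : Finset (Finset (Fin n))} {d : ℕ} {α : ℝ}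
    {x y : Fin n} (hα : 0 < α) (hn : 4 ≤ α * n) (hd : 2 * d ≤ n)
    (h : AlphaGoodPair E (d + 1) α x y) :
    α ^ 2 / (2 ^ (d + 1) * d.factorial) * (n : ℝ) ^ (d + 1) ≤ #(goodTuples E d α x y) := by
  have hchoose : ((n : ℝ) / 2) ^ d / d.factorial ≤ n.choose d := by
    refine le_trans ?_ (Nat.pow_le_choose d n)
    have : (n : ℝ) / 2 ≤ ((n + 1 - d : ℕ) : ℝ) := by
      have h' : n ≤ 2 * (n + 1 - d) := by omega
      have : (n : ℝ) ≤ 2 * ((n + 1 - d : ℕ) : ℝ) := mod_cast h'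
      linarith
    gcongr
  calc α ^ 2 / (2 ^ (d + 1) * d.factorial) * (n : ℝ) ^ (d + 1)
      = α * (((n : ℝ) / 2) ^ d / d.factorial) * (α * n / 2) := by
        rw [div_pow, pow_succ 2 d, pow_succ _ d]
        field_simp
    _ ≤ α * n.choose d * (α * n - 2) := by
        gcongr
        linarith
    _ ≤ _ := le_card_goodTuples (by linarith) h

/-- If `(x,y)` is an `α`-good pair, then `x` and `y` are `(K_k^k(m), 1, η)`-close to each
other. -/
theorem alpha_good_implies_close (k m : ℕ) (hk : 2 ≤ k) (hm : 2 ≤ m) (α : ℝ) (hα : 0 < α) :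
    ∃ η : ℝ, 0 < η ∧ ∃ n₀ : ℕ, ∀ n : ℕ, n₀ ≤ n →
      ∀ E : Finset (Finset (Fin n)), (∀ e ∈ E, e.card = k) →
      ∀ x y : Fin n, AlphaGoodPair E k α x y →
      CloseTo E (multipartiteEdges k m) 1 η x y ∧
      CloseTo E (multipartiteEdges k m) 1 η y x := by
  obtain ⟨d, rfl⟩ : ∃ d, k = d + 1 := ⟨k - 1, by omega⟩
  set M := (d + 1) * m with hM
  have hM2 : 2 ≤ M := by nlinarith
  obtain ⟨r, hr⟩ : ∃ r, M = r + 1 := ⟨M - 1, by omega⟩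
  have hr0 : 0 < r := by omega
  set c : ℝ := (α ^ 2 / (2 ^ (d + 1) * d.factorial)) ^ m ^ (d + 1) with hc
  have hc0 : 0 < c := by positivity
  refine ⟨c / (2 * r ^ r), by positivity,
    max (2 * d + 1) (max ⌈4 / α⌉₊ ⌈2 * (M : ℝ) ^ 2 / c⌉₊), fun n hn E _ x y h => ?_⟩
  suffices hclose : CloseTo E (multipartiteEdges (d + 1) m) 1 (c / (2 * r ^ r)) x y from
    ⟨hclose, hclose.symm⟩
  simp only [max_le_iff, Nat.ceil_le] at hn
  obtain ⟨hn1, hn2, hn3⟩ := hn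
  have hn0 : (0 : ℝ) < n := by
    have : 0 < n := by omega
    exact_mod_cast this
  have : Nonempty (Fin n) := ⟨x⟩
  rw [div_le_iff₀ hα] at hn2
  rw [div_le_iff₀ hc0] at hn3
  have hP := le_card_goodTuples_of_large hα (by linarith) (by omega) h
  have hhom := density_pow_le_blowupHoms m (goodTuples E d α x y)
  rw [Fintype.card_fin, mul_comm m, ← hM] at hhom
  have hcle : c ≤ #(blowupHoms m (goodTuples E d α x y)) / (n : ℝ) ^ M := by
    refine le_trans ?_ hhom
    rw [hc]
    refine pow_le_pow_left₀ (by positivity) ?_ _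
    rwa [le_div_iff₀ (by positivity)]
  rw [le_div_iff₀ (by positivity)] at hcle
  have hup := card_blowupHoms_goodTuples_le (d := d) (m := m) (by omega) E α x y
  unfold CloseTo
  simp only [Fintype.card_prod, Fintype.card_fin, one_mul]
  rw [← hM, hr, Nat.add_sub_cancel] at hup ⊢
  set K := ({S : Finset (Fin n) | #S = r ∧ x ∉ S ∧ y ∉ S ∧
        HasFactorOn E (multipartiteEdges (d + 1) m) (insert x S) ∧
        HasFactorOn E (multipartiteEdges (d + 1) m) (insert y S)}).ncard
  have hup' : (#(blowupHoms m (goodTuples E d α x y)) : ℝ) ≤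
      ((r : ℝ) + 1) ^ 2 * (n : ℝ) ^ r + K * (n * (r : ℝ) ^ r) := mod_cast hup
  rw [hr] at hcle hn3
  push_cast at hn3
  have hnr : (0 : ℝ) < (n : ℝ) ^ r := by positivity
  have h1 : c * (n : ℝ) ^ r * n ≤ ((r : ℝ) + 1) ^ 2 * (n : ℝ) ^ r + K * (n * (r : ℝ) ^ r) := by
    refine le_trans (le_of_eq ?_) (hcle.trans hup')
    rw [pow_succ, mul_assoc]
  have h2 : 2 * (((r : ℝ) + 1) ^ 2 * (n : ℝ) ^ r) ≤ c * (n : ℝ) ^ r * n := by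
    nlinarith [mul_le_mul_of_nonneg_right hn3 hnr.le]
  have h3 : c * (n : ℝ) ^ r * n ≤ K * (2 * (r : ℝ) ^ r) * n := by linarith
  rw [div_mul_eq_mul_div, div_le_iff₀ (by positivity)]
  exact le_of_mul_le_mul_right h3 hn0
end
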